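/- For every integer n > 1, the Ramanujan tau value τ(n) does not lie in the set {−9, 15, −15, 21, −21, −25, −27, −33, 35, −35, 45, −45, 49, −49, −55, 63, −63, 77, −77, −81, 91, −91}. -/

import Mathlib

/-- The Ramanujan tau function: `τ(n)` is the coefficient of `X^n` in
`X * ∏_{m=1}^{n} (1 - X^m)^24` over `ℤ`. -/
noncomputable def ramanujanTau (n : ℕ) : ℤ :=
  (Polynomial.X * ∏ m ∈ Finset.Icc 1 n, (1 - Polynomial.X ^ m) ^ 24).coeff n

namespace RamanujanTau

open Polynomial NumberField

section Units

/-- In an integral extension of `ℤ` embedded in a number field, any family of units with more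
members than the unit rank is multiplicatively dependent. -/
theorem exists_prod_zpow_eq_one {R K ι : Type*} [CommRing R] [Algebra.IsIntegral ℤ R]
    [Field K] [NumberField K] [Fintype ι] (φ : R →+* K) (hφ : Function.Injective φ)
    (hι : Units.rank K < Fintype.card ι) (u : ι → Rˣ) :
    ∃ n : ι → ℤ, n ≠ 0 ∧ ∏ i, u i ^ n i = 1 := by
  have hint (x : R) : IsIntegral ℤ (φ x) := (Algebra.IsIntegral.isIntegral x).map φ.toIntAlgHom
  let ψ : R →* 𝓞 K := RingOfIntegers.restrict_monoidHom φ.toMonoidHom hint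
  have hψ : Function.Injective ψ := fun x y h => hφ (congrArg (algebraMap (𝓞 K) K) h)
  have hdep : ¬ LinearIndependent ℤ (fun i => Additive.ofMul (Units.map ψ (u i))) := by
    intro h
    have := h.fintype_card_le_finrank
    rw [Units.finrank_eq] at this
    omega
  obtain ⟨g, hg, i₀, hi₀⟩ := Fintype.not_linearIndependent_iff.1 hdep
  refine ⟨g, fun h0 => hi₀ (congrFun h0 i₀), Units.map_injective (f := ψ) hψ ?_⟩
  apply Additive.ofMul.injective
  rw [map_prod, map_one, ofMul_prod, ofMul_one, ← hg]
  simp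

end Units

end RamanujanTau

namespace RamanujanTau

section Skolem

variable {R : Type*} [CommRing R] {l : ℕ}

/-- `u = 1 + l ^ k * y` modulo `l ^ (k + 1)`. -/
def HasLeadingTerm (l k : ℕ) (u y : R) : Prop := (l : R) ^ (k + 1) ∣ u - (1 + (l : R) ^ k * y)

namespace HasLeadingTerm

variable {k : ℕ} {u v y z : R}

theorem one : HasLeadingTerm l k (1 : R) 0 := by simp [HasLeadingTerm]

theorem zero_of_lt {k' : ℕ} (h : HasLeadingTerm l k u y) (hk : k' < k) :
    HasLeadingTerm l k' u 0 := by
  obtain ⟨c, hc⟩ := h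
  obtain ⟨d, rfl⟩ := Nat.exists_eq_add_of_lt hk
  exact ⟨(l : R) ^ d * y + (l : R) ^ (d + 1) * c, by linear_combination hc⟩

theorem mul (hk : 1 ≤ k) (hu : HasLeadingTerm l k u y) (hv : HasLeadingTerm l k v z) :
    HasLeadingTerm l k (u * v) (y + z) := by
  obtain ⟨c, hc⟩ := hu
  obtain ⟨d, hd⟩ := hv
  obtain ⟨j, rfl⟩ := Nat.exists_eq_add_of_le' hk
  rw [sub_eq_iff_eq_add] at hc hd
  exact ⟨c * v + d * (1 + (l : R) ^ (j + 1) * y) + (l : R) ^ j * (y * z), by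
    rw [hc, hd]; ring⟩

theorem inv {u : Rˣ} (hk : 1 ≤ k) (hu : HasLeadingTerm l k (u : R) y) :
    HasLeadingTerm l k ((u⁻¹ : Rˣ) : R) (-y) := by
  obtain ⟨c, hc⟩ := hu
  obtain ⟨j, rfl⟩ := Nat.exists_eq_add_of_le' hk
  have h : (u : R) * ((u⁻¹ : Rˣ) : R) = 1 := u.mul_inv
  exact ⟨((u⁻¹ : Rˣ) : R) * ((l : R) ^ j * y ^ 2 - c * (1 - (l : R) ^ (j + 1) * y)), by
    linear_combination (-((u⁻¹ : Rˣ) : R)) * (1 - (l : R) ^ (j + 1) * y) * hc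
      + (1 - (l : R) ^ (j + 1) * y) * h⟩

theorem pow (hk : 1 ≤ k) (hu : HasLeadingTerm l k u y) (n : ℕ) :
    HasLeadingTerm l k (u ^ n) (n * y) := by
  induction n with
  | zero => simpa using one
  | succ n ih =>
    rw [pow_succ, show ((n + 1 : ℕ) : R) * y = n * y + y by push_cast; ring]
    exact ih.mul hk hu

theorem zpow {u : Rˣ} (hk : 1 ≤ k) (hu : HasLeadingTerm l k (u : R) y) (n : ℤ) :
    HasLeadingTerm l k ((u ^ n : Rˣ) : R) (n * y) := by
  cases n with
  | ofNat n => simpa using hu.pow hk n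
  | negSucc n =>
    have h := hu.pow hk (n + 1)
    rw [← Units.val_pow_eq_pow_val] at h
    rw [zpow_negSucc, Int.cast_negSucc, neg_mul]
    exact h.inv hk

theorem prod {ι : Type*} (s : Finset ι) {u : ι → Rˣ} {y : ι → R} (hk : 1 ≤ k)
    (hu : ∀ i, HasLeadingTerm l k (u i : R) (y i)) :
    HasLeadingTerm l k ((∏ i ∈ s, u i : Rˣ) : R) (∑ i ∈ s, y i) := by
  classical
  induction s using Finset.induction_on with
  | empty => simpa using one
  | insert i s hi ih =>
    rw [Finset.prod_insert hi, Finset.sum_insert hi, Units.val_mul]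
    exact (hu i).mul hk ih

theorem pow_prime (hl : l.Prime) (hl2 : l ≠ 2) (hk : 1 ≤ k) (hu : HasLeadingTerm l k u y) :
    HasLeadingTerm l (k + 1) (u ^ l) y := by
  obtain ⟨c, hc⟩ := hu
  obtain ⟨j, rfl⟩ := Nat.exists_eq_add_of_le' hk
  have hl3 : 3 ≤ l := by have := hl.two_le; omega
  set w : R := y + l * c with hw
  have hu : u = 1 + (l : R) ^ (j + 1) * w := by rw [hw]; linear_combination hc
  obtain ⟨m, hm⟩ := Nat.exists_eq_add_of_le hl3
  -- `(1 + t) ^ l = 1 + l t + (l choose 2) t ^ 2 + t ^ 3 s`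
  have hexp (t : R) : ∃ s, (1 + t) ^ l = 1 + l * t + (l.choose 2 : ℕ) * t ^ 2 + t ^ 3 * s := by
    refine ⟨∑ i ∈ Finset.range (m + 1), t ^ i * (l.choose (i + 3) : ℕ), ?_⟩
    rw [add_comm 1 t, add_pow]
    have : l + 1 = (m + 1) + 1 + 1 + 1 := by omega
    rw [this, Finset.sum_range_succ', Finset.sum_range_succ', Finset.sum_range_succ',
      Finset.mul_sum]
    simp only [one_pow, mul_one, zero_add, Nat.choose_zero_right, Nat.choose_one_right, pow_zero,
      Nat.cast_one, pow_one]
    have : ∀ i ∈ Finset.range (m + 1), t ^ (i + 1 + 1 + 1) * ((l.choose (i + 1 + 1 + 1) : ℕ) : R)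
        = t ^ 3 * (t ^ i * (l.choose (i + 3) : ℕ)) := fun i _ => by ring
    rw [Finset.sum_congr rfl this]
    ring
  obtain ⟨s, hs⟩ := hexp ((l : R) ^ (j + 1) * w)
  obtain ⟨q, hq⟩ := hl.dvd_choose_self (k := 2) (by omega) (by omega)
  rw [HasLeadingTerm, hu, hs, hq]
  exact ⟨c + (l : R) ^ j * q * w ^ 2 + (l : R) ^ (2 * j) * w ^ 3 * s, by
    rw [hw]; push_cast; ring⟩

theorem pow_prime_pow (hl : l.Prime) (hl2 : l ≠ 2) (hk : 1 ≤ k) (hu : HasLeadingTerm l k u y)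
    (s : ℕ) : HasLeadingTerm l (k + s) (u ^ l ^ s) y := by
  induction s with
  | zero => simpa using hu
  | succ s ih =>
    rw [pow_succ, pow_mul]
    exact ih.pow_prime hl hl2 (hk.trans (Nat.le_add_right k s))

theorem dvd_sub [IsDomain R] [CharZero R] (hl : l ≠ 0) (hu : HasLeadingTerm l k u y)
    (hv : HasLeadingTerm l k u z) : (l : R) ∣ y - z := by
  have h := _root_.dvd_sub hv hu
  rw [show u - (1 + (l : R) ^ k * z) - (u - (1 + (l : R) ^ k * y)) = (l : R) ^ k * (y - z) by ring,
    pow_succ] at h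
  exact (mul_dvd_mul_iff_left (pow_ne_zero _ (Nat.cast_ne_zero.2 hl))).1 h

end HasLeadingTerm

theorem exists_eq_pow_mul_and_not_dvd {ι : Type*} {l : ℕ} (hl : l.Prime) {v : ι → ℤ}
    (hv : v ≠ 0) :
      ∃ (s : ℕ) (w : ι → ℤ), (∀ i, v i = (l : ℤ) ^ s * w i) ∧ ∃ i, ¬ (l : ℤ) ∣ w i := by
  classical
  obtain ⟨i₀, hi₀⟩ := Function.ne_iff.1 hv
  have hex : ∃ k, ¬ ∀ i, (l : ℤ) ^ (k + 1) ∣ v i := by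
    have hf : FiniteMultiplicity (l : ℤ) (v i₀) :=
      Int.finiteMultiplicity_iff.2 ⟨by simpa using hl.one_lt.ne', hi₀⟩
    obtain ⟨k, hk⟩ := hf
    exact ⟨k, fun h => hk (h i₀)⟩
  obtain ⟨k, hk, hmin⟩ : ∃ k, (¬ ∀ i, (l : ℤ) ^ (k + 1) ∣ v i) ∧
      ∀ j < k, ∀ i, (l : ℤ) ^ (j + 1) ∣ v i :=
    ⟨Nat.find hex, Nat.find_spec hex, fun j hj => not_not.1 (Nat.find_min hex hj)⟩
  have hall : ∀ i, (l : ℤ) ^ k ∣ v i := by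
    rcases k with _ | k
    · simp
    · exact hmin k (by omega)
  choose w hw using hall
  refine ⟨k, w, hw, ?_⟩
  push Not at hk
  obtain ⟨i, hi⟩ := hk
  refine ⟨i, fun hd => hi ?_⟩
  rw [hw i, pow_succ]
  exact mul_dvd_mul_left _ hd

/-- Skolem's method: if `e i = 1 + l * x i` modulo `l ^ 2`, where `1`, `θ` and the `x i` are
independent modulo `l`, then no unit `1 + l * (a + b * θ)` other than `1` is multiplicatively
dependent on the `e i`. -/
theorem eq_zero_of_prod_zpow_eq_one [IsDomain R] [CharZero R] (hl : l.Prime) (hl2 : l ≠ 2)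
    {ι : Type*} [Fintype ι] {e : ι → Rˣ} {x : ι → R}
    (he : ∀ i, HasLeadingTerm l 1 (e i : R) (x i)) {θ : R}
    (hind : ∀ (a b : ℤ) (m : ι → ℤ), (l : R) ∣ a + b * θ + ∑ i, m i * x i →
      (l : ℤ) ∣ a ∧ (l : ℤ) ∣ b ∧ ∀ i, (l : ℤ) ∣ m i)
    {η : Rˣ} {a b : ℤ} (hη : (η : R) = 1 + l * (a + b * θ)) {n₀ : ℤ} {n : ι → ℤ}
    (hn : n₀ ≠ 0 ∨ n ≠ 0) (hrel : η ^ n₀ * ∏ i, e i ^ n i = 1) : a = 0 ∧ b = 0 := by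
  by_contra hab
  have hl' : Prime (l : ℤ) := Nat.prime_iff_prime_int.1 hl
  have hE : n ≠ 0 → ∃ (k : ℕ) (m : ι → ℤ), 1 ≤ k ∧ (∃ i, ¬ (l : ℤ) ∣ m i) ∧
      HasLeadingTerm l k ((∏ i, e i ^ n i : Rˣ) : R) (∑ i, m i * x i) := by
    intro h
    obtain ⟨s, m, hm, hi⟩ := exists_eq_pow_mul_and_not_dvd hl h
    refine ⟨1 + s, m, by omega, hi, ?_⟩
    have h1 := HasLeadingTerm.prod Finset.univ (u := fun i => e i ^ m i) le_rfl
      fun i => (he i).zpow le_rfl (m i)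
    have h2 := h1.pow_prime_pow hl hl2 le_rfl s
    rw [← Units.val_pow_eq_pow_val, ← Finset.prod_pow] at h2
    convert h2 using 4 with i
    rw [hm i, mul_comm, zpow_mul]
    norm_cast
  have hN : n₀ ≠ 0 → ∃ (k : ℕ) (c d : ℤ), 1 ≤ k ∧ ¬ ((l : ℤ) ∣ c ∧ (l : ℤ) ∣ d) ∧
      HasLeadingTerm l k ((η ^ n₀ : Rˣ) : R) (c + d * θ) := by
    intro h
    have hv : ![a, b] ≠ 0 := fun h0 => hab ⟨congrFun h0 0, congrFun h0 1⟩
    obtain ⟨j, w, hw, i, hi⟩ := exists_eq_pow_mul_and_not_dvd hl hv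
    have hn : (fun _ : Unit => n₀) ≠ 0 := fun h0 => h (congrFun h0 ())
    obtain ⟨t, q, hq, i', hi'⟩ := exists_eq_pow_mul_and_not_dvd hl hn
    have ha : a = (l : ℤ) ^ j * w 0 := hw 0
    have hb : b = (l : ℤ) ^ j * w 1 := hw 1
    refine ⟨j + 1 + t, q () * w 0, q () * w 1, by omega, ?_, ?_⟩
    · rintro ⟨h0, h1⟩
      have h0 := (hl'.dvd_or_dvd h0).resolve_left hi'
      have h1 := (hl'.dvd_or_dvd h1).resolve_left hi'
      fin_cases i
      · exact hi h0
      · exact hi h1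
    · have h1 : HasLeadingTerm l (j + 1) (η : R) (w 0 + w 1 * θ) :=
        ⟨0, by rw [hη, ha, hb]; push_cast; ring⟩
      have h2 := (h1.zpow (by omega) (q ())).pow_prime_pow hl hl2 (by omega) t
      rw [← Units.val_pow_eq_pow_val] at h2
      convert h2 using 2
      · rw [hq (), mul_comm, zpow_mul]
        norm_cast
      · push_cast; ring
  have hone {k : ℕ} {y : R} (h : HasLeadingTerm l k (1 : R) y) : (l : R) ∣ y := by
    simpa using h.dvd_sub hl.ne_zero HasLeadingTerm.one
  have hrel' := congrArg (Units.val) hrel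
  rw [Units.val_mul, Units.val_one] at hrel'
  rcases eq_or_ne n 0 with h | h
  · obtain ⟨k, c, d, hk, hcd, hL⟩ := hN (by tauto)
    rw [h] at hrel
    simp only [Pi.zero_apply, zpow_zero, Finset.prod_const_one, mul_one] at hrel
    rw [hrel] at hL
    have := hind c d 0 (by simpa using hone hL)
    exact hcd ⟨this.1, this.2.1⟩
  obtain ⟨k', m, hk', ⟨i, hi⟩, hL'⟩ := hE h
  rcases eq_or_ne n₀ 0 with h0 | h0
  · rw [h0, zpow_zero, one_mul] at hrel
    rw [hrel] at hL'
    exact hi ((hind 0 0 m (by simpa using hone hL')).2.2 i)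
  obtain ⟨k, c, d, hk, hcd, hL⟩ := hN h0
  rcases lt_trichotomy k k' with hlt | rfl | hlt
  · have := hone (hrel' ▸ hL.mul hk (hL'.zero_of_lt hlt))
    have := hind c d 0 (by simpa using this)
    exact hcd ⟨this.1, this.2.1⟩
  · have := hone (hrel' ▸ hL.mul hk hL')
    exact hi ((hind c d m this).2.2 i)
  · have := hone (hrel' ▸ (hL.zero_of_lt hlt).mul hk' hL')
    exact hi ((hind 0 0 m (by simpa using this)).2.2 i)

end Skolem

end RamanujanTau

namespace RamanujanTau

open Polynomial

section ListArithmetic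

/-- The value at `r` of the polynomial with coefficient list `u`, constant term first. -/
def evalL {R : Type*} [CommRing R] (r : R) : List ℤ → R
  | [] => 0
  | a :: u => a + r * evalL r u

/-- Sum of coefficient lists. -/
def addL : List ℤ → List ℤ → List ℤ
  | [], v => v
  | u, [] => u
  | a :: u, b :: v => (a + b) :: addL u v

/-- Multiplication by `X` of a coefficient list, modulo `X ^ n = f`. -/
def mulXL (n : ℕ) (f u : List ℤ) : List ℤ :=
  addL (0 :: u.take (n - 1)) (f.map ((u.drop (n - 1)).headD 0 * ·))

/-- Product of coefficient lists, modulo `X ^ n = f` and with coefficients reduced modulo `m`. -/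
def mulL (n : ℕ) (f : List ℤ) (m : ℤ) : List ℤ → List ℤ → List ℤ
  | [], _ => []
  | a :: u, v => (addL (v.map (a * ·)) (mulXL n f (mulL n f m u v))).map (· % m)

/-- The `e`-th power of a coefficient list by repeated squaring; `k` bounds the number of binary
digits of `e`. -/
def powL (n : ℕ) (f : List ℤ) (m : ℤ) (u : List ℤ) : ℕ → ℕ → List ℤ
  | 0, _ => [1]
  | k + 1, e =>
    let h := powL n f m u k (e / 2)
    let s := mulL n f m h h
    if e % 2 = 1 then mulL n f m s u else s

variable {R : Type*} [CommRing R] {r : R} {n : ℕ} {f : List ℤ} {m : ℤ}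

theorem evalL_addL (u v : List ℤ) : evalL r (addL u v) = evalL r u + evalL r v := by
  induction u generalizing v with
  | nil => simp [addL, evalL]
  | cons a u ih =>
    cases v with
    | nil => simp [addL, evalL]
    | cons b v => simp only [addL, evalL, ih]; push_cast; ring

theorem evalL_map_mul (a : ℤ) (u : List ℤ) : evalL r (u.map (a * ·)) = a * evalL r u := by
  induction u with
  | nil => simp [evalL]
  | cons b u ih => simp only [List.map_cons, evalL, ih]; push_cast; ring

theorem dvd_evalL_map_emod (u : List ℤ) : (m : R) ∣ evalL r (u.map (· % m)) - evalL r u := by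
  induction u with
  | nil => simp [evalL]
  | cons b u ih =>
    obtain ⟨c, hc⟩ := ih
    refine ⟨r * c - (b / m : ℤ), ?_⟩
    have h : ((b % m : ℤ) : R) + m * (b / m : ℤ) = b := by
      rw [← Int.cast_mul, ← Int.cast_add, Int.emod_add_mul_ediv]
    simp only [List.map_cons, evalL]
    linear_combination r * hc + h

theorem length_addL (u v : List ℤ) : (addL u v).length = max u.length v.length := by
  induction u generalizing v with
  | nil => simp [addL]
  | cons a u ih => cases v <;> simp [addL, ih]

theorem evalL_take_drop (k : ℕ) (u : List ℤ) (hu : u.length ≤ k + 1) :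
    evalL r u = evalL r (u.take k) + ((u.drop k).headD 0 : ℤ) * r ^ k := by
  induction u generalizing k with
  | nil => simp [evalL]
  | cons a u ih =>
    cases k with
    | zero =>
      have : u = [] := List.eq_nil_of_length_eq_zero (by simpa using hu)
      simp [evalL, this]
    | succ k =>
      simp only [List.take_succ_cons, List.drop_succ_cons, evalL]
      rw [ih k (by simpa using hu)]
      ring

theorem evalL_mulXL (hn : 1 ≤ n) (hr : r ^ n = evalL r f) (u : List ℤ) (hu : u.length ≤ n) :
    evalL r (mulXL n f u) = r * evalL r u := by
  obtain ⟨k, rfl⟩ := Nat.exists_eq_add_of_le' hn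
  rw [mulXL, evalL_addL, evalL_map_mul, ← hr, evalL_take_drop k u hu]
  simp only [evalL, Nat.add_sub_cancel]
  push_cast
  ring

theorem length_mulXL (hn : 1 ≤ n) (hf : f.length ≤ n) (u : List ℤ) :
    (mulXL n f u).length ≤ n := by
  simp [mulXL, length_addL]
  omega

theorem length_mulL (hn : 1 ≤ n) (hf : f.length ≤ n) (u v : List ℤ) (hv : v.length ≤ n) :
    (mulL n f m u v).length ≤ n := by
  cases u with
  | nil => simp [mulL]
  | cons a u =>
    simp only [mulL, List.length_map, length_addL]
    exact max_le hv (length_mulXL hn hf _)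

theorem dvd_evalL_mulL (hn : 1 ≤ n) (hf : f.length ≤ n) (hr : r ^ n = evalL r f) (u v : List ℤ)
    (hv : v.length ≤ n) : (m : R) ∣ evalL r (mulL n f m u v) - evalL r u * evalL r v := by
  induction u with
  | nil => simp [mulL, evalL]
  | cons a u ih =>
    obtain ⟨c, hc⟩ := ih
    obtain ⟨d, hd⟩ := dvd_evalL_map_emod (r := r) (m := m)
      (addL (v.map (a * ·)) (mulXL n f (mulL n f m u v)))
    rw [evalL_addL, evalL_map_mul, evalL_mulXL hn hr _ (length_mulL hn hf u v hv)] at hd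
    exact ⟨d + r * c, by simp only [mulL, evalL]; linear_combination hd + r * hc⟩

/-- Reduction modulo `0` does nothing, so `mulL` with `m = 0` computes exact products. -/
theorem evalL_mulL_zero (hn : 1 ≤ n) (hf : f.length ≤ n) (hr : r ^ n = evalL r f) (u v : List ℤ)
    (hv : v.length ≤ n) : evalL r (mulL n f 0 u v) = evalL r u * evalL r v := by
  have := dvd_evalL_mulL (m := 0) hn hf hr u v hv
  rwa [Int.cast_zero, zero_dvd_iff, sub_eq_zero] at this

theorem length_powL (hn : 1 ≤ n) (hf : f.length ≤ n) (u : List ℤ) (hu : u.length ≤ n) (k e : ℕ) :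
    (powL n f m u k e).length ≤ n := by
  induction k generalizing e with
  | zero => simpa [powL] using hn
  | succ k ih =>
    simp only [powL]
    split_ifs
    · exact length_mulL hn hf _ _ hu
    · exact length_mulL hn hf _ _ (ih _)

theorem dvd_evalL_powL (hn : 1 ≤ n) (hf : f.length ≤ n) (hr : r ^ n = evalL r f) (u : List ℤ)
    (hu : u.length ≤ n) (k e : ℕ) (he : e < 2 ^ k) :
    (m : R) ∣ evalL r (powL n f m u k e) - evalL r u ^ e := by
  induction k generalizing e with
  | zero =>
    obtain rfl : e = 0 := by simpa using he
    simp [powL, evalL]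
  | succ k ih =>
    obtain ⟨c, hc⟩ := ih (e / 2) (by rw [pow_succ] at he; omega)
    set h := powL n f m u k (e / 2) with hh
    have hl : h.length ≤ n := length_powL hn hf u hu _ _
    obtain ⟨d, hd⟩ := dvd_evalL_mulL (m := m) hn hf hr h h hl
    set w := evalL r u ^ (e / 2) with hw
    simp only [powL]
    rw [← hh]
    have hs : evalL r (mulL n f m h h) = w * w + m * (d + c * (evalL r h + w)) := by
      linear_combination hd + (evalL r h + w) * hc
    split_ifs with h1
    · obtain ⟨d', hd'⟩ := dvd_evalL_mulL (m := m) hn hf hr (mulL n f m h h) u hu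
      have : evalL r u ^ e = w * w * evalL r u := by
        rw [hw, ← pow_add, ← pow_succ]; congr 1; omega
      exact ⟨d' + (d + c * (evalL r h + w)) * evalL r u, by
        rw [this]; linear_combination hd' + evalL r u * hs⟩
    · have : evalL r u ^ e = w * w := by rw [hw, ← pow_add]; congr 1; omega
      exact ⟨d + c * (evalL r h + w), by rw [this, hs]; ring⟩

/-- The polynomial with coefficient list `u`. -/
noncomputable def polyL (u : List ℤ) : ℤ[X] := evalL X u

theorem coeff_polyL (u : List ℤ) (i : ℕ) : (polyL u).coeff i = u.getD i 0 := by
  induction u generalizing i with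
  | nil => simp [polyL, evalL]
  | cons a u ih =>
    have : polyL (a :: u) = C a + X * polyL u := by simp [polyL, evalL]
    rw [this]
    cases i with
    | zero => simp
    | succ i => rw [coeff_add, coeff_C_succ, coeff_X_mul, zero_add, ih, List.getD_cons_succ]

theorem degree_polyL_lt (u : List ℤ) : (polyL u).degree < u.length := by
  rw [degree_lt_iff_coeff_zero]
  intro i hi
  rw [coeff_polyL, List.getD_eq_default _ _ hi]

theorem map_evalL {S : Type*} [CommRing S] (φ : R →+* S) (u : List ℤ) :
    φ (evalL r u) = evalL (φ r) u := by
  induction u with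
  | nil => simp [evalL]
  | cons a u ih => simp [evalL, ih]

theorem mk_polyL (g : ℤ[X]) (u : List ℤ) :
    AdjoinRoot.mk g (polyL u) = evalL (AdjoinRoot.root g) u := by
  rw [polyL, map_evalL, AdjoinRoot.mk_X]

theorem dvd_getD_of_dvd_evalL {g : ℤ[X]} (hg : g.Monic) {u : List ℤ} (hu : u.length ≤ g.natDegree)
    {l : ℤ} (h : (l : AdjoinRoot g) ∣ evalL (AdjoinRoot.root g) u) (i : ℕ) : l ∣ u.getD i 0 := by
  obtain ⟨c, hc⟩ := h
  obtain ⟨p, rfl⟩ := AdjoinRoot.mk_surjective c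
  rw [← AdjoinRoot.mk_leftInverse hg (AdjoinRoot.mk g p), AdjoinRoot.modByMonicHom_mk,
    ← mk_polyL] at hc
  have h0 : polyL u = C l * (p %ₘ g) := by
    rw [← sub_eq_zero]
    refine eq_zero_of_dvd_of_degree_lt (p := g) ?_ ?_
    · rw [← AdjoinRoot.mk_eq_zero, map_sub, map_mul, hc]
      simp
    · have h1 : (polyL u).degree < g.degree := by
        rw [degree_eq_natDegree hg.ne_zero]
        exact (degree_polyL_lt u).trans_le (by exact_mod_cast hu)
      refine (degree_sub_le _ _).trans_lt (max_lt h1 ?_)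
      refine (degree_mul_le _ _).trans_lt ?_
      have h2 := degree_modByMonic_lt p hg
      exact (add_le_add_left degree_C_le _).trans_lt (by simpa using h2)
  rw [← coeff_polyL, h0, coeff_C_mul]
  exact dvd_mul_right _ _

end ListArithmetic

end RamanujanTau

namespace RamanujanTau

open Polynomial NumberField

section AdjoinRootUnits

variable {g : ℤ[X]}

theorem isDomain_adjoinRoot (hirr : Irreducible g) : IsDomain (AdjoinRoot g) :=
  AdjoinRoot.isDomain_of_prime hirr.prime

theorem charZero_adjoinRoot (hg : g.degree ≠ 0) : CharZero (AdjoinRoot g) :=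
  charZero_of_injective_algebraMap (R := ℤ) (AdjoinRoot.of.injective_of_degree_ne_zero hg)

open scoped Classical in
theorem nrRealPlaces_le_card_roots [Fact (Irreducible (g.map (Int.castRingHom ℚ)))]
    [NumberField (AdjoinRoot (g.map (Int.castRingHom ℚ)))] :
    InfinitePlace.nrRealPlaces (AdjoinRoot (g.map (Int.castRingHom ℚ))) ≤
      (g.map (Int.castRingHom ℝ)).roots.toFinset.card := by
  set q := g.map (Int.castRingHom ℚ) with hq
  have hq0 : q ≠ 0 := (Fact.out : Irreducible q).ne_zero
  have hg0 : g.map (Int.castRingHom ℝ) ≠ 0 := by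
    intro h
    apply hq0
    rw [hq, (Polynomial.map_eq_zero_iff (RingHom.injective_int _)).1 h, Polynomial.map_zero]
  rw [← InfinitePlace.card_real_embeddings, ← Fintype.card_coe]
  let F : {φ : AdjoinRoot q →+* ℂ // ComplexEmbedding.IsReal φ} →
      (g.map (Int.castRingHom ℝ)).roots.toFinset := fun φ =>
    ⟨φ.2.embedding (AdjoinRoot.root q), by
      rw [Multiset.mem_toFinset, mem_roots hg0, IsRoot, eval_map]
      have h := congrArg φ.2.embedding (AdjoinRoot.eval₂_root q)
      rw [map_zero, hom_eval₂] at h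
      have h' := (eval₂_map (p := g) (Int.castRingHom ℚ) _ _).symm.trans h
      rwa [RingHom.ext_int (Int.castRingHom ℝ) _]⟩
  refine Fintype.card_le_of_injective F ?_
  intro φ ψ h
  have h1 : φ.2.embedding (AdjoinRoot.root q) = ψ.2.embedding (AdjoinRoot.root q) :=
    congrArg Subtype.val h
  apply Subtype.ext
  refine AdjoinRoot.ringHom_ext (RingHom.ext_rat _ _) ?_
  rw [← ComplexEmbedding.IsReal.coe_embedding_apply φ.2, h1,
    ComplexEmbedding.IsReal.coe_embedding_apply ψ.2]

/-- Dirichlet's unit theorem for the order `ℤ[X] / (g)`, with the number of real places bounded by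
the number of real roots of `g`. -/
theorem exists_prod_zpow_eq_one_adjoinRoot (hg : g.Monic) (hirr : Irreducible g) {s : ℕ}
    (hs : (g.map (Int.castRingHom ℝ)).roots.toFinset.card ≤ s) {ι : Type*} [Fintype ι]
    (hι : g.natDegree + s < 2 * (Fintype.card ι + 1)) (u : ι → (AdjoinRoot g)ˣ) :
    ∃ n : ι → ℤ, n ≠ 0 ∧ ∏ i, u i ^ n i = 1 := by
  classical
  set q := g.map (Int.castRingHom ℚ) with hq
  have hqm : q.Monic := hg.map _
  have hqi : Irreducible q := (hg.irreducible_iff_irreducible_map_fraction_map (K := ℚ)).1 hirr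
  have : Fact (Irreducible q) := ⟨hqi⟩
  have : Module.Finite ℚ (AdjoinRoot q) := hqm.finite_adjoinRoot
  have : Module.Finite ℤ (AdjoinRoot g) := hg.finite_adjoinRoot
  have : CharZero (AdjoinRoot q) :=
    charZero_of_injective_algebraMap (R := ℚ) (algebraMap ℚ (AdjoinRoot q)).injective
  have : NumberField (AdjoinRoot q) := { }
  have hφ : Function.Injective (AdjoinRoot.map (Int.castRingHom ℚ) g q dvd_rfl) := by
    rw [injective_iff_map_eq_zero]
    intro a ha
    obtain ⟨p, rfl⟩ := AdjoinRoot.mk_surjective a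
    have : AdjoinRoot.map (Int.castRingHom ℚ) g q dvd_rfl (AdjoinRoot.mk g p) =
        AdjoinRoot.mk q (p.map (Int.castRingHom ℚ)) := by
      rw [AdjoinRoot.map, AdjoinRoot.lift_mk, ← AdjoinRoot.aeval_eq, aeval_def, eval₂_map]
      rfl
    rw [this, AdjoinRoot.mk_eq_zero, map_dvd_map _ (RingHom.injective_int _) hg] at ha
    rwa [AdjoinRoot.mk_eq_zero]
  refine exists_prod_zpow_eq_one _ hφ ?_ u
  have h1 := InfinitePlace.card_eq_nrRealPlaces_add_nrComplexPlaces (AdjoinRoot q)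
  have h2 := InfinitePlace.card_add_two_mul_card_eq_rank (AdjoinRoot q)
  have h3 : InfinitePlace.nrRealPlaces (AdjoinRoot q) ≤
      (g.map (Int.castRingHom ℝ)).roots.toFinset.card := nrRealPlaces_le_card_roots
  have h4 : Module.finrank ℚ (AdjoinRoot q) = g.natDegree := by
    rw [(AdjoinRoot.powerBasis hqi.ne_zero).finrank, AdjoinRoot.powerBasis_dim,
      hg.natDegree_map]
  have h5 : Fintype.card (InfinitePlace (AdjoinRoot q)) ≠ 0 := Fintype.card_ne_zero
  rw [Units.rank]
  omega

end AdjoinRootUnits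

end RamanujanTau

namespace RamanujanTau

open Polynomial

section ListSkolem

theorem evalL_eq_sum {R : Type*} [CommRing R] (r : R) {u : List ℤ} {n : ℕ} (hu : u.length ≤ n) :
    evalL r u = ∑ j ∈ Finset.range n, ((u.getD j 0 : ℤ) : R) * r ^ j := by
  induction u generalizing n with
  | nil => simp [evalL]
  | cons a u ih =>
    cases n with
    | zero => simp at hu
    | succ n =>
      rw [Finset.sum_range_succ', evalL, ih (by simpa using hu), Finset.mul_sum]
      simp only [List.getD_cons_succ, List.getD_cons_zero, pow_zero, mul_one]
      rw [add_comm]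
      congr 1
      exact Finset.sum_congr rfl fun j _ => by ring

theorem evalL_map_range {R : Type*} [CommRing R] (r : R) (c : ℕ → ℤ) (n : ℕ) :
    evalL r ((List.range n).map c) = ∑ j ∈ Finset.range n, (c j : R) * r ^ j := by
  rw [evalL_eq_sum r (n := n) (by simp)]
  refine Finset.sum_congr rfl fun j hj => ?_
  rw [List.getD_eq_getElem _ _ (by simpa using hj)]
  simp

/-- Skolem's method in the order `ℤ[X] / (X ^ n - f)`, for units given by coefficient lists:
`U i` and `V i` are inverse units with `U i ^ M = 1 + l * X i` modulo `l ^ 2`. -/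
theorem eq_zero_of_lists {g : ℤ[X]} (hg : g.Monic) (hirr : Irreducible g) {n s : ℕ} (hn : 1 ≤ n)
    (hgn : g.natDegree = n) {f : List ℤ} (hf : f.length ≤ n)
    (hr : AdjoinRoot.root g ^ n = evalL (AdjoinRoot.root g) f)
    (hs : (g.map (Int.castRingHom ℝ)).roots.toFinset.card ≤ s) {ι : Type*} [Fintype ι]
    (hι : n + s < 2 * (Fintype.card ι + 2)) {l : ℕ} (hl : l.Prime) (hl2 : l ≠ 2)
    {U V X : ι → List ℤ} {T : List ℤ} (hT : T.length ≤ n) (hU : ∀ i, (U i).length ≤ n)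
    (hV : ∀ i, (V i).length ≤ n) (hX : ∀ i, (X i).length ≤ n) {M k : ℕ} (hM : M < 2 ^ k)
    (hUV : ∀ i, mulL n f 0 (U i) (V i) = 1 :: List.replicate (n - 1) 0)
    (hUX : ∀ i, powL n f (l ^ 2 : ℕ) (U i) k M = addL [1] ((X i).map ((l : ℤ) * ·)))
    (hind : ∀ (a b : ℤ) (m : ι → ℤ),
      (∀ j < n, (l : ℤ) ∣ (if j = 0 then a else 0) + b * T.getD j 0 +
        ∑ i, m i * (X i).getD j 0) → (l : ℤ) ∣ a ∧ (l : ℤ) ∣ b ∧ ∀ i, (l : ℤ) ∣ m i)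
    {η : (AdjoinRoot g)ˣ} {a b : ℤ}
    (hη : (η : AdjoinRoot g) = 1 + l * (a + b * evalL (AdjoinRoot.root g) T)) : a = 0 ∧ b = 0 := by
  classical
  have : IsDomain (AdjoinRoot g) := isDomain_adjoinRoot hirr
  have : CharZero (AdjoinRoot g) := charZero_adjoinRoot (by
    rw [degree_eq_natDegree hg.ne_zero, hgn]; exact_mod_cast (by omega))
  set r := AdjoinRoot.root g with hrdef
  have hzero (k : ℕ) : evalL r (List.replicate k 0) = 0 := by
    induction k with
    | zero => rfl
    | succ k ih => simp [List.replicate_succ, evalL, ih]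
  have huv i : evalL r (U i) * evalL r (V i) = 1 := by
    rw [← evalL_mulL_zero hn hf hr _ _ (hV i), hUV, evalL, hzero]
    simp
  let e : ι → (AdjoinRoot g)ˣ := fun i =>
    (⟨evalL r (U i), evalL r (V i), huv i, by rw [mul_comm, huv]⟩ : (AdjoinRoot g)ˣ) ^ M
  have he i : HasLeadingTerm l 1 (e i : AdjoinRoot g) (evalL r (X i)) := by
    have h := dvd_evalL_powL (m := (l ^ 2 : ℕ)) hn hf hr (U i) (hU i) k M hM
    rw [hUX, evalL_addL, evalL_map_mul] at h
    rw [HasLeadingTerm, ← dvd_neg]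
    convert h using 1
    · push_cast; ring
    · simp only [e, Units.val_pow_eq_pow_val, evalL]
      push_cast
      ring
  obtain ⟨N, hN, hrel⟩ := exists_prod_zpow_eq_one_adjoinRoot hg hirr hs (ι := Option ι)
    (by rw [Fintype.card_option]; omega) (fun o => o.elim η e)
  rw [Fintype.prod_option] at hrel
  refine eq_zero_of_prod_zpow_eq_one hl hl2 he (fun a b m hdvd => hind a b m fun j hj => ?_) hη
    (n₀ := N none) (n := fun i => N (some i)) ?_ hrel
  · have hlist : (a : AdjoinRoot g) + b * evalL r T + ∑ i, (m i : AdjoinRoot g) * evalL r (X i) =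
        evalL r ((List.range n).map fun j => (if j = 0 then a else 0) + b * T.getD j 0 +
          ∑ i, m i * (X i).getD j 0) := by
      rw [evalL_map_range, evalL_eq_sum r hT]
      simp_rw [fun i => evalL_eq_sum r (hX i)]
      push_cast
      simp only [add_mul, Finset.sum_add_distrib, Finset.mul_sum, Finset.sum_mul]
      rw [Finset.sum_comm]
      congr 1
      · congr 1
        · rw [Finset.sum_eq_single 0]
          · simp
          · intro b _ hb; simp [hb]
          · intro h; simp at h; omega
        · exact Finset.sum_congr rfl fun j _ => by ring
      · exact Finset.sum_congr rfl fun j _ => Finset.sum_congr rfl fun i _ => by ring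
    rw [hlist] at hdvd
    have hlen (c : ℕ → ℤ) : ((List.range n).map c).length ≤ g.natDegree := by simp [hgn]
    have := dvd_getD_of_dvd_evalL hg (hlen _) (l := l) (by exact_mod_cast hdvd) j
    rw [List.getD_eq_getElem _ _ (by simpa using hj)] at this
    simpa using this
  · by_contra! h
    exact hN (funext fun o => by cases o with
      | none => exact h.1
      | some i => exact congrFun h.2 i)

end ListSkolem

end RamanujanTau

namespace RamanujanTau

open Polynomial

section Irreducibility

/-- A form of the generalized Eisenstein criterion. -/
theorem irreducible_pow_add {l : ℕ} [hl : Fact l.Prime] {q h s : ℤ[X]} {e : ℕ} (he : e ≠ 0)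
    (hq : Irreducible (q.map (algebraMap ℤ (ZMod l)))) (hqm : q.Monic)
    (hs : s.degree < q.degree) {i : ℕ} (hi : ¬ (l : ℤ) ∣ s.coeff i)
    (hm : (q ^ e + C (l : ℤ) * (h * q + s)).Monic) :
    Irreducible (q ^ e + C (l : ℤ) * (h * q + s)) := by
  have hmap : (q ^ e + C (l : ℤ) * (h * q + s)).map (algebraMap ℤ (ZMod l)) =
      q.map (algebraMap ℤ (ZMod l)) ^ e := by simp
  have hl0 : (l : ℤ) ≠ 0 := by exact_mod_cast hl.out.ne_zero
  refine generalizedEisenstein (K := ZMod l) (p := e) hq hqm hm.isPrimitive ?_ ?_ ?_ ?_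
  · rw [← hm.natDegree_map (algebraMap ℤ (ZMod l)), hmap, natDegree_pow]
    exact Nat.mul_pos (Nat.pos_of_ne_zero he) hq.natDegree_pos
  · rw [hm.leadingCoeff]; simp
  · rw [hmap, hm.leadingCoeff]; simp
  · have hmod : (q ^ e + C (l : ℤ) * (h * q + s)) %ₘ q = C (l : ℤ) * s := by
      obtain ⟨k, rfl⟩ := Nat.exists_eq_succ_of_ne_zero he
      refine (div_modByMonic_unique (q ^ k + C (l : ℤ) * h) _ hqm ⟨by rw [pow_succ]; ring, ?_⟩).2
      rwa [degree_C_mul hl0]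
    rw [hmod]
    intro h0
    have h1 := congrArg (fun p => p.coeff i) h0
    simp only [coeff_map, coeff_C_mul, coeff_zero, Ideal.Quotient.eq_zero_iff_mem] at h1
    have hker : RingHom.ker (algebraMap ℤ (ZMod l)) = Ideal.span {(l : ℤ)} :=
      ZMod.ker_intCastRingHom l
    rw [hker, Ideal.span_singleton_pow, Ideal.mem_span_singleton, pow_two] at h1
    exact hi ((mul_dvd_mul_iff_left hl0).1 h1)

end Irreducibility

end RamanujanTau

namespace RamanujanTau

open Polynomial

section UndecicThue

/-- The minimal polynomial of `δ + δ⁻¹`, where `δ ^ 11 = 2 + √3`. -/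
noncomputable def undecic : ℤ[X] :=
  X ^ 11 - 11 * X ^ 9 + 44 * X ^ 7 - 77 * X ^ 5 + 55 * X ^ 3 - 11 * X - 4

theorem undecic_monic : undecic.Monic := by
  unfold undecic; monicity!

theorem undecic_natDegree : undecic.natDegree = 11 := by
  unfold undecic; compute_degree!

theorem undecic_irreducible : Irreducible undecic := by
  have : Fact (Nat.Prime 11) := ⟨by norm_num⟩
  have h : undecic = (X - C 4) ^ 11 + C ((11 : ℕ) : ℤ) *
      ((4 * X ^ 9 - 65 * X ^ 8 + 700 * X ^ 7 - 4876 * X ^ 6 + 23504 * X ^ 5 - 78023 * X ^ 4 +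
        179428 * X ^ 3 - 265323 * X ^ 2 + 249428 * X - 50865) * (X - C 4) + C 177840) := by
    unfold undecic
    rw [show (C 4 : ℤ[X]) = 4 from rfl, show (C 177840 : ℤ[X]) = 177840 from rfl,
      show (C ((11 : ℕ) : ℤ) : ℤ[X]) = 11 from rfl]
    ring
  rw [h]
  refine irreducible_pow_add (by norm_num) ?_ (monic_X_sub_C 4) ?_ (i := 0) ?_
    (h ▸ undecic_monic)
  · rw [Polynomial.map_sub, map_X, map_C]; exact irreducible_X_sub_C _
  · rw [degree_X_sub_C]; exact degree_C_le.trans_lt (by norm_num)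
  · rw [coeff_C_zero]; norm_num

theorem undecic_card_roots :
    (undecic.map (Int.castRingHom ℝ)).roots.toFinset.card ≤ 1 := by
  have key {x : ℝ} (hx : x ∈ (undecic.map (Int.castRingHom ℝ)).roots.toFinset) :
      x ^ 11 - 11 * x ^ 9 + 44 * x ^ 7 - 77 * x ^ 5 + 55 * x ^ 3 - 11 * x - 4 = 0 := by
    rw [Multiset.mem_toFinset, mem_roots (undecic_monic.map _).ne_zero, IsRoot, eval_map,
      undecic] at hx
    simpa using hx
  have key2 {x : ℝ} (hx : x ∈ (undecic.map (Int.castRingHom ℝ)).roots.toFinset) : 2 < x := by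
    have h := key hx
    by_contra! h2
    have := mul_nonneg (sub_nonneg.2 h2)
      (sq_nonneg (1 + 3 * x - 3 * x ^ 2 - 4 * x ^ 3 + x ^ 4 + x ^ 5))
    nlinarith
  have hlt {x y : ℝ} (hx : x ∈ (undecic.map (Int.castRingHom ℝ)).roots.toFinset)
      (hy : y ∈ (undecic.map (Int.castRingHom ℝ)).roots.toFinset) : ¬ x < y := by
    intro h
    have h1 := key hx
    have h2 := key hy
    obtain ⟨u, rfl⟩ : ∃ u, x = 2 + u := ⟨x - 2, by ring⟩
    obtain ⟨v, rfl⟩ : ∃ v, y = 2 + v := ⟨y - 2, by ring⟩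
    have hu : 0 ≤ u := by linarith [key2 hx]
    have huv : u < v := by linarith
    have : 121 * u + 1210 * u ^ 2 + 4719 * u ^ 3 + 9438 * u ^ 4 + 11011 * u ^ 5 + 8008 * u ^ 6 +
        3740 * u ^ 7 + 1122 * u ^ 8 + 209 * u ^ 9 + 22 * u ^ 10 + u ^ 11 <
        121 * v + 1210 * v ^ 2 + 4719 * v ^ 3 + 9438 * v ^ 4 + 11011 * v ^ 5 + 8008 * v ^ 6 +
        3740 * v ^ 7 + 1122 * v ^ 8 + 209 * v ^ 9 + 22 * v ^ 10 + v ^ 11 := by gcongr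
    refine absurd ?_ this.ne
    linear_combination h1 - h2
  exact Finset.card_le_one.2 fun x hx y hy =>
    le_antisymm (not_lt.1 (hlt hy hx)) (not_lt.1 (hlt hx hy))

/-- Evaluation of the polynomial with coefficients `c` at the list `u`, modulo `X ^ n = f`. -/
def hornerL (n : ℕ) (f u : List ℤ) : List ℤ → List ℤ
  | [] => []
  | a :: c => addL [a] (mulL n f 0 u (hornerL n f u c))

theorem evalL_hornerL {R : Type*} [CommRing R] {r : R} {n : ℕ} {f : List ℤ} (hn : 1 ≤ n)
    (hf : f.length ≤ n) (hr : r ^ n = evalL r f) (u c : List ℤ) :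
    (hornerL n f u c).length ≤ n ∧ evalL r (hornerL n f u c) = evalL (evalL r u) c := by
  induction c with
  | nil => simp [hornerL, evalL]
  | cons a c ih =>
    refine ⟨?_, ?_⟩
    · simp only [hornerL, length_addL]
      exact max_le hn (length_mulL hn hf _ _ ih.1)
    · rw [hornerL, evalL_addL, evalL_mulL_zero hn hf hr _ _ ih.1, ih.2]
      simp [evalL]

/-- Coefficients of `X ^ 11` modulo `undecic`. -/
def undecicRed : List ℤ := [4, 11, 0, -55, 0, 77, 0, -44, 0, 11, 0]

theorem undecic_root_pow :
    AdjoinRoot.root undecic ^ 11 = evalL (AdjoinRoot.root undecic) undecicRed := by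
  have h : AdjoinRoot.mk undecic
      (X ^ 11 - 11 * X ^ 9 + 44 * X ^ 7 - 77 * X ^ 5 + 55 * X ^ 3 - 11 * X - 4) = 0 :=
    AdjoinRoot.mk_self
  simp only [map_sub, map_add, map_mul, map_pow, AdjoinRoot.mk_X, map_ofNat] at h
  simp only [undecicRed, evalL]
  push_cast
  linear_combination h

/-- Root in `ℤ[X] / (undecic)` of the dehomogenization of the form in `eq_zero_of_thue`. -/
def undecicRoot : List ℤ := [-2, -5, 0, 20, 0, -21, 0, 8, 0, -1, 0]

/-- Units of `ℤ[X] / (undecic)`. -/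
def undecicUnit : Fin 5 → List ℤ :=
  ![[1, 6, 9, -5, -6, 1, 1, 0, 0, 0, 0], [1, 4, 6, -4, -5, 1, 1, 0, 0, 0, 0],
    [5, 0, -15, 1, 16, 0, -7, 0, 1, 0, 0], [-1, -16, -24, 20, 26, -8, -9, 1, 1, 0, 0],
    [-1, -11, 31, -1, -44, 17, 17, -8, -2, 1, 0]]

/-- The inverses of `undecicUnit`. -/
def undecicUnitInv : Fin 5 → List ℤ :=
  ![[1, 10, 7, -35, -18, 40, 20, -16, -8, 2, 1],
    [77, 125, -434, -161, 615, 89, -352, -22, 88, 2, -8],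
    [-7, -23, -9, 99, 55, -111, -65, 42, 25, -5, -3],
    [-2345, -7614, -3780, 30371, 15077, -37661, -18696, 16516, 8199, -2379, -1181],
    [-5, -12, 3, 66, -26, -75, 34, 31, -15, -4, 2]]

/-- The elements `x` with `u ^ (7 ^ 5 - 1) = 1 + 7 * x` modulo `49`, for `u` in `undecicUnit`. -/
def undecicLead : Fin 5 → List ℤ :=
  ![[4, 0, 0, 0, 3, 5, 1, 2, 3, 0, 0], [2, 4, 6, 5, 2, 5, 5, 4, 0, 5, 6],
    [6, 6, 6, 4, 6, 4, 5, 5, 0, 6, 3], [0, 4, 4, 3, 4, 4, 4, 1, 0, 5, 5],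
    [2, 0, 4, 6, 3, 4, 0, 1, 2, 4, 0]]

theorem sub_dvd_evalL_sub {R : Type*} [CommRing R] (a c : R) (u : List ℤ) :
    a - c ∣ evalL a u - evalL c u := by
  induction u with
  | nil => simp [evalL]
  | cons b u ih =>
    obtain ⟨d, hd⟩ := ih
    exact ⟨evalL a u + c * d, by simp only [evalL]; linear_combination c * hd⟩

theorem eq_zero_of_thue {a b : ℤ} (ha : (7 : ℤ) ∣ a - 1) (hb : (7 : ℤ) ∣ b)
    (h : 486 * b ^ 11 + 2673 * b ^ 10 * a + 8910 * b ^ 9 * a ^ 2 + 13365 * b ^ 8 * a ^ 3 +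
      17820 * b ^ 7 * a ^ 4 + 12474 * b ^ 6 * a ^ 5 + 8316 * b ^ 5 * a ^ 6 +
      2970 * b ^ 4 * a ^ 7 + 990 * b ^ 3 * a ^ 8 + 165 * b ^ 2 * a ^ 9 + 22 * b * a ^ 10 +
      a ^ 11 = 1) : b = 0 := by
  obtain ⟨a', ha'⟩ := ha
  obtain ⟨b', rfl⟩ := hb
  set r := AdjoinRoot.root undecic with hrdef
  set θ := evalL r undecicRoot with hθ
  have hroot : evalL θ [486, 2673, 8910, 13365, 17820, 12474, 8316, 2970, 990, 165, 22, 1] =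
      0 := by
    rw [hθ, ← (evalL_hornerL (by norm_num) (by decide) undecic_root_pow _ _).2,
      show hornerL 11 undecicRed undecicRoot
        [486, 2673, 8910, 13365, 17820, 12474, 8316, 2970, 990, 165, 22, 1] =
        [0, 0, 0, 0, 0, 0, 0, 0, 0, 0, 0] by decide +kernel]
    simp [evalL]
  have hdvd : (a : AdjoinRoot undecic) - (7 * b' : ℤ) * θ ∣ 1 := by
    have h1 := sub_dvd_evalL_sub (a : AdjoinRoot undecic) ((7 * b' : ℤ) * θ)
      [486 * (7 * b') ^ 11, 2673 * (7 * b') ^ 10, 8910 * (7 * b') ^ 9, 13365 * (7 * b') ^ 8,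
      17820 * (7 * b') ^ 7, 12474 * (7 * b') ^ 6, 8316 * (7 * b') ^ 5, 2970 * (7 * b') ^ 4,
      990 * (7 * b') ^ 3, 165 * (7 * b') ^ 2, 22 * (7 * b'), 1]
    convert h1 using 1
    have h2 := congrArg (Int.cast : ℤ → AdjoinRoot undecic) h
    simp only [evalL] at hroot ⊢
    push_cast at h2 hroot ⊢
    linear_combination -h2 + (7 * (b' : AdjoinRoot undecic)) ^ 11 * hroot
  obtain ⟨η, hη⟩ := isUnit_of_dvd_one hdvd
  have := (eq_zero_of_lists undecic_monic undecic_irreducible (n := 11) (by norm_num)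
    undecic_natDegree (f := undecicRed) (by decide) undecic_root_pow undecic_card_roots
    (ι := Fin 5) (by simp) (l := 7) (by norm_num) (by norm_num) (U := undecicUnit)
    (V := undecicUnitInv) (X := undecicLead) (T := undecicRoot) (by decide) (by decide)
    (by decide) (by decide) (M := 16806) (k := 15) (by norm_num) (by decide +kernel)
    (by decide +kernel) ?_ (η := η) (a := a') (b := -b') ?_).2
  · simpa using this
  · intro a b m hm
    simp only [Fin.sum_univ_five, undecicLead, undecicRoot] at hm
    obtain ⟨k0, hk0⟩ := hm 0 (by norm_num)
    obtain ⟨k1, hk1⟩ := hm 1 (by norm_num)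
    obtain ⟨k2, hk2⟩ := hm 2 (by norm_num)
    obtain ⟨k3, hk3⟩ := hm 3 (by norm_num)
    obtain ⟨k4, hk4⟩ := hm 4 (by norm_num)
    obtain ⟨k5, hk5⟩ := hm 5 (by norm_num)
    obtain ⟨k6, hk6⟩ := hm 6 (by norm_num)
    simp at hk0 hk1 hk2 hk3 hk4 hk5 hk6
    have da : (7 : ℤ) ∣ a :=
      ⟨1 * k0 + 4 * k1 + 6 * k3 + 3 * k4 + 4 * k5 + 2 * k6 - 2 * b - 5 * m 0 - 12 * m 1 -
        14 * m 2 - 10 * m 3 - 9 * m 4,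
        by linear_combination 1 * hk0 + 4 * hk1 + 6 * hk3 + 3 * hk4 + 4 * hk5 + 2 * hk6⟩
    have db : (7 : ℤ) ∣ b :=
      ⟨2 * k1 + 6 * k2 + 3 * k3 + 2 * k4 + 2 * k5 + 5 * k6 - 1 * b - 3 * m 0 - 14 * m 1 -
        15 * m 2 - 11 * m 3 - 8 * m 4,
        by linear_combination 2 * hk1 + 6 * hk2 + 3 * hk3 + 2 * hk4 + 2 * hk5 + 5 * hk6⟩
    have dm0 : (7 : ℤ) ∣ m 0 :=
      ⟨2 * k1 + 6 * k2 + 4 * k3 + 3 * k4 + 5 * k5 + 2 * k6 + 5 * b - 5 * m 0 - 15 * m 1 -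
        16 * m 2 - 12 * m 3 - 11 * m 4,
        by linear_combination 2 * hk1 + 6 * hk2 + 4 * hk3 + 3 * hk4 + 5 * hk5 + 2 * hk6⟩
    have dm1 : (7 : ℤ) ∣ m 1 :=
      ⟨4 * k1 + 5 * k2 + 1 * k3 + 1 * k4 + 5 * k5 + 15 * b - 4 * m 0 - 11 * m 1 - 12 * m 2 -
        9 * m 3 - 7 * m 4,
        by linear_combination 4 * hk1 + 5 * hk2 + 1 * hk3 + 1 * hk4 + 5 * hk5⟩
    have dm2 : (7 : ℤ) ∣ m 2 :=
      ⟨3 * k1 + 6 * k2 + 6 * k3 + 6 * k5 + 5 * k6 + 3 * b - 5 * m 0 - 19 * m 1 - 18 * m 2 -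
        14 * m 3 - 12 * m 4,
        by linear_combination 3 * hk1 + 6 * hk2 + 6 * hk3 + 6 * hk5 + 5 * hk6⟩
    have dm3 : (7 : ℤ) ∣ m 3 :=
      ⟨3 * k1 + 4 * k2 + 6 * k3 + 5 * k4 + 6 * k5 + 4 * k6 + 3 * b - 7 * m 0 - 18 * m 1 -
        20 * m 2 - 15 * m 3 - 13 * m 4,
        by linear_combination 3 * hk1 + 4 * hk2 + 6 * hk3 + 5 * hk4 + 6 * hk5 + 4 * hk6⟩
    have dm4 : (7 : ℤ) ∣ m 4 :=
      ⟨4 * k1 + 6 * k2 + 1 * k3 + 4 * k4 + 2 * k5 + 6 * k6 + 6 * b - 4 * m 0 - 15 * m 1 -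
        18 * m 2 - 13 * m 3 - 7 * m 4,
        by linear_combination 4 * hk1 + 6 * hk2 + 1 * hk3 + 4 * hk4 + 2 * hk5 + 6 * hk6⟩
    refine ⟨da, db, fun i => ?_⟩
    fin_cases i
    exacts [dm0, dm1, dm2, dm3, dm4]
  · rw [hη, ← hrdef, ← hθ]
    have h2 := congrArg (Int.cast : ℤ → AdjoinRoot undecic) ha'
    push_cast at h2 ⊢
    linear_combination h2

end UndecicThue

end RamanujanTau

namespace RamanujanTau

section RealQuadratic

open Zsqrtd

theorem exists_two_mul_abs_sub_le (A N : ℤ) (hN : N ≠ 0) : ∃ a : ℤ, 2 * |A - a * N| ≤ |N| := by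
  have hpos := abs_pos.2 hN
  have h1 := Int.emod_nonneg A hN
  have h2 := Int.emod_lt_abs A hN
  have h3 := Int.emod_add_mul_ediv A N
  rcases le_or_gt (2 * (A % N)) |N| with h | h
  · refine ⟨A / N, ?_⟩
    rw [show A - A / N * N = A % N by linarith, abs_of_nonneg h1]
    exact h
  · rcases abs_cases N with ⟨hc, -⟩ | ⟨hc, -⟩
    · refine ⟨A / N + 1, ?_⟩
      rw [show A - (A / N + 1) * N = A % N - |N| by rw [hc]; linarith, abs_of_neg (by linarith)]
      linarith
    · refine ⟨A / N - 1, ?_⟩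
      rw [show A - (A / N - 1) * N = A % N - |N| by rw [hc]; linarith, abs_of_neg (by linarith)]
      linarith

theorem nonsquare_three : ∀ n : ℕ, 3 ≠ n * n := by
  intro n h
  rcases le_or_gt n 1 with hn | hn
  · interval_cases n <;> omega
  · nlinarith

theorem norm_ne_zero_of_ne_zero {y : ℤ√3} (hy : y ≠ 0) : y.norm ≠ 0 := by
  exact fun h => hy ((Zsqrtd.norm_eq_zero (d := 3) (fun z hz =>
    nonsquare_three z.natAbs (by zify; rw [abs_mul_abs_self, ← hz])) y).1 h)

theorem exists_norm_sub_mul_lt (x y : ℤ√3) (hy : y ≠ 0) :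
    ∃ q : ℤ√3, (x - q * y).norm.natAbs < y.norm.natAbs := by
  have hN := norm_ne_zero_of_ne_zero hy
  obtain ⟨a, ha⟩ := exists_two_mul_abs_sub_le (x * star y).re y.norm hN
  obtain ⟨b, hb⟩ := exists_two_mul_abs_sub_le (x * star y).im y.norm hN
  refine ⟨⟨a, b⟩, ?_⟩
  have key : (x - ⟨a, b⟩ * y).norm * y.norm = ((x * star y).re - a * y.norm) ^ 2 -
      3 * ((x * star y).im - b * y.norm) ^ 2 := by
    simp only [Zsqrtd.norm_def, Zsqrtd.re_sub, Zsqrtd.im_sub, Zsqrtd.re_mul, Zsqrtd.im_mul,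
      Zsqrtd.re_star, Zsqrtd.im_star]
    ring
  set s := (x * star y).re - a * y.norm
  set t := (x * star y).im - b * y.norm
  have hs : 4 * s ^ 2 ≤ y.norm ^ 2 := by
    rw [← sq_abs s, ← sq_abs y.norm]; nlinarith [abs_nonneg s]
  have ht : 4 * t ^ 2 ≤ y.norm ^ 2 := by
    rw [← sq_abs t, ← sq_abs y.norm]; nlinarith [abs_nonneg t]
  have h2 : |(x - ⟨a, b⟩ * y).norm| * |y.norm| < |y.norm| * |y.norm| := by
    rw [← abs_mul, key, abs_mul_abs_self]
    have : 0 < y.norm ^ 2 := by positivity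
    rw [abs_lt]
    constructor <;> nlinarith [sq_nonneg s, sq_nonneg t]
  have h3 := lt_of_mul_lt_mul_right h2 (abs_nonneg _)
  zify
  exact h3

theorem isDomain_zsqrtd_three : IsDomain (ℤ√3) :=
  have : NoZeroDivisors (ℤ√3) := ⟨fun {x y} h => by
    by_contra! hxy
    refine mul_ne_zero (norm_ne_zero_of_ne_zero hxy.1) (norm_ne_zero_of_ne_zero hxy.2) ?_
    rw [← Zsqrtd.norm_mul, h, Zsqrtd.norm_zero]⟩
  NoZeroDivisors.to_isDomain _

theorem isPrincipalIdealRing_zsqrtd_three : IsPrincipalIdealRing (ℤ√3) := by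
  classical
  have := isDomain_zsqrtd_three
  have hq (x y : ℤ√3) : ∃ q : ℤ√3, y ≠ 0 → (x - q * y).norm.natAbs < y.norm.natAbs := by
    by_cases hy : y = 0
    · exact ⟨0, fun h => absurd hy h⟩
    · obtain ⟨q, hq⟩ := exists_norm_sub_mul_lt x y hy
      exact ⟨q, fun _ => hq⟩
  choose q hq using hq
  let E : EuclideanDomain (ℤ√3) :=
    { (inferInstance : CommRing (ℤ√3)), (inferInstance : Nontrivial (ℤ√3)) with
      quotient := fun x y => if y = 0 then 0 else q x y
      quotient_zero := by simp
      remainder := fun x y => if y = 0 then x else x - q x y * y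
      quotient_mul_add_remainder_eq := fun x y => by
        by_cases hy : y = 0 <;> simp [hy]; ring
      r := fun x y => x.norm.natAbs < y.norm.natAbs
      r_wellFounded := (measure fun x : ℤ√3 => x.norm.natAbs).wf
      remainder_lt := fun x y hy => by simpa [hy] using hq x y hy
      mul_left_not_lt := fun x y hy => by
        rw [Zsqrtd.norm_mul, Int.natAbs_mul, not_lt]
        exact Nat.le_mul_of_pos_right _ (Int.natAbs_pos.2 (norm_ne_zero_of_ne_zero hy)) }
  exact @EuclideanDomain.to_principal_ideal_domain _ E

/-- The fundamental unit `2 + √3`. -/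
def unitSqrtThree : Pell.Solution₁ 3 := Pell.Solution₁.mk 2 1 (by norm_num)

theorem isFundamental_unitSqrtThree : Pell.IsFundamental unitSqrtThree :=
  ⟨by simp [unitSqrtThree], by simp [unitSqrtThree], fun h => by
    simp only [unitSqrtThree, Pell.Solution₁.x_mk]; omega⟩

theorem exists_eq_pow_mul_pow_eleven {x : ℤ√3} {δ : ℤ√3} (h : Associated (δ ^ 11) x) :
    ∃ i < 11, ∃ γ : ℤ√3, x = ⟨2, 1⟩ ^ i * γ ^ 11 := by
  obtain ⟨u, rfl⟩ := h
  have hu : (u : ℤ√3).norm = 1 := by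
    have h1 := (Zsqrtd.isUnit_iff_norm_isUnit (u : ℤ√3)).1 u.isUnit
    rcases Int.isUnit_iff.1 h1 with h | h
    · exact h
    · exfalso
      rw [Zsqrtd.norm_def] at h
      have h3 := congrArg (Int.cast : ℤ → ZMod 3) h
      push_cast at h3
      rw [show (3 : ZMod 3) = 0 from rfl] at h3
      generalize ((u : ℤ√3).re : ZMod 3) = z at h3
      revert h3; revert z; simp; decide
  let s : Pell.Solution₁ 3 := Pell.Solution₁.mk (u : ℤ√3).re (u : ℤ√3).im (by
    rw [Zsqrtd.norm_def] at hu; linarith)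
  have hs : (s : ℤ√3) = u := by
    ext <;> rfl
  have hdecomp (n : ℤ) : ∃ i < 11, ∃ w : Pell.Solution₁ 3,
      unitSqrtThree ^ n = unitSqrtThree ^ i * w ^ 11 := by
    refine ⟨(n % 11).toNat, by omega, unitSqrtThree ^ (n / 11), ?_⟩
    rw [← zpow_natCast, ← zpow_natCast, ← zpow_mul, ← zpow_add]
    congr 1
    push_cast
    omega
  obtain ⟨n, hn⟩ := isFundamental_unitSqrtThree.eq_zpow_or_neg_zpow s
  obtain ⟨i, hi, w, hw⟩ := hdecomp n
  rw [hw] at hn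
  have hcoe : ((unitSqrtThree ^ i * w ^ 11 : Pell.Solution₁ 3) : ℤ√3) =
      ⟨2, 1⟩ ^ i * (w : ℤ√3) ^ 11 := rfl
  refine ⟨i, hi, ?_⟩
  rcases hn with hn | hn
  · refine ⟨w * δ, ?_⟩
    rw [← hs, hn, hcoe]
    ring
  · refine ⟨-(w * δ), ?_⟩
    rw [← hs, hn, show ((-(unitSqrtThree ^ i * w ^ 11) : Pell.Solution₁ 3) : ℤ√3) =
      -((unitSqrtThree ^ i * w ^ 11 : Pell.Solution₁ 3) : ℤ√3) from rfl, hcoe]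
    ring

theorem sq_eq_pow_eleven_add_three {t q : ℤ} (h : t ^ 2 = q ^ 11 + 3) (hq : ¬ 2 ∣ q)
    (ht7 : (7 : ℤ) ∣ t - 2) (ht23 : (23 : ℤ) ∣ t - 2) : t = 2 := by
  have := isDomain_zsqrtd_three
  have := isPrincipalIdealRing_zsqrtd_three
  have hcop : IsCoprime (12 : ℤ) (q ^ 11) := by
    refine IsCoprime.pow_right ?_
    have h2 : IsCoprime (2 : ℤ) q := (Prime.coprime_iff_not_dvd Int.prime_two).2 hq
    have h3 : IsCoprime (3 : ℤ) q := (Prime.coprime_iff_not_dvd Int.prime_three).2 fun hd => by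
      have ht : (3 : ℤ) ∣ t := Int.prime_three.dvd_of_dvd_pow (n := 2) (by
        rw [h]; exact dvd_add (dvd_pow hd (by norm_num)) dvd_rfl)
      have h9 : (9 : ℤ) ∣ t ^ 2 := by simpa using pow_dvd_pow_of_dvd ht 2
      have h9' : (9 : ℤ) ∣ q ^ 11 :=
        (show (9 : ℤ) ∣ q ^ 2 by simpa using pow_dvd_pow_of_dvd hd 2).trans
          (pow_dvd_pow q (by norm_num))
      omega
    simpa using (h2.pow_left (m := 2)).mul_left h3
  have hprod : (⟨t, 1⟩ : ℤ√3) * ⟨t, -1⟩ = (q : ℤ√3) ^ 11 := by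
    rw [← Int.cast_pow, show q ^ 11 = t * t - 3 by linarith]
    ext <;> simp <;> ring
  have hcop' : IsCoprime (⟨t, 1⟩ : ℤ√3) ⟨t, -1⟩ := by
    obtain ⟨u, v, huv⟩ := hcop
    refine ⟨u * ⟨0, 2⟩ + v * ⟨t, -1⟩, - u * ⟨0, 2⟩, ?_⟩
    have h1 := congrArg (Int.cast : ℤ → ℤ√3) huv
    push_cast at h1
    rw [← hprod] at h1
    rw [← h1]
    ext <;> simp <;> ring
  obtain ⟨δ, hδ⟩ := exists_associated_pow_of_mul_eq_pow' hcop' hprod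
  obtain ⟨i, hi, γ, hγ⟩ := exists_eq_pow_mul_pow_eleven hδ
  have hi1 : i = 1 := by
    have h1 := congrArg (Zsqrtd.lift (R := ZMod 23) ⟨7, by decide⟩) hγ
    rw [map_mul, map_pow, map_pow] at h1
    generalize Zsqrtd.lift (R := ZMod 23) ⟨7, by decide⟩ γ = z at h1
    have h2 : ((t - 2 : ℤ) : ZMod 23) = 0 := (ZMod.intCast_zmod_eq_zero_iff_dvd _ 23).2 ht23
    simp only [Zsqrtd.lift_apply_apply] at h1
    push_cast at h1 h2
    rw [sub_eq_zero.1 h2] at h1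
    have dec : ∀ i < 11, ∀ z : ZMod 23, (2 + 1 * 7) = (2 + 1 * 7) ^ i * z ^ 11 → i = 1 := by
      decide +kernel
    exact dec i hi z (by simpa using h1)
  subst hi1
  obtain ⟨a, b⟩ := γ
  have hpow : (⟨a, b⟩ : ℤ√3) ^ 11 = ⟨a ^ 11 + 165 * a ^ 9 * b ^ 2 + 2970 * a ^ 7 * b ^ 4 +
      12474 * a ^ 5 * b ^ 6 + 13365 * a ^ 3 * b ^ 8 + 2673 * a * b ^ 10,
      11 * a ^ 10 * b + 495 * a ^ 8 * b ^ 3 + 4158 * a ^ 6 * b ^ 5 + 8910 * a ^ 4 * b ^ 7 +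
      4455 * a ^ 2 * b ^ 9 + 243 * b ^ 11⟩ := by
    rw [show (11 : ℕ) = 2 * (2 * 2 + 1) + 1 from rfl, pow_succ, pow_mul, pow_succ, pow_mul]
    simp only [pow_two]
    ext <;> simp <;> ring
  rw [hpow, pow_one] at hγ
  have him := congrArg Zsqrtd.im hγ
  have hre := congrArg Zsqrtd.re hγ
  simp only [Zsqrtd.im_mul, Zsqrtd.re_mul] at him hre
  have h7 : (a : ZMod 7) = 1 ∧ (b : ZMod 7) = 0 := by
    have h2 : ((t - 2 : ℤ) : ZMod 7) = 0 := (ZMod.intCast_zmod_eq_zero_iff_dvd _ 7).2 ht7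
    have him7 := congrArg (Int.cast : ℤ → ZMod 7) him
    have hre7 := congrArg (Int.cast : ℤ → ZMod 7) hre
    push_cast at him7 hre7 h2
    rw [sub_eq_zero.1 h2] at hre7
    generalize (a : ZMod 7) = a at *
    generalize (b : ZMod 7) = b at *
    clear h2 him hre hγ hpow hδ
    revert a b
    decide +kernel
  have ha : (7 : ℤ) ∣ a - 1 := by
    exact (ZMod.intCast_zmod_eq_zero_iff_dvd _ 7).1 (by push_cast; simp [h7.1])
  have hb : (7 : ℤ) ∣ b := by
    exact (ZMod.intCast_zmod_eq_zero_iff_dvd _ 7).1 h7.2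
  obtain rfl := eq_zero_of_thue ha hb (by linear_combination -him)
  have ha1 : a ^ 11 = 1 := by linarith
  rw [hre]
  linear_combination 2 * ha1

end RealQuadratic

end RamanujanTau

namespace RamanujanTau

open Polynomial

section Sextic

/-- The polynomial whose squared roots generate the real subfield of `ℚ(ζ₇)`. -/
noncomputable def sextic : ℤ[X] := X ^ 6 - 2 * X ^ 4 - X ^ 2 + 1

theorem sextic_monic : sextic.Monic := by
  unfold sextic; monicity!

theorem sextic_natDegree : sextic.natDegree = 6 := by
  unfold sextic; compute_degree!

theorem irreducible_X_sq_sub_three : Irreducible (X ^ 2 - C 3 : (ZMod 7)[X]) := by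
  have hns : ∀ x : ZMod 7, x ^ 2 - 3 ≠ 0 := by decide
  have : Fact (Nat.Prime 7) := ⟨by norm_num⟩
  have hd : (X ^ 2 - C 3 : (ZMod 7)[X]).natDegree = 2 := natDegree_X_pow_sub_C
  refine irreducible_of_degree_le_three_of_not_isRoot (by rw [hd]; decide) ?_
  intro x hx
  simp only [IsRoot, eval_sub, eval_pow, eval_X, eval_C] at hx
  exact hns x hx

theorem sextic_irreducible : Irreducible sextic := by
  have : Fact (Nat.Prime 7) := ⟨by norm_num⟩
  have h : sextic = (X ^ 2 - C 3) ^ 3 + C ((7 : ℕ) : ℤ) * ((X ^ 2 - 1) * (X ^ 2 - C 3) + 1) := by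
    unfold sextic
    rw [show (C 3 : ℤ[X]) = 3 from rfl, show (C ((7 : ℕ) : ℤ) : ℤ[X]) = 7 from rfl]
    ring
  rw [h]
  refine irreducible_pow_add (by norm_num) ?_ (monic_X_pow_sub_C 3 (by norm_num)) ?_ (i := 0) ?_
    (h ▸ sextic_monic)
  · rw [Polynomial.map_sub, Polynomial.map_pow, map_X, map_C]
    exact irreducible_X_sq_sub_three
  · rw [degree_X_pow_sub_C (by norm_num), degree_one]; norm_num
  · rw [coeff_one_zero]; norm_num

theorem sextic_card_roots : (sextic.map (Int.castRingHom ℝ)).roots.toFinset.card ≤ 4 := by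
  obtain ⟨v, ⟨hv1, hv2⟩, hv⟩ :
      (0 : ℝ) ∈ (fun x : ℝ => x ^ 3 - 2 * x ^ 2 - x + 1) '' Set.Icc (-1) 0 :=
    intermediate_value_Icc (by norm_num) (by fun_prop) (by norm_num)
  dsimp only at hv
  have hv0 : v < 0 := lt_of_le_of_ne hv2 (by rintro rfl; norm_num at hv)
  set p : ℝ[X] := X ^ 4 + C (v - 2) * X ^ 2 + C (v ^ 2 - 2 * v - 1) with hp
  have hpm : p.Monic := by rw [hp]; monicity!
  have hpd : p.natDegree = 4 := by rw [hp]; compute_degree!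
  have hsub : (sextic.map (Int.castRingHom ℝ)).roots.toFinset ⊆ p.roots.toFinset := by
    intro x hx
    rw [Multiset.mem_toFinset, mem_roots (sextic_monic.map _).ne_zero, IsRoot, eval_map,
      sextic] at hx
    rw [Multiset.mem_toFinset, mem_roots hpm.ne_zero, IsRoot, hp]
    simp at hx ⊢
    have h0 : x ^ 2 - v ≠ 0 := by nlinarith [sq_nonneg x]
    refine (mul_eq_zero.1 ?_).resolve_left h0
    linear_combination hx - hv
  refine (Finset.card_le_card hsub).trans ?_
  rw [← hpd]
  exact (Multiset.toFinset_card_le _).trans (card_roots' p)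

/-- Coefficients of `X ^ 6` modulo `sextic`. -/
def sexticRed : List ℤ := [-1, 0, 1, 0, 2, 0]

theorem sextic_root_pow :
    AdjoinRoot.root sextic ^ 6 = evalL (AdjoinRoot.root sextic) sexticRed := by
  have h : AdjoinRoot.mk sextic (X ^ 6 - 2 * X ^ 4 - X ^ 2 + 1) = 0 := AdjoinRoot.mk_self
  simp only [map_sub, map_add, map_mul, map_pow, map_one, AdjoinRoot.mk_X, map_ofNat] at h
  simp only [sexticRed, evalL]
  push_cast
  linear_combination h

/-- Coefficients of a root of `x ^ 2 - (2 * c ^ 2 - 2 * c + 4) * x + 7 * (2 * c - 1)`, where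
`c` is `cubicRootInSextic`. -/
def sexticGamma : List ℤ := [8, 8, 4, 4, -3, -3]

/-- Units of `ℤ[X] / (sextic)`. -/
def sexticUnit : Fin 4 → List ℤ :=
  ![[0, 1, 0, 0, 0, 0], [-1, 1, 0, 0, 0, 0], [1, 0, 1, 0, 0, 0], [-1, -1, 1, 0, 0, 0]]

/-- The inverses of `sexticUnit`. -/
def sexticUnitInv : Fin 4 → List ℤ :=
  ![[0, 1, 0, 2, 0, -1], [-2, -2, -1, -1, 1, 1], [2, 0, -3, 0, 1, 0], [1, -2, 1, -2, -1, 1]]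

/-- The elements `x` with `u ^ (23 ^ 6 - 1) = 1 + 23 * x` modulo `23 ^ 2`, for `u` in
`sexticUnit`. -/
def sexticLead : Fin 4 → List ℤ :=
  ![[2, 0, 18, 0, 16, 0], [13, 5, 3, 1, 4, 20], [2, 0, 14, 0, 2, 0], [1, 1, 11, 19, 15, 6]]

/-- The element `2 + ζ + ζ⁻¹` of the real subfield of `ℚ(ζ₇)`, inside `ℤ[X] / (sextic)`. -/
noncomputable def cubicRootInSextic : AdjoinRoot sextic :=
  3 + AdjoinRoot.root sextic ^ 2 - AdjoinRoot.root sextic ^ 4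

theorem cubicRootInSextic_eq :
    cubicRootInSextic ^ 3 - 5 * cubicRootInSextic ^ 2 + 6 * cubicRootInSextic - 1 = 0 := by
  have h := sextic_root_pow
  simp only [sexticRed, evalL] at h
  push_cast at h
  rw [cubicRootInSextic]
  generalize AdjoinRoot.root sextic = r at *
  linear_combination ((-1) * r ^ 0 + (2) * r ^ 2 + (1) * r ^ 4 + (-1) * r ^ 6) * h

theorem sexticGamma_eq :
    evalL (AdjoinRoot.root sextic) sexticGamma ^ 2 -
      (2 * cubicRootInSextic ^ 2 - 2 * cubicRootInSextic + 4) *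
        evalL (AdjoinRoot.root sextic) sexticGamma + 7 * (2 * cubicRootInSextic - 1) = 0 := by
  have h := sextic_root_pow
  simp only [sexticRed, evalL] at h
  push_cast at h
  rw [cubicRootInSextic]
  simp only [sexticGamma, evalL]
  push_cast
  generalize AdjoinRoot.root sextic = r at *
  linear_combination ((-29) * r ^ 0 + (-31) * r ^ 2 + (-16) * r ^ 3 + (1) * r ^ 4 + (-8) * r ^ 5 +
    (6) * r ^ 6 + (6) * r ^ 7) * h

theorem eq_of_isUnit_sextic {s u : ℤ} (hs : (23 : ℤ) ∣ s - 1) (hu : (23 : ℤ) ∣ u)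
    (h : IsUnit ((s : AdjoinRoot sextic) ^ 2 + 7 * (u : AdjoinRoot sextic) ^ 2 *
      (2 * cubicRootInSextic - 1) + (s : AdjoinRoot sextic) * u *
      (2 * cubicRootInSextic ^ 2 - 2 * cubicRootInSextic + 4))) : s = 1 ∧ u = 0 := by
  obtain ⟨s', hs'⟩ := hs
  obtain ⟨u', rfl⟩ := hu
  set r := AdjoinRoot.root sextic with hrdef
  set γ := evalL r sexticGamma with hγ
  have hg := sexticGamma_eq
  rw [← hrdef, ← hγ] at hg
  have hη : IsUnit ((s : AdjoinRoot sextic) + (23 * u' : ℤ) * γ) := by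
    refine isUnit_of_dvd_unit ⟨s + (23 * u' : ℤ) *
      (2 * cubicRootInSextic ^ 2 - 2 * cubicRootInSextic + 4 - γ), ?_⟩ h
    push_cast
    linear_combination (23 * (u' : AdjoinRoot sextic)) ^ 2 * hg
  obtain ⟨η, hη⟩ := hη
  have := eq_zero_of_lists sextic_monic sextic_irreducible (n := 6) (by norm_num)
    sextic_natDegree (f := sexticRed) (by decide) sextic_root_pow sextic_card_roots
    (ι := Fin 4) (by simp) (l := 23) (by norm_num) (by norm_num) (U := sexticUnit)
    (V := sexticUnitInv) (X := sexticLead) (T := sexticGamma) (by decide) (by decide)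
    (by decide) (by decide) (M := 148035888) (k := 28) (by norm_num) (by decide +kernel)
    (by decide +kernel) ?_ (η := η) (a := s') (b := u') ?_
  · obtain ⟨rfl, rfl⟩ := this
    exact ⟨by linarith, by simp⟩
  · intro a b m hm
    simp only [Fin.sum_univ_four, sexticLead, sexticGamma] at hm
    obtain ⟨k0, hk0⟩ := hm 0 (by norm_num)
    obtain ⟨k1, hk1⟩ := hm 1 (by norm_num)
    obtain ⟨k2, hk2⟩ := hm 2 (by norm_num)
    obtain ⟨k3, hk3⟩ := hm 3 (by norm_num)
    obtain ⟨k4, hk4⟩ := hm 4 (by norm_num)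
    obtain ⟨k5, hk5⟩ := hm 5 (by norm_num)
    simp at hk0 hk1 hk2 hk3 hk4 hk5
    have da : (23 : ℤ) ∣ a :=
      ⟨1 * k0 + 9 * k1 + 16 * k2 + 15 * k3 + 2 * k4 + 20 * k5 - 6 * b - 14 * m 0 - 23 * m 1 -
        10 * m 2 - 27 * m 3,
        by linear_combination 1 * hk0 + 9 * hk1 + 16 * hk2 + 15 * hk3 + 2 * hk4 + 20 * hk5⟩
    have db : (23 : ℤ) ∣ b :=
      ⟨3 * k1 + 5 * k3 + 22 * k5 + 1 * b - 20 * m 1 - 10 * m 3,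
        by linear_combination 3 * hk1 + 5 * hk3 + 22 * hk5⟩
    have dm0 : (23 : ℤ) ∣ m 0 :=
      ⟨4 * k1 + 11 * k2 + 12 * k3 + 15 * k4 + 11 * k5 - 2 * b - 19 * m 0 - 15 * m 1 - 8 * m 2 -
        28 * m 3,
        by linear_combination 4 * hk1 + 11 * hk2 + 12 * hk3 + 15 * hk4 + 11 * hk5⟩
    have dm1 : (23 : ℤ) ∣ m 1 :=
      ⟨6 * k1 + 9 * k3 + 5 * k5 - 3 * b - 6 * m 1 - 9 * m 3,
        by linear_combination 6 * hk1 + 9 * hk3 + 5 * hk5⟩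
    have dm2 : (23 : ℤ) ∣ m 2 :=
      ⟨13 * k1 + 4 * k2 + 2 * k3 + 7 * k4 + 5 * k5 - 4 * b - 8 * m 0 - 9 * m 1 - 3 * m 2 - 10 * m 3,
        by linear_combination 13 * hk1 + 4 * hk2 + 2 * hk3 + 7 * hk4 + 5 * hk5⟩
    have dm3 : (23 : ℤ) ∣ m 3 :=
      ⟨16 * k1 + 7 * k3 + 6 * k5 - 6 * b - 9 * m 1 - 8 * m 3,
        by linear_combination 16 * hk1 + 7 * hk3 + 6 * hk5⟩
    refine ⟨da, db, fun i => ?_⟩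
    fin_cases i
    exacts [dm0, dm1, dm2, dm3]
  · rw [hη, ← hrdef, ← hγ]
    have h2 := congrArg (Int.cast : ℤ → AdjoinRoot sextic) hs'
    push_cast at h2 ⊢
    linear_combination h2

end Sextic

end RamanujanTau

namespace RamanujanTau

open Polynomial

section Cubic

/-- The minimal polynomial of `2 + ζ + ζ⁻¹`, where `ζ` is a primitive seventh root of unity. -/
noncomputable def cubic : ℤ[X] := X ^ 3 - 5 * X ^ 2 + 6 * X - 1

theorem cubic_monic : cubic.Monic := by
  unfold cubic; monicity!

theorem cubic_natDegree : cubic.natDegree = 3 := by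
  unfold cubic; compute_degree!

theorem cubic_irreducible : Irreducible cubic := by
  have : Fact (Nat.Prime 7) := ⟨by norm_num⟩
  have h : cubic = (X - C 4) ^ 3 + C ((7 : ℕ) : ℤ) * ((X - 2) * (X - C 4) + 1) := by
    unfold cubic
    rw [show (C 4 : ℤ[X]) = 4 from rfl, show (C ((7 : ℕ) : ℤ) : ℤ[X]) = 7 from rfl]
    ring
  rw [h]
  refine irreducible_pow_add (by norm_num) ?_ (monic_X_sub_C 4) ?_ (i := 0) ?_
    (h ▸ cubic_monic)
  · rw [Polynomial.map_sub, map_X, map_C]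
    exact irreducible_X_sub_C _
  · rw [degree_X_sub_C, degree_one]; norm_num
  · rw [coeff_one_zero]; norm_num

theorem cubic_card_roots : (cubic.map (Int.castRingHom ℝ)).roots.toFinset.card ≤ 3 := by
  rw [← cubic_natDegree, ← cubic_monic.natDegree_map (Int.castRingHom ℝ)]
  exact (Multiset.toFinset_card_le _).trans (card_roots' _)

theorem cubic_root_pow : AdjoinRoot.root cubic ^ 3 =
    5 * AdjoinRoot.root cubic ^ 2 - 6 * AdjoinRoot.root cubic + 1 := by
  have h : AdjoinRoot.mk cubic (X ^ 3 - 5 * X ^ 2 + 6 * X - 1) = 0 := AdjoinRoot.mk_self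
  simp only [map_sub, map_add, map_mul, map_pow, map_one, AdjoinRoot.mk_X, map_ofNat] at h
  linear_combination h

theorem exists_cubic_coords (w : AdjoinRoot cubic) : ∃ x y z : ℤ,
    w = x + y * AdjoinRoot.root cubic + z * AdjoinRoot.root cubic ^ 2 := by
  obtain ⟨p, rfl⟩ := AdjoinRoot.mk_surjective w
  have hd : (p %ₘ cubic).natDegree < 3 :=
    cubic_natDegree ▸ natDegree_modByMonic_lt p cubic_monic fun h => by
      have := cubic_natDegree
      rw [h, natDegree_one] at this
      omega
  have h1 : AdjoinRoot.mk cubic p = AdjoinRoot.mk cubic (p %ₘ cubic) := by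
    rw [← sub_eq_zero, ← map_sub, AdjoinRoot.mk_eq_zero]
    exact ⟨p /ₘ cubic, by linear_combination -modByMonic_add_div p cubic⟩
  refine ⟨(p %ₘ cubic).coeff 0, (p %ₘ cubic).coeff 1, (p %ₘ cubic).coeff 2, ?_⟩
  rw [h1]
  conv_lhs => rw [as_sum_range_C_mul_X_pow' _ hd]
  simp [Finset.sum_range_succ]

theorem dvd_cubic_coords {l x y z : ℤ} (h : (l : AdjoinRoot cubic) ∣
    x + y * AdjoinRoot.root cubic + z * AdjoinRoot.root cubic ^ 2) : l ∣ x ∧ l ∣ y ∧ l ∣ z := by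
  have key := dvd_getD_of_dvd_evalL cubic_monic (u := [x, y, z]) (by simp [cubic_natDegree])
    (l := l) (by convert h using 1; simp only [evalL]; ring)
  exact ⟨key 0, key 1, key 2⟩

/-- Reduction of `ℤ[X] / (cubic)` at the prime above `7`. -/
noncomputable def cubicModSeven : AdjoinRoot cubic →+* ZMod 7 :=
  AdjoinRoot.lift (Int.castRingHom _) 4 (by simp [cubic]; decide)

theorem exists_sq_of_relation {u e₁ e₂ : (AdjoinRoot cubic)ˣ}
    (hpar : ∀ n₀ n₁ n₂ : ℤ,
      u ^ n₀ * e₁ ^ n₁ * e₂ ^ n₂ = 1 ∨ u ^ n₀ * e₁ ^ n₁ * e₂ ^ n₂ = -1 → 2 ∣ n₁ ∧ 2 ∣ n₂)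
    (N : ℕ) (n₀ n₁ n₂ : ℤ) (hN : n₀.natAbs + n₁.natAbs + n₂.natAbs ≤ N)
    (hn : n₀ ≠ 0 ∨ n₁ ≠ 0 ∨ n₂ ≠ 0)
    (h : u ^ n₀ * e₁ ^ n₁ * e₂ ^ n₂ = 1 ∨ u ^ n₀ * e₁ ^ n₁ * e₂ ^ n₂ = -1) :
    ∃ v, u = v ^ 2 ∨ u = -v ^ 2 := by
  have := isDomain_adjoinRoot cubic_irreducible
  have hd (a : (AdjoinRoot cubic)ˣ) (k : ℤ) : a ^ (2 * k) = (a ^ k) ^ 2 := by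
    rw [mul_comm, zpow_mul]; rfl
  induction N generalizing n₀ n₁ n₂ with
  | zero => omega
  | succ N ih =>
    obtain ⟨⟨k₁, rfl⟩, ⟨k₂, rfl⟩⟩ := hpar n₀ n₁ n₂ h
    rcases Int.even_or_odd' n₀ with ⟨k₀, rfl | rfl⟩
    · rw [hd, hd, hd, ← mul_pow, ← mul_pow] at h
      refine ih k₀ k₁ k₂ (by omega) (by omega) ?_
      rcases h with h | h
      · have h1 := congrArg Units.val h
        rw [Units.val_pow_eq_pow_val, Units.val_one] at h1
        exact (sq_eq_one_iff.1 h1).imp (fun h => Units.ext h) (fun h => Units.ext h)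
      · exfalso
        have h7 := congrArg (fun x : (AdjoinRoot cubic)ˣ => cubicModSeven x) h
        simp only [Units.val_pow_eq_pow_val, map_pow, Units.val_neg, Units.val_one, map_neg,
          map_one] at h7
        have dec : ∀ z : ZMod 7, z ^ 2 ≠ -1 := by decide
        exact dec _ h7
    · rw [zpow_add_one, hd, hd, hd, mul_right_comm _ u, mul_right_comm _ u, ← mul_pow,
        ← mul_pow] at h
      refine ⟨(u ^ k₀ * e₁ ^ k₁ * e₂ ^ k₂)⁻¹, h.imp (fun h => ?_) (fun h => ?_)⟩
      · rw [inv_pow]; exact eq_inv_of_mul_eq_one_right h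
      · rw [inv_pow, ← mul_right_inj, h, mul_neg, mul_inv_cancel]

/-- The square of `x + y * c + z * c ^ 2`, where `c` is the root of `cubic`. -/
theorem cubic_sq (x y z : ℤ) :
    ((x : AdjoinRoot cubic) + y * AdjoinRoot.root cubic + z * AdjoinRoot.root cubic ^ 2) ^ 2 =
      ((x ^ 2 + 2 * y * z + 5 * z ^ 2 : ℤ) : AdjoinRoot cubic) +
      ((2 * x * y - 12 * y * z - 29 * z ^ 2 : ℤ) : AdjoinRoot cubic) * AdjoinRoot.root cubic +
      ((y ^ 2 + 2 * x * z + 10 * y * z + 19 * z ^ 2 : ℤ) : AdjoinRoot cubic) *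
        AdjoinRoot.root cubic ^ 2 := by
  have h := cubic_root_pow
  generalize AdjoinRoot.root cubic = c at *
  push_cast
  linear_combination (2 * y * z + z ^ 2 * c + 5 * z ^ 2 : AdjoinRoot cubic) * h

/-- The class of `X - 1` as a unit of `ℤ[X] / (cubic)`. -/
noncomputable def cubicUnit₁ : (AdjoinRoot cubic)ˣ where
  val := AdjoinRoot.root cubic - 1
  inv := -(AdjoinRoot.root cubic ^ 2 - 4 * AdjoinRoot.root cubic + 2)
  val_inv := by linear_combination -cubic_root_pow
  inv_val := by linear_combination -cubic_root_pow

/-- The class of `X - 2` as a unit of `ℤ[X] / (cubic)`. -/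
noncomputable def cubicUnit₂ : (AdjoinRoot cubic)ˣ where
  val := AdjoinRoot.root cubic - 2
  inv := AdjoinRoot.root cubic ^ 2 - 3 * AdjoinRoot.root cubic
  val_inv := by linear_combination cubic_root_pow
  inv_val := by linear_combination cubic_root_pow

theorem dvd_of_cubic_relation {u : (AdjoinRoot cubic)ˣ} (hu : (4 : AdjoinRoot cubic) ∣ u - 1)
    (n₀ n₁ n₂ : ℤ) (h : u ^ n₀ * cubicUnit₁ ^ n₁ * cubicUnit₂ ^ n₂ = 1 ∨
      u ^ n₀ * cubicUnit₁ ^ n₁ * cubicUnit₂ ^ n₂ = -1) : 2 ∣ n₁ ∧ 2 ∣ n₂ := by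
  obtain ⟨v, b, c, e, hb, hc, he, hn⟩ : ∃ v : (AdjoinRoot cubic)ˣ, ∃ b c : ℕ, ∃ e : ℤ,
      (n₁ % 2 = b ∧ b < 2) ∧ (n₂ % 2 = c ∧ c < 2) ∧ (e = 1 ∨ e = -1) ∧ (4 : AdjoinRoot cubic) ∣
        v ^ 2 * (cubicUnit₁ ^ b * cubicUnit₂ ^ c : (AdjoinRoot cubic)ˣ) - e := by
    have hd (a : (AdjoinRoot cubic)ˣ) (n : ℤ) : ∃ b : ℕ, (n % 2 = b ∧ b < 2) ∧
        a ^ n = (a ^ (n / 2)) ^ 2 * a ^ b := by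
      refine ⟨(n % 2).toNat, by omega, ?_⟩
      rw [← zpow_natCast, ← zpow_natCast, ← zpow_mul, ← zpow_add]
      congr 1
      push_cast
      omega
    obtain ⟨d, hd', h0⟩ := hd u n₀
    obtain ⟨b, hb, h1⟩ := hd cubicUnit₁ n₁
    obtain ⟨c, hc, h2⟩ := hd cubicUnit₂ n₂
    have hprod : u ^ n₀ * cubicUnit₁ ^ n₁ * cubicUnit₂ ^ n₂ =
        u ^ d * ((u ^ (n₀ / 2) * cubicUnit₁ ^ (n₁ / 2) * cubicUnit₂ ^ (n₂ / 2)) ^ 2 *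
          (cubicUnit₁ ^ b * cubicUnit₂ ^ c)) := by
      rw [h0, h1, h2]
      generalize u ^ (n₀ / 2) = a₀, cubicUnit₁ ^ (n₁ / 2) = a₁, cubicUnit₂ ^ (n₂ / 2) = a₂
      ext
      push_cast
      ring
    have hu' : (4 : AdjoinRoot cubic) ∣ (u : AdjoinRoot cubic) ^ d - 1 :=
      hu.trans (by simpa using sub_dvd_pow_sub_pow (u : AdjoinRoot cubic) 1 d)
    obtain ⟨e, he, heq⟩ : ∃ e : ℤ, (e = 1 ∨ e = -1) ∧
        ((u ^ n₀ * cubicUnit₁ ^ n₁ * cubicUnit₂ ^ n₂ : (AdjoinRoot cubic)ˣ) : AdjoinRoot cubic) =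
          e := by
      rcases h with h | h
      · exact ⟨1, .inl rfl, by rw [h]; simp⟩
      · exact ⟨-1, .inr rfl, by rw [h]; simp⟩
    refine ⟨u ^ (n₀ / 2) * cubicUnit₁ ^ (n₁ / 2) * cubicUnit₂ ^ (n₂ / 2), b, c, e, hb, hc, he, ?_⟩
    rw [hprod, Units.val_mul, Units.val_mul, Units.val_pow_eq_pow_val] at heq
    obtain ⟨k, hk⟩ := hu'
    rw [← heq, Units.val_pow_eq_pow_val]
    generalize u ^ (n₀ / 2) * cubicUnit₁ ^ (n₁ / 2) * cubicUnit₂ ^ (n₂ / 2) = V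
    generalize cubicUnit₁ ^ b * cubicUnit₂ ^ c = W
    refine ⟨-(k * ((V : AdjoinRoot cubic) ^ 2 * W)), ?_⟩
    linear_combination -((V : AdjoinRoot cubic) ^ 2 * W) * hk
  obtain ⟨x, y, z, hv⟩ := exists_cubic_coords v
  rw [hv, cubic_sq] at hn
  have hval₁ : (cubicUnit₁ : AdjoinRoot cubic) = AdjoinRoot.root cubic - 1 := rfl
  have hval₂ : (cubicUnit₂ : AdjoinRoot cubic) = AdjoinRoot.root cubic - 2 := rfl
  rw [Units.val_mul, Units.val_pow_eq_pow_val, Units.val_pow_eq_pow_val, hval₁, hval₂] at hn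
  have hr := cubic_root_pow
  set X₀ := x ^ 2 + 2 * y * z + 5 * z ^ 2 with hX₀
  set X₁ := 2 * x * y - 12 * y * z - 29 * z ^ 2 with hX₁
  set X₂ := y ^ 2 + 2 * x * z + 10 * y * z + 19 * z ^ 2 with hX₂
  have toZMod {k : ℤ} (h : 4 ∣ k) : (k : ZMod 4) = 0 := (ZMod.intCast_zmod_eq_zero_iff_dvd k 4).2 h
  have he4 : (e : ZMod 4) = 1 ∨ (e : ZMod 4) = -1 := by
    rcases he with rfl | rfl <;> simp
  obtain ⟨hb, hb2⟩ := hb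
  obtain ⟨hc, hc2⟩ := hc
  interval_cases b <;> interval_cases c
  · omega
  · exfalso
    obtain ⟨h0, h1, h2⟩ := dvd_cubic_coords (l := 4) (x := X₂ - 2 * X₀ - e)
      (y := X₀ - 6 * X₂ - 2 * X₁) (z := X₁ + 5 * X₂ - 2 * X₂) (by
        rw [Int.cast_ofNat]
        convert hn using 1
        push_cast
        linear_combination -(X₂ : AdjoinRoot cubic) * hr)
    have h0 := toZMod h0
    have h1 := toZMod h1
    have h2 := toZMod h2
    simp only [hX₀, hX₁, hX₂] at h0 h1 h2
    push_cast at h0 h1 h2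
    generalize (x : ZMod 4) = x at *
    generalize (y : ZMod 4) = y at *
    generalize (z : ZMod 4) = z at *
    generalize (e : ZMod 4) = e at *
    clear * - h0 h1 h2 he4
    revert x y z e
    decide +kernel
  · exfalso
    obtain ⟨h0, h1, h2⟩ := dvd_cubic_coords (l := 4) (x := X₂ - X₀ - e)
      (y := X₀ - X₁ - 6 * X₂) (z := X₁ + 4 * X₂) (by
        rw [Int.cast_ofNat]
        convert hn using 1
        push_cast
        linear_combination -(X₂ : AdjoinRoot cubic) * hr)
    have h0 := toZMod h0
    have h1 := toZMod h1
    have h2 := toZMod h2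
    simp only [hX₀, hX₁, hX₂] at h0 h1 h2
    push_cast at h0 h1 h2
    generalize (x : ZMod 4) = x at *
    generalize (y : ZMod 4) = y at *
    generalize (z : ZMod 4) = z at *
    generalize (e : ZMod 4) = e at *
    clear * - h0 h1 h2 he4
    revert x y z e
    decide +kernel
  · exfalso
    obtain ⟨h0, h1, h2⟩ := dvd_cubic_coords (l := 4) (x := 2 * X₀ + X₁ + 2 * X₂ - e)
      (y := -3 * X₀ - 4 * X₁ - 11 * X₂) (z := X₀ + 2 * X₁ + 6 * X₂) (by
        rw [Int.cast_ofNat]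
        convert hn using 1
        push_cast
        linear_combination -(X₁ + 2 * X₂ + X₂ * AdjoinRoot.root cubic : AdjoinRoot cubic) * hr)
    have h0 := toZMod h0
    have h1 := toZMod h1
    have h2 := toZMod h2
    simp only [hX₀, hX₁, hX₂] at h0 h1 h2
    push_cast at h0 h1 h2
    generalize (x : ZMod 4) = x at *
    generalize (y : ZMod 4) = y at *
    generalize (z : ZMod 4) = z at *
    generalize (e : ZMod 4) = e at *
    clear * - h0 h1 h2 he4
    revert x y z e
    decide +kernel

theorem exists_sq_of_dvd_sub_one {u : (AdjoinRoot cubic)ˣ} (hu : (4 : AdjoinRoot cubic) ∣ u - 1)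
    (hu7 : IsSquare (cubicModSeven u)) : ∃ v : (AdjoinRoot cubic)ˣ, u = v ^ 2 := by
  obtain ⟨n, hn, h⟩ := exists_prod_zpow_eq_one_adjoinRoot cubic_monic cubic_irreducible
    cubic_card_roots (ι := Fin 3) (by simp [cubic_natDegree]) ![u, cubicUnit₁, cubicUnit₂]
  simp only [Fin.prod_univ_three] at h
  have hn' : n 0 ≠ 0 ∨ n 1 ≠ 0 ∨ n 2 ≠ 0 := by
    by_contra! hc
    refine hn (funext fun i => ?_)
    fin_cases i
    exacts [hc.1, hc.2.1, hc.2.2]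
  obtain ⟨v, hv | hv⟩ := exists_sq_of_relation (dvd_of_cubic_relation hu) _ _ _ _ le_rfl hn'
    (.inl h)
  · exact ⟨v, hv⟩
  · exfalso
    obtain ⟨z, hz⟩ := hu7
    have h1 : cubicModSeven (v⁻¹ : (AdjoinRoot cubic)ˣ) * cubicModSeven v = 1 := by
      rw [← map_mul, Units.inv_mul, map_one]
    rw [hv, Units.val_neg, Units.val_pow_eq_pow_val, map_neg, map_pow] at hz
    have dec : ∀ a b z : ZMod 7, a * b = 1 → -b ^ 2 ≠ z * z := by decide +kernel
    exact dec _ _ _ h1 hz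

end Cubic

end RamanujanTau

namespace RamanujanTau

open Polynomial

theorem exists_sq_params {x y z m Q : ℤ} (h₀ : x ^ 2 + 2 * y * z + 5 * z ^ 2 = Q + 2 * m)
    (h₁ : 2 * x * y - 12 * y * z - 29 * z ^ 2 = -m)
    (h₂ : y ^ 2 + 2 * x * z + 10 * y * z + 19 * z ^ 2 = m)
    (hN : Q ^ 3 + 14 * m * Q ^ 2 + 49 * m ^ 2 * Q + 49 * m ^ 3 = 1) (hm : 4 ∣ m)
    (hx : 23 ∣ x - 1) (hy : 23 ∣ y) (hz : 23 ∣ z) :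
    ∃ s v : ℤ, 23 ∣ s - 1 ∧ 23 ∣ v ∧ x = s ^ 2 - 7 * v ^ 2 + 4 * (s * v) ∧
      y = 2 * (7 * v ^ 2 - s * v) ∧ z = 2 * (s * v) := by
  have hz2 : 2 ∣ z := by
    have : 2 ∣ 29 * z ^ 2 := by
      obtain ⟨k, rfl⟩ := hm
      exact ⟨x * y - 6 * y * z + 2 * k, by linarith⟩
    rcases Int.prime_two.dvd_mul.1 this with h | h
    · omega
    · exact Int.prime_two.dvd_of_dvd_pow h
  have hy2 : 2 ∣ y := by
    have : 2 ∣ y ^ 2 := by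
      obtain ⟨k, rfl⟩ := hm
      obtain ⟨l, rfl⟩ := hz2
      exact ⟨2 * k - 2 * x * l - 10 * y * l - 38 * l ^ 2, by linarith⟩
    exact Int.prime_two.dvd_of_dvd_pow this
  obtain ⟨z, rfl⟩ := hz2
  obtain ⟨y, rfl⟩ := hy2
  obtain ⟨U, rfl⟩ : ∃ U, y = U - z := ⟨y + z, by ring⟩
  obtain ⟨T, rfl⟩ : ∃ T, x = T - U + 4 * z := ⟨x + U - 4 * z, by ring⟩
  have hTU : U * T = 7 * z ^ 2 := by linarith
  have hcop : IsCoprime U T := by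
    rw [Int.isCoprime_iff_gcd_eq_one]
    by_contra hne
    obtain ⟨p, hp, hpd⟩ := Nat.exists_prime_and_dvd hne
    have hp' := Nat.prime_iff_prime_int.1 hp
    have hpU : (p : ℤ) ∣ U := (Int.natCast_dvd_natCast.2 hpd).trans (Int.gcd_dvd_left ..)
    have hpT : (p : ℤ) ∣ T := (Int.natCast_dvd_natCast.2 hpd).trans (Int.gcd_dvd_right ..)
    have hpz : (p : ℤ) ∣ z := by
      obtain ⟨a, rfl⟩ := hpU
      obtain ⟨b, rfl⟩ := hpT
      have h : (p : ℤ) * p * (a * b) = 7 * z ^ 2 := by linarith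
      have h7 : (p : ℤ) ∣ 7 * z ^ 2 := ⟨p * (a * b), by linarith⟩
      rcases hp'.dvd_mul.1 h7 with h7 | h7
      · have hp7 : p = 7 := by
          have : p ∣ 7 := by exact_mod_cast h7
          exact (Nat.prime_dvd_prime_iff_eq hp (by norm_num)).1 this
        subst hp7
        refine hp'.dvd_of_dvd_pow (n := 2) ⟨a * b, ?_⟩
        push_cast at h ⊢
        linarith
      · exact hp'.dvd_of_dvd_pow h7
    have hpm : (p : ℤ) ∣ m := by
      rw [← h₂]
      obtain ⟨a, rfl⟩ := hpU
      obtain ⟨b, rfl⟩ := hpT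
      obtain ⟨c, rfl⟩ := hpz
      exact ⟨p * (4 * (a - c) ^ 2 + 4 * (b - a + 4 * c) * c + 40 * (a - c) * c + 76 * c ^ 2),
        by ring⟩
    have hpQ : (p : ℤ) ∣ Q := by
      have : Q = (T - U + 4 * z) ^ 2 + 2 * (2 * (U - z)) * (2 * z) + 5 * (2 * z) ^ 2 - 2 * m := by
        linarith
      rw [this]
      obtain ⟨a, rfl⟩ := hpU
      obtain ⟨b, rfl⟩ := hpT
      obtain ⟨c, rfl⟩ := hpz
      obtain ⟨d, rfl⟩ := hpm
      exact ⟨p * (b - a + 4 * c) ^ 2 + 8 * p * (a - c) * c + 20 * p * c ^ 2 - 2 * d, by ring⟩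
    have : (p : ℤ) ∣ 1 := by
      rw [← hN]
      obtain ⟨a, rfl⟩ := hpm
      obtain ⟨b, rfl⟩ := hpQ
      exact ⟨p ^ 2 * (b ^ 3 + 14 * a * b ^ 2 + 49 * a ^ 2 * b + 49 * a ^ 3), by ring⟩
    exact hp'.not_dvd_one this
  have hT7 : ¬ 7 ∣ T := by
    rintro ⟨T, rfl⟩
    have h7 : 7 ∣ Q ^ 3 - 1 := ⟨-(2 * m * Q ^ 2 + 7 * m ^ 2 * Q + 7 * m ^ 3), by linarith⟩
    have h7' : 7 ∣ Q := by
      refine ⟨7 * (T + U + 4 * z) ^ 2 - 2 * m - 8 * (U - z) * z - 36 * z ^ 2, ?_⟩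
      linear_combination -h₀ - 4 * h₁ - 16 * h₂
    obtain ⟨b, rfl⟩ := h7'
    obtain ⟨k, hk⟩ := h7
    have : 7 ∣ (1 : ℤ) := ⟨49 * b ^ 3 - k, by linarith⟩
    omega
  have hU7 : 7 ∣ U := by
    have : (7 : ℤ) ∣ U * T := ⟨_, hTU⟩
    exact ((Int.prime_ofNat_iff.2 (by norm_num) : Prime (7 : ℤ)).dvd_mul.1 this).resolve_right hT7
  obtain ⟨U, rfl⟩ := hU7
  have hTz : T * U = z ^ 2 := by linarith
  have hcop' : IsCoprime T U := (hcop.of_isCoprime_of_dvd_left ⟨7, by ring⟩).symm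
  have hT23 : 23 ∣ T - 1 := by omega
  have hU23 : 23 ∣ U := by omega
  obtain ⟨s, hs⟩ : ∃ s, T = s ^ 2 := by
    obtain ⟨s, hs | hs⟩ := Int.sq_of_isCoprime hcop' hTz
    · exact ⟨s, hs⟩
    · exfalso
      have h1 : ((T - 1 : ℤ) : ZMod 23) = 0 := (ZMod.intCast_zmod_eq_zero_iff_dvd _ 23).2 hT23
      rw [hs] at h1
      push_cast at h1
      have dec : ∀ z : ZMod 23, -z ^ 2 - 1 ≠ 0 := by decide
      exact dec _ h1
  subst hs
  clear hcop hTU h₁ h₂ hcop'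
  have hp23 : Prime (23 : ℤ) := Int.prime_ofNat_iff.2 (by norm_num)
  wlog hs23 : 23 ∣ s - 1 generalizing s
  · have hs2 : (23 : ℤ) ∣ (s - 1) * (s + 1) := by
      convert hT23 using 1; ring
    have h' := (hp23.dvd_mul.1 hs2).resolve_left hs23
    have key := this (-s) (by rwa [neg_sq]) (by rwa [neg_sq]) (by rwa [neg_sq]) (by rwa [neg_sq])
      (by rwa [neg_sq]) (by omega)
    rwa [neg_sq] at key
  have hs0 : s ≠ 0 := by rintro rfl; omega
  obtain ⟨v, hv⟩ : s ∣ z := by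
    rw [← Int.pow_dvd_pow_iff two_ne_zero]
    exact ⟨U, hTz.symm⟩
  subst hv
  have hU : U = v ^ 2 := by
    have : s ^ 2 * U = s ^ 2 * v ^ 2 := by linarith
    exact mul_left_cancel₀ (pow_ne_zero 2 hs0) this
  subst hU
  refine ⟨s, v, hs23, hp23.dvd_of_dvd_pow hU23, ?_, rfl, rfl⟩
  ring

theorem eq_one_of_heptic {t Q : ℤ}
    (h : (t ^ 2) ^ 3 - 5 * (t ^ 2) ^ 2 * Q + 6 * t ^ 2 * Q ^ 2 - Q ^ 3 = 7) (ht : 2 ∣ t)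
    (ht23 : 23 ∣ t - 2) (hQ23 : 23 ∣ Q - 1) : Q = 1 := by
  have h7 : 7 ∣ t ^ 2 - 4 * Q := by
    refine (Int.prime_ofNat_iff.2 (by norm_num) : Prime (7 : ℤ)).dvd_of_dvd_pow (n := 3)
      ⟨1 - (t ^ 2) ^ 2 * Q + 6 * t ^ 2 * Q ^ 2 - 9 * Q ^ 3, ?_⟩
    linear_combination h
  obtain ⟨m, hm⟩ := h7
  have hN : Q ^ 3 + 14 * m * Q ^ 2 + 49 * m ^ 2 * Q + 49 * m ^ 3 = 1 := by
    have ha : t ^ 2 = 4 * Q + 7 * m := by linarith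
    rw [ha] at h
    linarith
  have hm4 : 4 ∣ m := by
    obtain ⟨k, rfl⟩ := ht
    have : 4 * (k ^ 2 - Q) = 7 * m := by linarith
    omega
  have hQ4 : 4 ∣ Q - 1 := by
    have h1 : (m : ZMod 4) = 0 := (ZMod.intCast_zmod_eq_zero_iff_dvd _ 4).2 hm4
    have h2 := congrArg (Int.cast : ℤ → ZMod 4) hN
    push_cast at h2
    rw [h1] at h2
    refine (ZMod.intCast_zmod_eq_zero_iff_dvd _ 4).1 ?_
    push_cast
    generalize (Q : ZMod 4) = q at *
    revert q
    decide
  have hm23 : 23 ∣ m := by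
    obtain ⟨k, hk⟩ := ht23
    obtain ⟨l, hl⟩ := hQ23
    obtain rfl : t = 23 * k + 2 := by linarith
    obtain rfl : Q = 23 * l + 1 := by linarith
    have : 23 * (23 * k ^ 2 + 4 * k - 4 * l) = 7 * m := by linarith
    omega
  have hr := cubic_root_pow
  obtain ⟨u, hu⟩ : ∃ u : (AdjoinRoot cubic)ˣ, (u : AdjoinRoot cubic) = Q +
      m * (AdjoinRoot.root cubic ^ 2 - AdjoinRoot.root cubic + 2) := by
    have hN' := congrArg (Int.cast : ℤ → AdjoinRoot cubic) hN
    push_cast at hN'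
    generalize hg : AdjoinRoot.root cubic ^ 2 - AdjoinRoot.root cubic + 2 = g
    have hg3 : g ^ 3 - 14 * g ^ 2 + 49 * g - 49 = 0 := by
      rw [← hg]
      linear_combination (AdjoinRoot.root cubic ^ 3 + 2 * AdjoinRoot.root cubic ^ 2 -
        AdjoinRoot.root cubic - 1) * hr
    exact ⟨Units.mkOfMulEqOne (Q + m * g)
      (Q ^ 2 + (14 - g) * Q * m + m ^ 2 * (g ^ 2 - 14 * g + 49))
      (by linear_combination hN' + m ^ 3 * hg3), rfl⟩
  have hu4 : (4 : AdjoinRoot cubic) ∣ u - 1 := by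
    obtain ⟨k, rfl⟩ := hm4
    obtain ⟨l, hl⟩ := hQ4
    obtain rfl : Q = 4 * l + 1 := by linarith
    rw [hu]
    exact ⟨l + k * (AdjoinRoot.root cubic ^ 2 - AdjoinRoot.root cubic + 2), by push_cast; ring⟩
  have hu7 : IsSquare (cubicModSeven u) := by
    have hroot : cubicModSeven (AdjoinRoot.root cubic) = 4 := by simp [cubicModSeven]
    have hN7 := congrArg (Int.cast : ℤ → ZMod 7) hN
    push_cast at hN7
    rw [hu]
    simp only [map_add, map_mul, map_sub, map_pow, hroot, map_intCast, map_ofNat]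
    generalize (Q : ZMod 7) = q at *
    generalize (m : ZMod 7) = m at *
    revert q m
    decide +kernel
  obtain ⟨w, hw⟩ := exists_sq_of_dvd_sub_one hu4 hu7
  obtain ⟨x, y, z, hxyz⟩ := exists_cubic_coords w
  have hsq := cubic_sq x y z
  rw [← hxyz, ← Units.val_pow_eq_pow_val, ← hw, hu] at hsq
  obtain ⟨h₀, h₁, h₂⟩ := dvd_cubic_coords (l := 0)
    (x := x ^ 2 + 2 * y * z + 5 * z ^ 2 - (Q + 2 * m))
    (y := 2 * x * y - 12 * y * z - 29 * z ^ 2 - (-m))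
    (z := y ^ 2 + 2 * x * z + 10 * y * z + 19 * z ^ 2 - m) (by
      rw [Int.cast_zero, zero_dvd_iff]
      push_cast at hsq ⊢
      linear_combination -hsq)
  rw [zero_dvd_iff, sub_eq_zero] at h₀ h₁ h₂
  have hw23 : (23 ∣ x - 1 ∨ 23 ∣ x + 1) ∧ 23 ∣ y ∧ 23 ∣ z := by
    have e₀ := congrArg (Int.cast : ℤ → ZMod 23) h₀
    have e₁ := congrArg (Int.cast : ℤ → ZMod 23) h₁
    have e₂ := congrArg (Int.cast : ℤ → ZMod 23) h₂
    have eQ : ((Q - 1 : ℤ) : ZMod 23) = 0 := (ZMod.intCast_zmod_eq_zero_iff_dvd _ 23).2 hQ23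
    have em : (m : ZMod 23) = 0 := (ZMod.intCast_zmod_eq_zero_iff_dvd _ 23).2 hm23
    have toDvd (k : ℤ) : 23 ∣ k ↔ (k : ZMod 23) = 0 := (ZMod.intCast_zmod_eq_zero_iff_dvd k 23).symm
    rw [toDvd, toDvd, toDvd, toDvd]
    push_cast at e₀ e₁ e₂ eQ ⊢
    rw [sub_eq_zero.1 eQ, em] at e₀
    rw [em] at e₁ e₂
    generalize (x : ZMod 23) = x at *
    generalize (y : ZMod 23) = y at *
    generalize (z : ZMod 23) = z at *
    clear * - e₀ e₁ e₂
    revert x y z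
    decide +kernel
  wlog hx23 : 23 ∣ x - 1 generalizing w x y z
  · refine this (-w) (by rw [neg_sq]; exact hw) (-x) (-y) (-z) ?_ ?_ ?_ ?_ ?_ ?_ ?_
    · rw [Units.val_neg, hxyz]; push_cast; ring
    · rw [hsq]; push_cast; ring
    · linarith
    · linarith
    · linarith
    · omega
    · omega
  obtain ⟨s, v, hs, hv, hx, hy, hz⟩ := exists_sq_params h₀ h₁ h₂ hN hm4 hx23 hw23.2.1 hw23.2.2
  have hunit : s = 1 ∧ v = 0 := by
    refine eq_of_isUnit_sextic hs hv ?_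
    have hlift := (w.map (AdjoinRoot.lift (algebraMap ℤ (AdjoinRoot sextic)) cubicRootInSextic (by
      simp only [cubic, eval₂_sub, eval₂_add, eval₂_mul, eval₂_pow, eval₂_X, eval₂_one,
        eval₂_ofNat]
      exact cubicRootInSextic_eq) : AdjoinRoot cubic →+* AdjoinRoot sextic).toMonoidHom).isUnit
    convert hlift using 1
    change _ = AdjoinRoot.lift _ _ _ (w : AdjoinRoot cubic)
    rw [hxyz, hx, hy, hz]
    simp only [map_add, map_mul, map_pow, map_intCast, AdjoinRoot.lift_root]
    push_cast
    ring
  obtain ⟨rfl, rfl⟩ := hunit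
  subst hx hy hz
  linarith

end RamanujanTau

namespace RamanujanTau

/-- The Lucas numbers `L (2 * n + 1)`. -/
def oddLucas : ℕ → ℤ
  | 0 => 1
  | 1 => 4
  | n + 2 => 3 * oddLucas (n + 1) - oddLucas n

/-- The Lucas numbers `L (2 * n)`. -/
def evenLucas : ℕ → ℤ
  | 0 => 2
  | 1 => 3
  | n + 2 => 3 * evenLucas (n + 1) - evenLucas n

theorem oddLucas_add_two (n : ℕ) : oddLucas (n + 2) = 3 * oddLucas (n + 1) - oddLucas n := rfl

theorem evenLucas_add_two (n : ℕ) : evenLucas (n + 2) = 3 * evenLucas (n + 1) - evenLucas n := rfl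

theorem oddLucas_add_two_mul (k n : ℕ) :
    oddLucas (n + 2 * k) + oddLucas n = evenLucas k * oddLucas (n + k) := by
  induction k using Nat.twoStepInduction generalizing n with
  | zero => simp [evenLucas]; ring
  | one => simp [evenLucas, oddLucas_add_two]
  | more k h0 h1 =>
    have h0 := h0 (n + 2)
    have h1 := h1 (n + 1)
    have e1 := oddLucas_add_two (n + 2 + 2 * k)
    have e2 := oddLucas_add_two n
    rw [show n + 1 + 2 * (k + 1) = n + 2 + 2 * k + 1 by ring,
      show n + 1 + (k + 1) = n + (k + 2) by ring] at h1
    rw [show n + 2 + k = n + (k + 2) by ring] at h0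
    rw [show n + 2 * (k + 2) = n + 2 + 2 * k + 2 by ring, evenLucas_add_two]
    linarith

theorem dvd_oddLucas_add (k n j : ℕ) :
    evenLucas k ∣ oddLucas (n + 2 * (k * (2 * j + 1))) + oddLucas n := by
  induction j with
  | zero => exact ⟨_, by simpa using oddLucas_add_two_mul k n⟩
  | succ j ih =>
    have h1 := oddLucas_add_two_mul k (n + 2 * (k * (2 * j + 1)))
    have h2 := oddLucas_add_two_mul k (n + 2 * (k * (2 * j + 1)) + 2 * k)
    obtain ⟨c, hc⟩ := ih
    rw [show n + 2 * (k * (2 * j + 1)) + 2 * k + 2 * k = n + 2 * (k * (2 * (j + 1) + 1)) by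
      ring] at h2
    exact ⟨oddLucas (n + 2 * (k * (2 * j + 1)) + 2 * k + k) -
      oddLucas (n + 2 * (k * (2 * j + 1)) + k) + c, by linarith⟩

theorem evenLucas_mod_four (k : ℕ) : evenLucas (3 * k) % 4 = 2 ∧ evenLucas (3 * k + 1) % 4 = 3 ∧
    evenLucas (3 * k + 2) % 4 = 3 := by
  induction k with
  | zero => simp [evenLucas]
  | succ k ih =>
    have h1 := evenLucas_add_two (3 * k + 1)
    have h2 := evenLucas_add_two (3 * k + 2)
    have h3 := evenLucas_add_two (3 * k + 3)
    rw [show 3 * (k + 1) = 3 * k + 3 by ring]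
    simp only [add_assoc, Nat.reduceAdd] at *
    omega

theorem one_lt_evenLucas (k : ℕ) : 1 < evenLucas k ∧ evenLucas k ≤ evenLucas (k + 1) := by
  induction k with
  | zero => simp [evenLucas]
  | succ k ih =>
    have := evenLucas_add_two k
    grind

theorem not_dvd_sq_add_sq {N c x : ℤ} (hN : 0 < N) (hN4 : N % 4 = 3) (hc : IsCoprime c N) :
    ¬ N ∣ x ^ 2 + c ^ 2 := by
  lift N to ℕ using hN.le
  intro h
  have hN4' : N % 4 = 3 := by omega
  have h1 : jacobiSym (x ^ 2) N = jacobiSym (-c ^ 2) N := by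
    refine jacobiSym.mod_left' (Int.ModEq.symm ((Int.modEq_iff_dvd).2 ?_))
    rwa [sub_neg_eq_add]
  rw [jacobiSym.neg _ (Nat.odd_iff.2 (by omega)),
    jacobiSym.sq_one' (Int.isCoprime_iff_gcd_eq_one.1 hc),
    jacobiSym.pow_left, ZMod.χ₄_nat_three_mod_four hN4'] at h1
  nlinarith [sq_nonneg (jacobiSym x N)]

theorem le_one_of_oddLucas_eq_sq {n : ℕ} {x : ℤ} (h : oddLucas n = x ^ 2) : n ≤ 1 := by
  by_contra! hn
  obtain ⟨r, K, hK, hrK⟩ := Nat.exists_eq_pow_mul_and_not_dvd (n := n / 2)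
    (by omega) 3 (by norm_num)
  obtain ⟨j, hj⟩ : Odd (3 ^ r) := Odd.pow (by decide)
  rw [hj, mul_comm] at hrK
  have hV4 : evenLucas K % 4 = 3 := by
    have := evenLucas_mod_four (K / 3)
    have h3 : K = 3 * (K / 3) + 1 ∨ K = 3 * (K / 3) + 2 := by omega
    rcases h3 with h3 | h3 <;> rw [h3] <;> omega
  obtain ⟨c, d, hcd, hd, hnc⟩ : ∃ (c : ℕ) (d : ℤ), oddLucas c = d ^ 2 ∧ (d = 1 ∨ d = 2) ∧
      n = c + 2 * (n / 2) := by
    obtain h2 | h2 := Nat.mod_two_eq_zero_or_one n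
    · exact ⟨0, 1, rfl, .inl rfl, by omega⟩
    · exact ⟨1, 2, rfl, .inr rfl, by omega⟩
  have hdvd := dvd_oddLucas_add K c j
  rw [← hrK, ← hnc, h, hcd] at hdvd
  refine not_dvd_sq_add_sq (by linarith [(one_lt_evenLucas K).1]) hV4 ?_ hdvd
  rcases hd with rfl | rfl
  · exact isCoprime_one_left
  · exact ⟨-(evenLucas K / 2), 1, by omega⟩

theorem exists_oddLucas {a Q : ℤ} (hQ : 0 < Q) (hQa : Q < a) (h : a ^ 2 - 3 * a * Q + Q ^ 2 = 5) :
    ∃ n, Q = oddLucas n ∧ a = oddLucas (n + 1) := by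
  by_cases hQ3 : 3 ≤ Q
  · have hpos : 0 < 3 * Q - a := by
      have : 0 < a * (3 * Q - a) := by nlinarith
      exact pos_of_mul_pos_right this (by linarith)
    have hlt : 3 * Q - a < Q := by nlinarith
    obtain ⟨n, hn, hn'⟩ := exists_oddLucas hpos hlt (by linarith)
    exact ⟨n + 1, hn', by rw [oddLucas_add_two]; linarith⟩
  · have h12 : Q = 1 ∨ Q = 2 := by omega
    rcases h12 with rfl | rfl
    · refine ⟨0, rfl, ?_⟩
      have : (a - 4) * (a + 1) = 0 := by linarith
      rcases mul_eq_zero.1 this with h | h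
      · simp [oddLucas]; linarith
      · omega
    · exfalso
      have : a ≤ 6 := by nlinarith
      interval_cases a <;> omega
termination_by Q.toNat
decreasing_by omega

theorem eq_one_of_quintic {t Q : ℤ} (h : (t ^ 2) ^ 2 - 3 * t ^ 2 * Q + Q ^ 2 = 5) (hQ : 0 < Q)
    (hQ23 : 23 ∣ Q - 1) : Q = 1 := by
  have ht : 0 < t ^ 2 := by
    refine (sq_nonneg t).lt_of_ne fun h0 => ?_
    rw [← h0] at h
    have : Q ≤ 3 := by nlinarith
    interval_cases Q <;> omega
  rcases lt_trichotomy (t ^ 2) Q with hlt | heq | hlt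
  · obtain ⟨n, hn, hn'⟩ := exists_oddLucas ht hlt (by linarith)
    have := le_one_of_oddLucas_eq_sq hn.symm
    interval_cases n <;> simp [oddLucas] at hn' <;> omega
  · rw [heq] at h
    nlinarith
  · obtain ⟨n, hn, hn'⟩ := exists_oddLucas hQ hlt h
    have : n = 0 := by have := le_one_of_oddLucas_eq_sq hn'.symm; omega
    subst this
    exact hn

end RamanujanTau

namespace RamanujanTau

open Polynomial UpperHalfPlane Filter

/-- The truncated product whose coefficients are the values of `ramanujanTau`. -/
noncomputable def tauPoly (N : ℕ) : ℤ[X] := X * ∏ m ∈ Finset.Icc 1 N, (1 - X ^ m) ^ 24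

theorem tauPoly_succ (N : ℕ) : (X : ℤ[X]) ^ (N + 1) ∣ tauPoly (N + 1) - tauPoly N := by
  have h : (X : ℤ[X]) ^ (N + 1) ∣ (1 - X ^ (N + 1)) ^ 24 - 1 ^ 24 :=
    dvd_trans ⟨-1, by ring⟩ (sub_dvd_pow_sub_pow _ _ _)
  rw [tauPoly, tauPoly, Finset.prod_Icc_succ_top (by omega), ← mul_assoc, ← mul_sub_one]
  simpa using h.mul_left _

theorem coeff_tauPoly {n N : ℕ} (h : n ≤ N) : (tauPoly N).coeff n = ramanujanTau n := by
  induction N, h using Nat.le_induction with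
  | base => rfl
  | succ N hN ih =>
    have := X_pow_dvd_iff.1 (tauPoly_succ N) n (by omega)
    rw [coeff_sub, sub_eq_zero] at this
    rw [this, ih]

theorem tendstoLocallyUniformlyOn_tauPoly :
    TendstoLocallyUniformlyOn (fun N q => aeval q (tauPoly N))
      (fun q : ℂ => q * (∏' i : ℕ, (1 - q ^ (i + 1))) ^ 24) atTop (Metric.ball 0 1) := by
  have h := ModularForm.multipliableLocallyUniformlyOn_one_sub_pow.hasProdLocallyUniformlyOn
    |>.tendstoLocallyUniformlyOn_finsetRange
  have hc := ModularForm.differentiableOn_tprod_one_sub_pow.continuousOn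
  have hconst (g : ℂ → ℂ) : TendstoLocallyUniformlyOn (fun (_ : ℕ) => g) g atTop
      (Metric.ball 0 1) := fun u hu x hx =>
    ⟨_, self_mem_nhdsWithin, .of_forall fun _ _ _ => refl_mem_uniformity hu⟩
  have hpow (k : ℕ) : TendstoLocallyUniformlyOn
      (fun (N : ℕ) (q : ℂ) => (∏ i ∈ Finset.range N, (1 - q ^ (i + 1))) ^ k)
      (fun q : ℂ => (∏' i : ℕ, (1 - q ^ (i + 1))) ^ k) atTop (Metric.ball 0 1) := by
    induction k with
    | zero =>
      simp only [pow_zero]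
      exact hconst _
    | succ k ih =>
      simp only [pow_succ]
      exact ih.mul₀ h (hc.pow k) hc
  refine ((hconst fun q => q).mul₀ (hpow 24) continuousOn_id (hc.pow 24)).congr fun N q _ => ?_
  simp only [tauPoly, map_mul, map_prod, map_pow, map_sub, map_one, aeval_X, Pi.mul_apply]
  rw [Finset.prod_pow, Finset.range_eq_Ico, Finset.prod_Ico_add' (fun i => 1 - q ^ i)]
  rfl

theorem iterate_deriv_aeval (p : ℤ[X]) (n : ℕ) :
    deriv^[n] (fun q : ℂ => aeval q p) = fun q : ℂ => aeval q (derivative^[n] p) := by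
  induction n generalizing p with
  | zero => rfl
  | succ n ih =>
    rw [Function.iterate_succ_apply, Function.iterate_succ_apply, ← ih]
    congr 1
    ext q
    exact p.deriv_aeval

theorem qExpansion_discriminant_coeff (n : ℕ) :
    (qExpansion 1 ModularForm.discriminant).coeff n = ramanujanTau n := by
  have hlim (n : ℕ) : TendstoLocallyUniformlyOn
      (fun N => deriv^[n] (fun q : ℂ => aeval q (tauPoly N)))
      (deriv^[n] (cuspFunction 1 ModularForm.discriminant)) atTop (Metric.ball 0 1) := by
    induction n with
    | zero => exact tendstoLocallyUniformlyOn_tauPoly.congr_right fun q hq =>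
        ((ModularForm.discriminant_cuspFunction_eqOn hq).trans (congrArg (q * ·)
          ((ModularForm.multipliable_one_sub_pow (by simpa using hq)).tprod_pow 24))).symm
    | succ n ih =>
      simp only [Function.iterate_succ_apply']
      refine ih.deriv (.of_forall fun N => ?_) Metric.isOpen_ball
      rw [iterate_deriv_aeval]
      exact (Polynomial.differentiable_aeval _).differentiableOn
  have h := (hlim n).tendsto_at (Metric.mem_ball_self one_pos)
  have h' : Tendsto (fun N => deriv^[n] (fun q : ℂ => aeval q (tauPoly N)) 0) atTop
      (nhds (n.factorial * ramanujanTau n)) := by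
    refine tendsto_const_nhds.congr' ?_
    filter_upwards [eventually_ge_atTop n] with N hN
    simp only [iterate_deriv_aeval]
    rw [← coeff_zero_eq_aeval_zero', coeff_iterate_derivative, zero_add,
      coeff_tauPoly hN, Nat.descFactorial_self]
    simp
  rw [qExpansion_coeff, iteratedDeriv_eq_iterate, tendsto_nhds_unique h h',
    inv_mul_cancel_left₀ (by exact_mod_cast n.factorial_ne_zero)]

end RamanujanTau

namespace RamanujanTau

open UpperHalfPlane Filter ModularForm Matrix MatrixGroups
open scoped Manifold

local notation "Δ" => ModularForm.discriminant

theorem discriminant_slash (γ : SL(2, ℤ)) : (Δ ∣[(12 : ℤ)] γ) = Δ :=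
  SlashInvariantForm.slash_action_generators_SL2Z discriminant_S_invariant
    discriminant_T_invariant γ

/-- An integral matrix with nonzero determinant as an element of `GL₂(ℝ)`. -/
noncomputable def intGL (M : Matrix (Fin 2) (Fin 2) ℤ) (h : M.det ≠ 0) : GL (Fin 2) ℝ :=
  GeneralLinearGroup.mkOfDetNeZero (M.map Int.cast) (by
    rw [← Int.cast_det]
    exact_mod_cast h)

theorem discriminant_slash_intGL {M N : Matrix (Fin 2) (Fin 2) ℤ} (hM : M.det ≠ 0) (hN : N.det ≠ 0)
    {γ δ : SL(2, ℤ)} (h : M * γ.1 = δ.1 * N) :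
    (Δ ∣[(12 : ℤ)] intGL M hM) ∣[(12 : ℤ)] γ = Δ ∣[(12 : ℤ)] intGL N hN := by
  have : intGL M hM * (γ : GL (Fin 2) ℝ) = (δ : GL (Fin 2) ℝ) * intGL N hN := by
    apply Units.ext
    have := congrArg (Int.castRingHom ℝ).mapMatrix h
    simpa [map_mul] using! this
  rw [SL_slash, ← SlashAction.slash_mul, this, SlashAction.slash_mul, ← SL_slash,
    discriminant_slash]

section

variable (p : ℕ) [hp : Fact p.Prime]

theorem heckeUp_det (j : ℤ) : (!![1, j; 0, (p : ℤ)] : Matrix (Fin 2) (Fin 2) ℤ).det ≠ 0 := by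
  simpa [det_fin_two] using hp.out.ne_zero

theorem heckeDown_det : (!![(p : ℤ), 0; 0, 1] : Matrix (Fin 2) (Fin 2) ℤ).det ≠ 0 := by
  simpa [det_fin_two] using hp.out.ne_zero

/-- The summand `z ↦ p⁻¹ Δ((z + j) / p)` of the Hecke operator. -/
noncomputable def heckeUp (j : ℤ) : ℍ → ℂ := Δ ∣[(12 : ℤ)] intGL _ (heckeUp_det p j)

/-- The summand `z ↦ p¹¹ Δ(p z)` of the Hecke operator. -/
noncomputable def heckeDown : ℍ → ℂ := Δ ∣[(12 : ℤ)] intGL _ (heckeDown_det p)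

theorem heckeUp_congr {i j : ℤ} (h : (i : ZMod p) = j) : heckeUp p i = heckeUp p j := by
  obtain ⟨k, hk⟩ := (ZMod.intCast_eq_intCast_iff_dvd_sub i j p).1 h
  have := discriminant_slash_intGL (heckeUp_det p j) (heckeUp_det p i)
    (γ := 1) (δ := ⟨!![1, k; 0, 1], by simp [det_fin_two]⟩)
    (by ext a b; fin_cases a <;> fin_cases b <;> simp <;> linarith)
  rw [SlashAction.slash_one] at this
  exact this.symm

theorem heckeUp_slash_T (j : ℤ) :
    heckeUp p j ∣[(12 : ℤ)] ModularGroup.T = heckeUp p (j + 1) :=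
  discriminant_slash_intGL _ _ (δ := 1) (by
    ext a b; fin_cases a <;> fin_cases b <;> simp [ModularGroup.T, add_comm])

theorem heckeDown_slash_T : heckeDown p ∣[(12 : ℤ)] ModularGroup.T = heckeDown p :=
  discriminant_slash_intGL _ _ (δ := ⟨!![1, (p : ℤ); 0, 1], by simp [det_fin_two]⟩) (by
    ext a b; fin_cases a <;> fin_cases b <;> simp [ModularGroup.T])

theorem heckeUp_zero_slash_S : heckeUp p 0 ∣[(12 : ℤ)] ModularGroup.S = heckeDown p :=
  discriminant_slash_intGL _ _ (δ := ModularGroup.S) (by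
    ext a b; fin_cases a <;> fin_cases b <;> simp [ModularGroup.S])

theorem heckeDown_slash_S : heckeDown p ∣[(12 : ℤ)] ModularGroup.S = heckeUp p 0 :=
  discriminant_slash_intGL _ _ (δ := ModularGroup.S) (by
    ext a b; fin_cases a <;> fin_cases b <;> simp [ModularGroup.S])

theorem heckeUp_slash_S {i j : ℤ} (h : (i * j : ZMod p) = -1) :
    heckeUp p i ∣[(12 : ℤ)] ModularGroup.S = heckeUp p j := by
  obtain ⟨k, hk⟩ := (ZMod.intCast_eq_intCast_iff_dvd_sub (-1) (i * j) p).1 (by simp [h])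
  exact discriminant_slash_intGL _ _ (δ := ⟨!![i, -k; p, -j], by simp [det_fin_two]; linarith⟩) (by
    ext a b; fin_cases a <;> fin_cases b <;> simp [ModularGroup.S] <;> linarith)

/-- The image of the discriminant under the Hecke operator of index `p`. -/
noncomputable def hecke : ℍ → ℂ := ∑ j : ZMod p, heckeUp p j.val + heckeDown p

theorem hecke_slash_T : hecke p ∣[(12 : ℤ)] ModularGroup.T = hecke p := by
  rw [hecke, SlashAction.add_slash, SlashAction.sum_slash, heckeDown_slash_T]
  congr 1
  simp only [heckeUp_slash_T]
  exact Fintype.sum_equiv (Equiv.addRight 1) _ _ fun j => heckeUp_congr p (by simp)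

theorem hecke_slash_S : hecke p ∣[(12 : ℤ)] ModularGroup.S = hecke p := by
  rw [hecke, SlashAction.add_slash, SlashAction.sum_slash, heckeDown_slash_S,
    ← Finset.add_sum_erase _ _ (Finset.mem_univ (0 : ZMod p)),
    ← Finset.add_sum_erase _ _ (Finset.mem_univ (0 : ZMod p))]
  simp only [ZMod.val_zero, Nat.cast_zero, heckeUp_zero_slash_S]
  have : ∑ j ∈ Finset.univ.erase (0 : ZMod p), heckeUp p j.val ∣[(12 : ℤ)] ModularGroup.S =
      ∑ j ∈ Finset.univ.erase (0 : ZMod p), heckeUp p j.val := by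
    refine Finset.sum_bij' (fun j _ => -j⁻¹) (fun j _ => -j⁻¹) ?_ ?_ ?_ ?_ ?_
    · simp
    · simp
    · simp
    · simp
    · intro j hj
      have : j ≠ 0 := by simpa using hj
      exact heckeUp_slash_S p (by simp [this])
  rw [this]
  abel

theorem hecke_slash (γ : SL(2, ℤ)) : hecke p ∣[(12 : ℤ)] γ = hecke p :=
  SlashInvariantForm.slash_action_generators_SL2Z (hecke_slash_S p) (hecke_slash_T p) γ

theorem mdifferentiable_discriminant : MDiff Δ := CuspForm.discriminant.holo'

theorem hecke_isZeroAtImInfty : IsZeroAtImInfty (hecke p) := by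
  have hz : IsZeroAtImInfty Δ := discriminant_isZeroAtImInfty
  refine Filter.ZeroAtFilter.add (f := ∑ j : ZMod p, heckeUp p j.val) ?_ ?_
  · refine Finset.sum_induction _ IsZeroAtImInfty (fun _ _ => Filter.ZeroAtFilter.add) ?_ ?_
    · exact Filter.zero_zeroAtFilter _
    · intro j _
      exact hz.slash 12 (g := intGL _ (heckeUp_det p j.val)) Int.cast_zero
  · exact hz.slash 12 (g := intGL _ (heckeDown_det p)) Int.cast_zero

/-- `hecke p` as a cusp form. -/
noncomputable def heckeForm : CuspForm 𝒮ℒ 12 where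
  toFun := hecke p
  slash_action_eq' A hA := by
    obtain ⟨A, rfl⟩ := hA
    exact hecke_slash p A
  holo' := by
    have hd := mdifferentiable_discriminant
    refine MDifferentiable.add (MDifferentiable.sum fun j _ => ?_) ?_
    · exact hd.slash _ _
    · exact hd.slash _ _
  zero_at_cusps' hc := by
    rw [Subgroup.IsArithmetic.isCusp_iff_isCusp_SL2Z] at hc
    rw [OnePoint.isZeroAt_iff_forall_SL2Z hc]
    intro γ _
    rw [hecke_slash]
    exact hecke_isZeroAtImInfty p

theorem exists_smul_discriminant_eq_hecke : ∃ c : ℂ, ∀ z, hecke p z = c * Δ z := by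
  obtain ⟨c, hc⟩ := CuspForm.exists_smul_discriminant_of_weight_eq_twelve (heckeForm p)
  exact ⟨c, fun z => (DFunLike.congr_fun hc z).symm⟩

end

end RamanujanTau

namespace RamanujanTau

open UpperHalfPlane Filter ModularForm Matrix MatrixGroups

local notation "Δ" => ModularForm.discriminant

theorem hasSum_discriminant (z : ℍ) :
    HasSum (fun n : ℕ => (ramanujanTau n : ℂ) * Complex.exp (2 * Real.pi * Complex.I * (n * z)))
      (Δ z) := by
  have := hasSum_qExpansion CuspForm.discriminant one_pos one_mem_strictPeriods_SL z
  refine this.congr_fun fun n => ?_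
  rw [CuspForm.coe_discriminant, qExpansion_discriminant_coeff, Function.Periodic.qParam,
    ← Complex.exp_nat_mul]
  congr 2
  push_cast
  ring

section

variable (p : ℕ) [hp : Fact p.Prime]

theorem intGL_det {M : Matrix (Fin 2) (Fin 2) ℤ} (h : M.det ≠ 0) :
    (intGL M h).det.val = M.det := by
  simp [intGL, Int.cast_det]

theorem slash_intGL_apply (f : ℍ → ℂ) {a b d : ℤ} (h : (!![a, b; 0, d]).det ≠ 0) (hd : 0 < a * d)
    (z : ℍ) :
    ∃ w : ℍ, (w : ℂ) = (a * z + b) / d ∧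
      (f ∣[(12 : ℤ)] intGL _ h) z = (a * d) ^ 11 * (d : ℂ) ^ (-12 : ℤ) * f w := by
  have hdet : (intGL _ h).det.val = (a * d : ℝ) := by
    rw [intGL_det]
    simp [det_fin_two]
  have hd' : (0 : ℝ) < a * d := by exact_mod_cast hd
  have hpos : 0 < (intGL _ h).det.val := by rwa [hdet]
  refine ⟨intGL _ h • z, ?_, ?_⟩
  · rw [coe_smul_of_det_pos hpos]
    simp [num, denom, intGL]
  · rw [slash_apply, σ, if_pos hpos, hdet, abs_of_pos hd']
    simp [denom, intGL]
    norm_cast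
    ring

theorem hasSum_heckeDown (z : ℍ) :
    HasSum (fun n : ℕ => (if p ∣ n then (p : ℂ) ^ 11 * ramanujanTau (n / p) else 0) *
      Complex.exp (2 * Real.pi * Complex.I * (n * z))) (heckeDown p z) := by
  obtain ⟨w, hw, h⟩ := slash_intGL_apply Δ (heckeDown_det p) (by simpa using hp.out.pos) z
  rw [heckeDown, h]
  refine (Function.Injective.hasSum_iff (mul_right_injective₀ hp.out.ne_zero) ?_).1
    (((hasSum_discriminant w).mul_left _).congr_fun fun n => ?_)
  · intro n hn
    rw [if_neg, zero_mul]
    rintro ⟨k, rfl⟩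
    exact hn ⟨k, rfl⟩
  · simp [hw, hp.out.pos]
    ring_nf

theorem hasSum_sum_heckeUp (z : ℍ) :
    HasSum (fun n : ℕ => (ramanujanTau (p * n) : ℂ) *
      Complex.exp (2 * Real.pi * Complex.I * (n * z))) ((∑ j : ZMod p, heckeUp p j.val) z) := by
  have hp0 : (p : ℂ) ≠ 0 := by exact_mod_cast hp.out.ne_zero
  have h1 (j : ZMod p) : HasSum (fun n : ℕ => (p : ℂ)⁻¹ * ramanujanTau n *
      Complex.exp (2 * Real.pi * Complex.I * (n * (z / p))) * ZMod.stdAddChar (j * (n : ZMod p)))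
      (heckeUp p j.val z) := by
    obtain ⟨w, hw, h⟩ := slash_intGL_apply Δ (heckeUp_det p j.val) (by simpa using hp.out.pos) z
    rw [heckeUp, h]
    refine ((hasSum_discriminant w).mul_left _).congr_fun fun n => ?_
    have : (j * n : ZMod p) = ((j.val * n : ℤ) : ZMod p) := by simp
    have hpow : ((1 : ℤ) * (p : ℤ) : ℂ) ^ 11 * ((p : ℤ) : ℂ) ^ (-12 : ℤ) = (p : ℂ)⁻¹ := by
      simp [_root_.zpow_neg]
      field_simp
    rw [hpow, this, ZMod.stdAddChar_coe, mul_assoc (_ * _), ← Complex.exp_add, mul_assoc (p : ℂ)⁻¹,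
      hw]
    congr 3
    push_cast
    field_simp
  have h2 := hasSum_sum fun (j : ZMod p) (_ : j ∈ Finset.univ) => h1 j
  rw [Finset.sum_apply]
  refine ((Function.Injective.hasSum_iff (mul_right_injective₀ hp.out.ne_zero) ?_).2
    h2).congr_fun fun n => ?_
  · intro n hn
    rw [← Finset.mul_sum, AddChar.sum_mulShift _ (ZMod.isPrimitive_stdAddChar p), if_neg]
    · simp
    · rw [ZMod.natCast_eq_zero_iff]
      rintro ⟨k, rfl⟩
      exact hn ⟨k, rfl⟩
  · simp [ZMod.card]
    field_simp

theorem ramanujanTau_hecke_aux : ∃ c : ℂ, ∀ n, (ramanujanTau (p * n) : ℂ) +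
    (if p ∣ n then (p : ℂ) ^ 11 * ramanujanTau (n / p) else 0) = c * ramanujanTau n := by
  obtain ⟨c, hc⟩ := exists_smul_discriminant_eq_hecke p
  refine ⟨c, fun n => ?_⟩
  have h (z : ℍ) : HasSum (fun n : ℕ => ((ramanujanTau (p * n) : ℂ) +
    (if p ∣ n then (p : ℂ) ^ 11 * ramanujanTau (n / p) else 0)) • Function.Periodic.qParam 1 z ^ n)
      ((c • CuspForm.discriminant) z) := by
    have := (hasSum_sum_heckeUp p z).add (hasSum_heckeDown p z)
    rw [_root_.smul_apply, CuspForm.coe_discriminant, smul_eq_mul, ← hc]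
    refine this.congr_fun fun n => ?_
    rw [Function.Periodic.qParam, ← Complex.exp_nat_mul, smul_eq_mul, add_mul]
    congr 3 <;> push_cast <;> ring
  have := ModularFormClass.qExpansion_coeff_unique one_pos one_mem_strictPeriods_SL h n
  rw [this, ← ModularFormClass.qExpansion_coeff_unique one_pos one_mem_strictPeriods_SL
    (f := c • CuspForm.discriminant) (c := fun n => c * ramanujanTau n)
    fun z => ((hasSum_discriminant z).mul_left c).congr_fun fun n => ?_]
  rw [Function.Periodic.qParam, ← Complex.exp_nat_mul, smul_eq_mul, mul_assoc]
  congr 3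
  push_cast
  ring

end
end RamanujanTau

namespace RamanujanTau

open Polynomial in
open Polynomial in
theorem ramanujanTau_one : ramanujanTau 1 = 1 := by
  simp [ramanujanTau, coeff_zero_eq_eval_zero]

theorem ramanujanTau_hecke {p : ℕ} (hp : p.Prime) (n : ℕ) :
    ramanujanTau (p * n) + (if p ∣ n then (p : ℤ) ^ 11 * ramanujanTau (n / p) else 0) =
      ramanujanTau p * ramanujanTau n := by
  have := Fact.mk hp
  obtain ⟨c, hc⟩ := ramanujanTau_hecke_aux p
  have h1 : (ramanujanTau p : ℂ) = c := by
    simpa [ramanujanTau_one, hp.ne_one] using hc 1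
  have h2 := hc n
  rw [← h1] at h2
  exact_mod_cast h2

theorem ramanujanTau_prime_pow_add_two {p : ℕ} (hp : p.Prime) (k : ℕ) :
    ramanujanTau (p ^ (k + 2)) =
      ramanujanTau p * ramanujanTau (p ^ (k + 1)) - (p : ℤ) ^ 11 * ramanujanTau (p ^ k) := by
  have := ramanujanTau_hecke hp (p ^ (k + 1))
  rw [if_pos (dvd_pow_self p k.succ_ne_zero), pow_succ p k, Nat.mul_div_cancel _ hp.pos,
    show p * (p ^ k * p) = p ^ (k + 2) by ring] at this
  rw [pow_succ p k]
  linarith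

theorem ramanujanTau_prime_pow_mul {p m : ℕ} (hp : p.Prime) (hm : ¬ p ∣ m) (k : ℕ) :
    ramanujanTau (p ^ k * m) = ramanujanTau (p ^ k) * ramanujanTau m := by
  induction k using Nat.twoStepInduction with
  | zero => simp [ramanujanTau_one]
  | one => simpa [hm] using ramanujanTau_hecke hp m
  | more k ih1 ih2 =>
    have := ramanujanTau_hecke hp (p ^ (k + 1) * m)
    rw [if_pos ((dvd_pow_self p k.succ_ne_zero).mul_right m),
      show p ^ (k + 1) * m / p = p ^ k * m by
        rw [pow_succ, mul_right_comm, Nat.mul_div_cancel _ hp.pos],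
      show p * (p ^ (k + 1) * m) = p ^ (k + 2) * m by ring] at this
    rw [ramanujanTau_prime_pow_add_two hp]
    linear_combination this + ramanujanTau p * ih2 - (p : ℤ) ^ 11 * ih1

theorem exists_prime_pow_of_dvd_ramanujanTau {l : ℤ} (hl : Prime l) {n : ℕ} (hn : n ≠ 0)
    (h : l ∣ ramanujanTau n) :
    ∃ p k : ℕ, p.Prime ∧ l ∣ ramanujanTau (p ^ k) ∧ ramanujanTau (p ^ k) ∣ ramanujanTau n := by
  induction n using Nat.strong_induction_on with
  | _ n ih =>
    obtain rfl | h1 := eq_or_ne n 1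
    · exact absurd (isUnit_of_dvd_one (ramanujanTau_one ▸ h)) hl.not_isUnit
    have hp := Nat.minFac_prime h1
    obtain ⟨k, m, hm, hkm⟩ := Nat.exists_eq_pow_mul_and_not_dvd hn n.minFac hp.ne_one
    set p := n.minFac with hpn
    have hmul := ramanujanTau_prime_pow_mul hp hm k
    rw [← hkm] at hmul
    rcases hl.dvd_or_dvd (hmul ▸ h) with h' | h'
    · exact ⟨p, k, hp, h', hmul ▸ dvd_mul_right _ _⟩
    · have hm0 : m ≠ 0 := by rintro rfl; simp at hm
      have hlt : m < n := by
        refine lt_of_le_of_ne (Nat.le_of_dvd (Nat.pos_of_ne_zero hn) (hkm ▸ dvd_mul_left _ _)) ?_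
        intro h
        exact hm (h ▸ Nat.minFac_dvd n)
      obtain ⟨q, j, hq, h1, h2⟩ := ih m hlt hm0 h'
      exact ⟨q, j, hq, h1, h2.trans (hmul ▸ dvd_mul_left _ _)⟩

section

open Polynomial

theorem dvd_pow_sub_of_dvd_sub {R : Type*} [CommRing R] {d a b c : R} (k : ℕ) (h : d ∣ a - b)
    (h' : d ∣ b ^ k - c) : d ∣ a ^ k - c := by
  rw [← sub_add_sub_cancel _ (b ^ k)]
  exact dvd_add (h.trans (sub_dvd_pow_sub_pow a b k)) h'

theorem X_pow_eight_dvd_tauPoly_sub : (X : ℤ[X]) ^ 8 ∣ tauPoly 7 -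
    X * (1 - 24 * X + 252 * X ^ 2 - 1472 * X ^ 3 + 4830 * X ^ 4 - 6048 * X ^ 5 - 16744 * X ^ 6 +
      84480 * X ^ 7) := by
  have h0 : (X : ℤ[X]) ^ 8 ∣ ∏ m ∈ Finset.Icc 1 7, (1 - X ^ m) -
      (1 - X - X ^ 2 + X ^ 5 + X ^ 7) :=
    ⟨1 - X ^ 2 - X ^ 3 - 2 * X ^ 4 + 2 * X ^ 8 + X ^ 9 + X ^ 10 - X ^ 12 - X ^ 13 - X ^ 15 +
      X ^ 18 + X ^ 19 - X ^ 20, by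
      simp only [Finset.prod_Icc_succ_top, Finset.Icc_self, Finset.prod_singleton, Nat.reduceAdd,
        Nat.reduceLeDiff]
      ring⟩
  have h1 := dvd_pow_sub_of_dvd_sub (c := 1 - 3 * X + 5 * X ^ 3 - 7 * X ^ 6) 3 h0
    ⟨9 * X ^ 2 + 3 * X ^ 4 - 6 * X ^ 5 - 3 * X ^ 6 - 2 * X ^ 7 - 3 * X ^ 8 + 3 * X ^ 9 +
      3 * X ^ 11 + X ^ 13, by ring⟩
  have h2 := dvd_pow_sub_of_dvd_sub
    (c := 1 - 6 * X + 9 * X ^ 2 + 10 * X ^ 3 - 30 * X ^ 4 + 11 * X ^ 6 + 42 * X ^ 7) 2 h1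
    ⟨-70 * X + 49 * X ^ 4, by ring⟩
  have h3 := dvd_pow_sub_of_dvd_sub (c := 1 - 12 * X + 54 * X ^ 2 - 88 * X ^ 3 - 99 * X ^ 4 +
    540 * X ^ 5 - 418 * X ^ 6 - 648 * X ^ 7) 2 h2
    ⟨594 + 976 * X + 180 * X ^ 2 - 2520 * X ^ 3 + 121 * X ^ 4 + 924 * X ^ 5 + 1764 * X ^ 6,
      by ring⟩
  have h4 := dvd_pow_sub_of_dvd_sub (c := 1 - 24 * X + 252 * X ^ 2 - 1472 * X ^ 3 + 4830 * X ^ 4 -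
    6048 * X ^ 5 - 16744 * X ^ 6 + 84480 * X ^ 7) 2 h3
    ⟨-114831 - 103336 * X + 488412 * X ^ 2 - 323136 * X ^ 3 - 525116 * X ^ 4 + 541728 * X ^ 5 +
      419904 * X ^ 6, by ring⟩
  rw [tauPoly, Finset.prod_pow, ← mul_sub]
  refine Dvd.dvd.mul_left ?_ X
  simpa only [← pow_mul] using h4

theorem ramanujanTau_small : ramanujanTau 2 = -24 ∧ ramanujanTau 3 = 252 ∧
    ramanujanTau 5 = 4830 ∧ ramanujanTau 7 = -16744 := by
  have h := X_pow_dvd_iff.1 X_pow_eight_dvd_tauPoly_sub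
  have key (n : ℕ) (hn : n < 8) : ramanujanTau n = (X * (1 - 24 * X + 252 * X ^ 2 - 1472 * X ^ 3 +
      4830 * X ^ 4 - 6048 * X ^ 5 - 16744 * X ^ 6 + 84480 * X ^ 7) : ℤ[X]).coeff n := by
    rw [← coeff_tauPoly (N := 7) (by omega), ← sub_eq_zero, ← coeff_sub, h n hn]
  refine ⟨?_, ?_, ?_, ?_⟩ <;> rw [key _ (by norm_num)] <;>
    simp [coeff_X_mul, coeff_X, coeff_one, coeff_X_pow, coeff_ofNat_mul]

end

end RamanujanTau

namespace RamanujanTau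

open UpperHalfPlane Filter ModularForm Matrix MatrixGroups Function Derivative EisensteinSeries
open scoped Manifold ArithmeticFunction.sigma

local notation "Δ" => ModularForm.discriminant

local notation "𝕢" => Function.Periodic.qParam

section

variable {F : ℍ → ℂ}

theorem normalizedDeriv_eq_deriv_cuspFunction (hper : Periodic (F ∘ ofComplex) (1 : ℝ))
    (hF : MDiff F) (hbdd : IsBoundedAtImInfty F) (z : ℍ) :
    D F z = 𝕢 1 z * deriv (cuspFunction 1 F) (𝕢 1 z) := by
  have hq : ‖𝕢 1 z‖ < 1 := Periodic.norm_qParam_lt_one one_pos z.im_pos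
  have hd := (differentiableAt_cuspFunction one_pos hper hF hbdd hq).hasDerivAt
  have hdq : HasDerivAt (𝕢 1) (2 * Real.pi * Complex.I * 𝕢 1 z) (z : ℂ) := by
    unfold Function.Periodic.qParam
    have := ((hasDerivAt_id (z : ℂ)).const_mul (2 * Real.pi * Complex.I)).cexp
    simpa [mul_comm] using this
  have hcomp := hd.comp (z : ℂ) hdq
  have heq : cuspFunction 1 F ∘ 𝕢 1 = F ∘ ofComplex := by
    ext w
    exact Periodic.eq_cuspFunction one_ne_zero hper w
  rw [heq] at hcomp
  rw [normalizedDerivOfComplex, hcomp.deriv]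
  have := Complex.two_pi_I_ne_zero
  field_simp

theorem hasSum_normalizedDeriv (hper : Periodic (F ∘ ofComplex) (1 : ℝ)) (hF : MDiff F)
    (hbdd : IsBoundedAtImInfty F) (z : ℍ) :
    HasSum (fun n : ℕ => (n * (qExpansion 1 F).coeff n) • 𝕢 1 z ^ n) (D F z) := by
  have hq : ‖𝕢 1 z‖ < 1 := Periodic.norm_qParam_lt_one one_pos z.im_pos
  have hd := (differentiableOn_cuspFunction_ball one_pos hper hF hbdd).deriv Metric.isOpen_ball
  have := (Complex.hasSum_taylorSeries_on_ball hd (by simpa using hq)).mul_left (𝕢 1 z)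
  rw [normalizedDeriv_eq_deriv_cuspFunction hper hF hbdd, ← hasSum_nat_add_iff' 1]
  simp only [Finset.range_one, Finset.sum_singleton, Nat.cast_zero, zero_mul, zero_smul, sub_zero]
  refine this.congr_fun fun n => ?_
  rw [qExpansion_coeff, iteratedDeriv_succ', Nat.factorial_succ]
  have h1 : (n.factorial : ℂ) ≠ 0 := by exact_mod_cast n.factorial_ne_zero
  have h2 : (n + 1 : ℂ) ≠ 0 := by exact_mod_cast n.succ_ne_zero
  simp only [smul_eq_mul, sub_zero]
  push_cast
  field_simp
  ring

theorem normalizedDeriv_isZeroAtImInfty (hper : Periodic (F ∘ ofComplex) (1 : ℝ)) (hF : MDiff F)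
    (hbdd : IsBoundedAtImInfty F) : IsZeroAtImInfty (D F) := by
  have hc : ContinuousAt (deriv (cuspFunction 1 F)) 0 :=
    (analyticAt_cuspFunction_zero one_pos hper hF hbdd).deriv.continuousAt
  have : Tendsto (fun q : ℂ => q * deriv (cuspFunction 1 F) q) (nhds 0) (nhds 0) := by
    simpa using continuousAt_id.tendsto.mul hc.tendsto
  refine (this.comp (qParam_tendsto_atImInfty one_pos)).congr fun z => ?_
  exact (normalizedDeriv_eq_deriv_cuspFunction hper hF hbdd z).symm

theorem normalizedDeriv_periodic (hper : Periodic (F ∘ ofComplex) (1 : ℝ)) :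
    Periodic (D F ∘ ofComplex) (1 : ℝ) := by
  intro w
  by_cases! hw : 0 < w.im
  · have : 0 < (w + (1 : ℝ)).im := by simp [hw]
    simp only [Function.comp_apply, ofComplex_apply_of_im_pos this, ofComplex_apply_of_im_pos hw,
      normalizedDerivOfComplex]
    rw [← deriv_comp_add_const]
    congr 2
    exact funext hper
  · have : (w + (1 : ℝ)).im ≤ 0 := by simpa using hw
    simp only [Function.comp_apply, ofComplex_apply_of_im_nonpos this,
      ofComplex_apply_of_im_nonpos hw]

theorem normalizedDeriv_analyticAt (hper : Periodic (F ∘ ofComplex) (1 : ℝ)) (hF : MDiff F)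
    (hbdd : IsBoundedAtImInfty F) : AnalyticAt ℂ (cuspFunction 1 (D F)) 0 :=
  analyticAt_cuspFunction_zero one_pos (normalizedDeriv_periodic hper)
    (normalizedDerivOfComplex_mdifferentiable hF)
    (normalizedDeriv_isZeroAtImInfty hper hF hbdd).isBoundedAtImInfty

theorem qExpansion_normalizedDeriv (hper : Periodic (F ∘ ofComplex) (1 : ℝ)) (hF : MDiff F)
    (hbdd : IsBoundedAtImInfty F) (n : ℕ) :
    (qExpansion 1 (D F)).coeff n = n * (qExpansion 1 F).coeff n := by
  have h1 := normalizedDeriv_analyticAt hper hF hbdd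
  have h2 := hasSum_normalizedDeriv hper hF hbdd
  let _ : FunLike (ℍ → ℂ) ℍ ℂ := ⟨id, Function.injective_id⟩
  exact (UpperHalfPlane.qExpansion_coeff_unique (D F) one_pos h1 h2 n).symm

end
end RamanujanTau

namespace RamanujanTau

open UpperHalfPlane Filter ModularForm Matrix MatrixGroups Function Derivative EisensteinSeries
open scoped Manifold ArithmeticFunction.sigma

local notation "Δ" => ModularForm.discriminant

theorem qExpansion_normalizedDeriv_modularForm {k : ℤ} (f : ModularForm 𝒮ℒ k) (n : ℕ) :
    (qExpansion 1 (D f)).coeff n = n * (qExpansion 1 f).coeff n :=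
  qExpansion_normalizedDeriv (SlashInvariantFormClass.periodic_comp_ofComplex f
    one_mem_strictPeriods_SL) (ModularFormClass.holo f) (ModularFormClass.bdd_at_infty f) n

theorem analyticAt_normalizedDeriv_modularForm {k : ℤ} (f : ModularForm 𝒮ℒ k) :
    AnalyticAt ℂ (cuspFunction 1 (D f)) 0 :=
  normalizedDeriv_analyticAt (SlashInvariantFormClass.periodic_comp_ofComplex f
    one_mem_strictPeriods_SL) (ModularFormClass.holo f) (ModularFormClass.bdd_at_infty f)

theorem isZeroAtImInfty_normalizedDeriv_modularForm {k : ℤ} (f : ModularForm 𝒮ℒ k) :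
    IsZeroAtImInfty (D f) :=
  normalizedDeriv_isZeroAtImInfty (SlashInvariantFormClass.periodic_comp_ofComplex f
    one_mem_strictPeriods_SL) (ModularFormClass.holo f) (ModularFormClass.bdd_at_infty f)

/-- The first Rankin–Cohen bracket of `E₄` and `E₆`, up to normalisation. -/
noncomputable def eisensteinBracket : ℍ → ℂ :=
  (2 : ℂ) • (⇑E₄ * D E₆) - (3 : ℂ) • (⇑E₆ * D E₄)

theorem eisensteinBracket_eq : eisensteinBracket =
    (2 : ℂ) • (⇑E₄ * serreDerivative (6 : ℤ) E₆) -
      (3 : ℂ) • (⇑E₆ * serreDerivative (4 : ℤ) E₄) := by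
  ext z
  simp [eisensteinBracket]
  ring

theorem eisensteinBracket_slash (γ : SL(2, ℤ)) :
    eisensteinBracket ∣[(12 : ℤ)] γ = eisensteinBracket := by
  have h4 : (⇑E₄) ∣[(4 : ℤ)] γ = ⇑E₄ := SlashInvariantFormClass.slash_action_eq E₄ _ ⟨γ, rfl⟩
  have h6 : (⇑E₆) ∣[(6 : ℤ)] γ = ⇑E₆ := SlashInvariantFormClass.slash_action_eq E₆ _ ⟨γ, rfl⟩
  have d4 := serreDerivative_slash_invariant (ModularFormClass.holo E₄) h4
  have d6 := serreDerivative_slash_invariant (ModularFormClass.holo E₆) h6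
  have e1 := mul_slash_SL2 4 (6 + 2) γ E₄ (serreDerivative (6 : ℤ) E₆)
  have e2 := mul_slash_SL2 6 (4 + 2) γ E₆ (serreDerivative (4 : ℤ) E₄)
  rw [h4, d6] at e1
  rw [h6, d4] at e2
  rw [eisensteinBracket_eq, sub_eq_add_neg, SlashAction.add_slash, SlashAction.neg_slash,
    SL_smul_slash, SL_smul_slash]
  rw [show (4 : ℤ) + (6 + 2) = 12 from rfl] at e1
  rw [show (6 : ℤ) + (4 + 2) = 12 from rfl] at e2
  rw [e1, e2]

theorem mdifferentiable_eisensteinBracket : MDiff eisensteinBracket := by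
  have h4 := ModularFormClass.holo E₄
  have h6 := ModularFormClass.holo E₆
  exact ((h4.mul (normalizedDerivOfComplex_mdifferentiable h6)).const_smul _).sub
    ((h6.mul (normalizedDerivOfComplex_mdifferentiable h4)).const_smul _)

theorem eisensteinBracket_isZeroAtImInfty : IsZeroAtImInfty eisensteinBracket := by
  have key {k l : ℤ} (f : ModularForm 𝒮ℒ k) (g : ModularForm 𝒮ℒ l) (c : ℂ) :
      IsZeroAtImInfty (c • (⇑f * D g)) := by
    refine Filter.ZeroAtFilter.smul c ?_
    have hz : IsZeroAtImInfty (D g) := isZeroAtImInfty_normalizedDeriv_modularForm g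
    have hb : IsBoundedAtImInfty f := ModularFormClass.bdd_at_infty f
    exact Filter.BoundedAtFilter.mul_zeroAtFilter hb hz
  have := (key E₄ E₆ 2).add (key E₆ E₄ 3).neg
  rwa [← sub_eq_add_neg] at this

/-- `eisensteinBracket` as a cusp form. -/
noncomputable def eisensteinBracketForm : CuspForm 𝒮ℒ 12 where
  toFun := eisensteinBracket
  slash_action_eq' A hA := by
    obtain ⟨A, rfl⟩ := hA
    exact eisensteinBracket_slash A
  holo' := mdifferentiable_eisensteinBracket
  zero_at_cusps' hc := by
    rw [Subgroup.IsArithmetic.isCusp_iff_isCusp_SL2Z] at hc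
    rw [OnePoint.isZeroAt_iff_forall_SL2Z hc]
    intro γ _
    rw [eisensteinBracket_slash]
    exact eisensteinBracket_isZeroAtImInfty

theorem qExpansion_E₄_coeff (n : ℕ) : (qExpansion 1 E₄).coeff n =
    if n = 0 then 1 else 240 * (σ 3 n : ℂ) := by
  norm_num [E_qExpansion_coeff _ ⟨2, rfl⟩, show bernoulli 4 = -1 / 30 by decide +kernel]

theorem qExpansion_E₆_coeff (n : ℕ) : (qExpansion 1 E₆).coeff n =
    if n = 0 then 1 else -504 * (σ 5 n : ℂ) := by
  norm_num [E_qExpansion_coeff _ ⟨3, rfl⟩, show bernoulli 6 = 1 / 42 by decide +kernel]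

theorem qExpansion_eisensteinBracket : qExpansion 1 eisensteinBracket =
    (2 : ℂ) • (qExpansion 1 E₄ * qExpansion 1 (D E₆)) -
      (3 : ℂ) • (qExpansion 1 E₆ * qExpansion 1 (D E₄)) := by
  have a4 : AnalyticAt ℂ (cuspFunction 1 E₄) 0 :=
    ModularFormClass.analyticAt_cuspFunction_zero E₄ one_pos one_mem_strictPeriods_SL
  have a6 : AnalyticAt ℂ (cuspFunction 1 E₆) 0 :=
    ModularFormClass.analyticAt_cuspFunction_zero E₆ one_pos one_mem_strictPeriods_SL
  have b4 := analyticAt_normalizedDeriv_modularForm E₄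
  have b6 := analyticAt_normalizedDeriv_modularForm E₆
  have m4 : AnalyticAt ℂ (cuspFunction 1 (⇑E₄ * D E₆)) 0 := by
    rw [cuspFunction_mul a4.continuousAt b6.continuousAt]
    exact a4.mul b6
  have m6 : AnalyticAt ℂ (cuspFunction 1 (⇑E₆ * D E₄)) 0 := by
    rw [cuspFunction_mul a6.continuousAt b4.continuousAt]
    exact a6.mul b4
  rw [← qExpansion_mul a4 b6, ← qExpansion_mul a6 b4, ← qExpansion_smul m4, ← qExpansion_smul m6]
  refine qExpansion_sub ?_ ?_
  · rw [cuspFunction_smul m4.continuousAt]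
    exact m4.const_smul
  · rw [cuspFunction_smul m6.continuousAt]
    exact m6.const_smul

theorem exists_smul_discriminant_eq_eisensteinBracket :
    ∃ c : ℂ, c • Δ = eisensteinBracket := by
  obtain ⟨c, hc⟩ := CuspForm.exists_smul_discriminant_of_weight_eq_twelve eisensteinBracketForm
  exact ⟨c, congrArg DFunLike.coe hc⟩

/-- The power series `∑ σ k n * X ^ n`. -/
noncomputable def sigmaSeries (k : ℕ) : PowerSeries ℤ := .mk fun n => (σ k n : ℤ)

/-- The power series `∑ n * σ k n * X ^ n`. -/
noncomputable def sigmaDerivSeries (k : ℕ) : PowerSeries ℤ := .mk fun n => (n * σ k n : ℤ)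

@[simp]
theorem coeff_sigmaSeries (k n : ℕ) : (sigmaSeries k).coeff n = (σ k n : ℤ) :=
  PowerSeries.coeff_mk _ _

@[simp]
theorem coeff_sigmaDerivSeries (k n : ℕ) : (sigmaDerivSeries k).coeff n = (n * σ k n : ℤ) :=
  PowerSeries.coeff_mk _ _

theorem qExpansion_E₄ :
    qExpansion 1 E₄ = 1 + (240 : ℂ) • (sigmaSeries 3).map (Int.castRingHom ℂ) := by
  ext n
  by_cases hn : n = 0 <;> simp [hn, PowerSeries.coeff_one, qExpansion_E₄_coeff,
    -PowerSeries.coeff_zero_eq_constantCoeff]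

theorem qExpansion_E₆ :
    qExpansion 1 E₆ = 1 - (504 : ℂ) • (sigmaSeries 5).map (Int.castRingHom ℂ) := by
  ext n
  by_cases hn : n = 0 <;> simp [hn, PowerSeries.coeff_one, qExpansion_E₆_coeff,
    -PowerSeries.coeff_zero_eq_constantCoeff]

theorem qExpansion_normalizedDeriv_E₄ : qExpansion 1 (D E₄) =
    (240 : ℂ) • (sigmaDerivSeries 3).map (Int.castRingHom ℂ) := by
  ext n
  rw [qExpansion_normalizedDeriv_modularForm, qExpansion_E₄_coeff]
  by_cases hn : n = 0 <;> simp [hn, mul_left_comm, -PowerSeries.coeff_zero_eq_constantCoeff]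

theorem qExpansion_normalizedDeriv_E₆ : qExpansion 1 (D E₆) =
    (-504 : ℂ) • (sigmaDerivSeries 5).map (Int.castRingHom ℂ) := by
  ext n
  rw [qExpansion_normalizedDeriv_modularForm, qExpansion_E₆_coeff]
  by_cases hn : n = 0 <;> simp [hn, mul_left_comm, -PowerSeries.coeff_zero_eq_constantCoeff]

theorem qExpansion_eisensteinBracket_coeff (n : ℕ) :
    (qExpansion 1 eisensteinBracket).coeff n = -144 * ((7 * n * σ 5 n + 5 * n * σ 3 n +
      840 * (2 * (sigmaSeries 3 * sigmaDerivSeries 5) -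
        3 * (sigmaSeries 5 * sigmaDerivSeries 3)).coeff n : ℤ) : ℂ) := by
  have h : qExpansion 1 eisensteinBracket =
      (-144 : ℂ) • (7 * sigmaDerivSeries 5 + 5 * sigmaDerivSeries 3 +
      840 * (2 * (sigmaSeries 3 * sigmaDerivSeries 5) -
        3 * (sigmaSeries 5 * sigmaDerivSeries 3))).map (Int.castRingHom ℂ) := by
    rw [qExpansion_eisensteinBracket, qExpansion_E₄, qExpansion_E₆,
      qExpansion_normalizedDeriv_E₄, qExpansion_normalizedDeriv_E₆]
    simp only [map_add, map_sub, map_mul, map_ofNat, PowerSeries.smul_eq_C_mul, map_neg]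
    ring
  rw [h]
  simp only [PowerSeries.coeff_smul, PowerSeries.coeff_map, smul_eq_mul, eq_intCast, map_add]
  congr 2
  rw [← map_ofNat (PowerSeries.C (R := ℤ)) 7, ← map_ofNat (PowerSeries.C (R := ℤ)) 5,
    ← map_ofNat (PowerSeries.C (R := ℤ)) 840]
  simp only [PowerSeries.coeff_C_mul, coeff_sigmaDerivSeries, mul_assoc, Int.cast_add]

theorem ramanujanTau_eq_sigma (n : ℕ) : ∃ c : ℤ, 12 * ramanujanTau n =
    7 * n * σ 5 n + 5 * n * σ 3 n + 840 * c := by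
  obtain ⟨c, hc⟩ := exists_smul_discriminant_eq_eisensteinBracket
  have hΔ : qExpansion 1 eisensteinBracket = c • qExpansion 1 Δ := by
    rw [← hc]
    exact qExpansion_smul (ModularFormClass.analyticAt_cuspFunction_zero CuspForm.discriminant
      one_pos one_mem_strictPeriods_SL) c
  have h (n : ℕ) := qExpansion_eisensteinBracket_coeff n
  simp only [hΔ, PowerSeries.coeff_smul, qExpansion_discriminant_coeff, smul_eq_mul] at h
  have h1 : c = -1728 := by
    have := h 1
    rw [ramanujanTau_one] at this
    have h2 : (2 * (sigmaSeries 3 * sigmaDerivSeries 5) -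
        3 * (sigmaSeries 5 * sigmaDerivSeries 3)).coeff 1 = 0 := by
      rw [← map_ofNat (PowerSeries.C (R := ℤ)) 2, ← map_ofNat (PowerSeries.C (R := ℤ)) 3]
      simp [PowerSeries.coeff_mul, Finset.Nat.antidiagonal_succ,
        -PowerSeries.coeff_zero_eq_constantCoeff]
    rw [h2] at this
    norm_num at this
    exact this
  refine ⟨(2 * (sigmaSeries 3 * sigmaDerivSeries 5) -
    3 * (sigmaSeries 5 * sigmaDerivSeries 3)).coeff n, ?_⟩
  rw [← Int.cast_inj (α := ℂ)]
  push_cast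
  have := h n
  push_cast at this
  linear_combination (-1 / 144) * this + ramanujanTau n / 144 * h1

theorem ramanujanTau_prime_congr {p : ℕ} (hp : p.Prime) : ∃ c : ℤ, 12 * ramanujanTau p =
    7 * p * (1 + p ^ 5) + 5 * p * (1 + p ^ 3) + 840 * c := by
  obtain ⟨c, hc⟩ := ramanujanTau_eq_sigma p
  refine ⟨c, ?_⟩
  have h (k : ℕ) : σ k p = 1 + p ^ k := by
    rw [ArithmeticFunction.sigma_apply, hp.divisors, Finset.sum_pair hp.one_lt.ne]
    simp
  rw [hc, h, h]
  push_cast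
  ring

theorem even_ramanujanTau_prime {p : ℕ} (hp : p.Prime) : Even (ramanujanTau p) := by
  rcases hp.eq_two_or_odd' with rfl | hodd
  · rw [ramanujanTau_small.1]
    decide
  obtain ⟨c, hc⟩ := ramanujanTau_prime_congr hp
  have h8 : (ramanujanTau p * 12 : ZMod 8) = 0 := by
    have := congrArg (Int.cast : ℤ → ZMod 8) hc
    push_cast at this
    obtain ⟨k, rfl⟩ := hodd
    push_cast at this
    rw [mul_comm, this]
    clear this hc hp
    generalize (k : ZMod 8) = x at *
    generalize (c : ZMod 8) = z at *
    revert x z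
    decide
  have : ((ramanujanTau p * 12 : ℤ) : ZMod 8) = 0 := by exact_mod_cast h8
  rw [ZMod.intCast_zmod_eq_zero_iff_dvd] at this
  rw [Int.even_iff]
  omega

theorem ramanujanTau_prime_congr_five {p : ℕ} (hp : p.Prime) :
    (ramanujanTau p : ZMod 5) = p + p ^ 2 := by
  obtain ⟨c, hc⟩ := ramanujanTau_prime_congr hp
  have := congrArg (Int.cast : ℤ → ZMod 5) hc
  push_cast at this
  generalize (p : ZMod 5) = x at *
  generalize (ramanujanTau p : ZMod 5) = y at *
  generalize (c : ZMod 5) = z at *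
  revert x y z
  decide

theorem ramanujanTau_prime_congr_seven {p : ℕ} (hp : p.Prime) :
    (ramanujanTau p : ZMod 7) = p + p ^ 4 := by
  obtain ⟨c, hc⟩ := ramanujanTau_prime_congr hp
  have := congrArg (Int.cast : ℤ → ZMod 7) hc
  push_cast at this
  generalize (p : ZMod 7) = x at *
  generalize (ramanujanTau p : ZMod 7) = y at *
  generalize (c : ZMod 7) = z at *
  revert x y z
  decide

end RamanujanTau

namespace RamanujanTau

section

open Polynomial Filter

local notation "P" => PowerSeries.pentagonalSeries (ZMod 23)

theorem exists_coeff_prod_eq_pentagonal (n : ℕ) : ∃ N, n ≤ N ∧ ∀ i ≤ n,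
    (∏ m ∈ Finset.Icc 1 N, (1 - X ^ m) : (ZMod 23)[X]).coeff i = PowerSeries.coeff i P := by
  have h := (eventually_all_finset (Finset.range (n + 1))).2 fun i _ =>
    tendsto_finset_range.eventually
      (PowerSeries.coeff_prod_one_sub_X_pow_eventually_eq (ZMod 23) i)
  obtain ⟨N, hN, h⟩ := ((eventually_ge_atTop n).and h).exists
  refine ⟨N, hN, fun i hi => ?_⟩
  rw [← h i (by simpa [Nat.lt_succ_iff] using hi), ← Polynomial.coeff_coe]
  congr 1
  rw [Finset.range_eq_Ico, Finset.prod_Ico_add' (fun m => (1 - PowerSeries.X ^ m)) 0 N 1]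
  rw [← Polynomial.coeToPowerSeries.ringHom_apply, map_prod]
  simp
  rfl

/-- The coefficients of `∏ (1 - X ^ m) * (1 - X ^ (23 * m))`. -/
theorem ramanujanTau_succ_mod (n : ℕ) : (ramanujanTau (n + 1) : ZMod 23) =
    ∑ x ∈ Finset.HasAntidiagonal.antidiagonal n, PowerSeries.coeff x.1 P *
      if 23 ∣ x.2 then PowerSeries.coeff (x.2 / 23) P else 0 := by
  have : Fact (Nat.Prime 23) := ⟨by norm_num⟩
  obtain ⟨N, hN, h⟩ := exists_coeff_prod_eq_pentagonal (n + 1)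
  rw [← coeff_tauPoly hN, ← eq_intCast (Int.castRingHom (ZMod 23)), ← coeff_map, tauPoly]
  simp only [Polynomial.map_mul, Polynomial.map_prod, Polynomial.map_pow, Polynomial.map_sub,
    Polynomial.map_one, Polynomial.map_X, coeff_X_mul, Finset.prod_pow]
  rw [pow_succ', ← ZMod.expand_card, coeff_mul]
  refine Finset.sum_congr rfl fun x hx => ?_
  have := Finset.HasAntidiagonal.mem_antidiagonal.1 hx
  rw [coeff_expand (by norm_num), h _ (by omega), h _ (by omega)]

theorem exists_sq_of_coeff_pentagonalSeries_ne_zero {i : ℕ} (h : PowerSeries.coeff i P ≠ 0) :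
    ∃ a : ℤ, a ^ 2 = 24 * i + 1 := by
  have : Fact (1 < 23) := ⟨by norm_num⟩
  rw [ne_eq, PowerSeries.coeff_pentagonalSeries_eq_zero_iff, not_not] at h
  obtain ⟨k, rfl⟩ := h
  exact ⟨6 * k - 1, by linear_combination -12 * two_mul_natCast_pentagonal k⟩

theorem coeff_pentagonalSeries_of_sq {i : ℕ} {a : ℤ} (h : a ^ 2 = 24 * i + 1) :
    PowerSeries.coeff i P = if a % 12 = 1 ∨ a % 12 = 11 then 1 else -1 := by
  have h6 : a % 6 = 1 ∨ a % 6 = 5 := by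
    have h1 : a ^ 2 % 6 = 1 := by omega
    have h2 : a % 6 = 0 ∨ a % 6 = 1 ∨ a % 6 = 2 ∨ a % 6 = 3 ∨ a % 6 = 4 ∨ a % 6 = 5 := by omega
    rcases h2 with h2 | h2 | h2 | h2 | h2 | h2 <;> simp [pow_two, Int.mul_emod, h2] at h1 ⊢
  have key (k : ℤ) (hk : a = 6 * k - 1 ∨ a = 1 - 6 * k) : PowerSeries.coeff i P =
      if a % 12 = 1 ∨ a % 12 = 11 then 1 else -1 := by
    have hi : i = pentagonal k := by
      have := two_mul_natCast_pentagonal k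
      zify
      rcases hk with rfl | rfl <;> linarith
    rw [hi, PowerSeries.coeff_pentagonalSeries_pentagonal]
    rcases Int.even_or_odd k with h | h
    · rw [Int.negOnePow_even _ h, if_pos (by obtain ⟨c, rfl⟩ := h; omega)]
      simp
    · rw [Int.negOnePow_odd _ h, if_neg (by obtain ⟨c, rfl⟩ := h; omega)]
      simp
  rcases h6 with h6 | h6
  · exact key ((1 - a) / 6) (by omega)
  · exact key ((a + 1) / 6) (by omega)

end

end RamanujanTau

namespace RamanujanTau

/-- `(a, b, c)` is the pullback of one of the reduced forms of discriminant `-23`. -/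
def PullbackOfReduced (a b c : ℤ) : Prop :=
  ∃ x y z w : ℤ,
    (a = x ^ 2 + x * y + 6 * y ^ 2 ∧ b = 2 * x * z + x * w + y * z + 12 * y * w ∧
      c = z ^ 2 + z * w + 6 * w ^ 2) ∨
    (a = 2 * x ^ 2 + x * y + 3 * y ^ 2 ∧ b = 4 * x * z + x * w + y * z + 6 * y * w ∧
      c = 2 * z ^ 2 + z * w + 3 * w ^ 2)

theorem PullbackOfReduced.swap {a b c : ℤ} (h : PullbackOfReduced a b c) :
    PullbackOfReduced c b a := by
  obtain ⟨x, y, z, w, ⟨h1, h2, h3⟩ | ⟨h1, h2, h3⟩⟩ := h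
  · exact ⟨z, w, x, y, .inl ⟨h3, by rw [h2]; ring, h1⟩⟩
  · exact ⟨z, w, x, y, .inr ⟨h3, by rw [h2]; ring, h1⟩⟩

theorem PullbackOfReduced.shear {a b c : ℤ} (k : ℤ) (h : PullbackOfReduced a b c) :
    PullbackOfReduced a (b + 2 * a * k) (c + b * k + a * k ^ 2) := by
  obtain ⟨x, y, z, w, ⟨h1, h2, h3⟩ | ⟨h1, h2, h3⟩⟩ := h
  · exact ⟨x, y, z + k * x, w + k * y, .inl ⟨h1, by rw [h1, h2]; ring, by rw [h1, h2, h3]; ring⟩⟩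
  · exact ⟨x, y, z + k * x, w + k * y, .inr ⟨h1, by rw [h1, h2]; ring, by rw [h1, h2, h3]; ring⟩⟩

theorem pullbackOfReduced {a b c : ℤ} (ha : 0 < a) (h : b ^ 2 - 4 * a * c = -23) :
    PullbackOfReduced a b c := by
  induction hn : a.natAbs using Nat.strong_induction_on generalizing a b c with
  | _ n ih =>
  subst hn
  set k := (b + a) / (2 * a) with hk
  set b' := b - 2 * a * k with hb'
  set c' := c - b * k + a * k ^ 2 with hc'
  have h' : b' ^ 2 - 4 * a * c' = -23 := by rw [← h, hb', hc']; ring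
  suffices H : PullbackOfReduced a b' c' by
    convert H.shear k using 1
    · rw [hb']; ring
    · rw [hb', hc']; ring
  have hb1 : -a ≤ b' := by
    have := Int.mul_ediv_self_le (x := b + a) (k := 2 * a) (by omega)
    rw [← hk] at this
    linarith
  have hb2 : b' < a := by
    have := Int.lt_mul_ediv_self_add (x := b + a) (k := 2 * a) (by omega)
    rw [← hk] at this
    linarith
  clear_value b' c'
  have hc : 0 < c' := by nlinarith [sq_nonneg b']
  by_cases hca : c' < a
  · exact (ih c'.natAbs (by omega) hc (by linarith) rfl).swap
  have ha2 : a ≤ 2 := by nlinarith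
  interval_cases a
  · interval_cases b'
    · exact ⟨1, 0, -1, 1, .inl ⟨by norm_num, by norm_num, by linarith⟩⟩
    · omega
  · interval_cases b'
    · omega
    · exact ⟨1, 0, 0, -1, .inr ⟨by norm_num, by norm_num, by linarith⟩⟩
    · omega
    · exact ⟨1, 0, 0, 1, .inr ⟨by norm_num, by norm_num, by linarith⟩⟩

theorem sq_eq_of_dvd_of_principal {p X Y a b : ℤ} (hp : Prime p) (h : p = X ^ 2 + X * Y + 6 * Y ^ 2)
    (hab : a ^ 2 + 23 * b ^ 2 = 24 * p) (hd : p ∣ a * Y - b * (2 * X + Y)) :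
    (a ^ 2 = (X - 11 * Y) ^ 2 ∧ b ^ 2 = (X + Y) ^ 2) ∨
    (a ^ 2 = (X + 12 * Y) ^ 2 ∧ b ^ 2 = X ^ 2) := by
  obtain ⟨m, hm⟩ := hd
  have hp0 := hp.ne_zero
  have e1 : (a * (2 * X + Y) + 23 * b * Y) ^ 2 = p * (p * (96 - 23 * m ^ 2)) := by
    linear_combination (-(a ^ 2 + 23 * b ^ 2) * 4) * h + 4 * p * hab -
      23 * (a * Y - b * (2 * X + Y) + p * m) * hm
  obtain ⟨n, hn⟩ := hp.dvd_of_dvd_pow (Dvd.intro _ e1.symm)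
  have e2 : n ^ 2 + 23 * m ^ 2 = 96 := by
    rw [hn] at e1
    apply mul_left_cancel₀ (pow_ne_zero 2 hp0)
    linear_combination e1
  have e3 : 4 * a = n * (2 * X + Y) + 23 * m * Y := by
    apply mul_left_cancel₀ hp0
    linear_combination 4 * a * h + (2 * X + Y) * hn + 23 * Y * hm
  have e4 : 4 * b = n * Y - m * (2 * X + Y) := by
    apply mul_left_cancel₀ hp0
    linear_combination 4 * b * h + Y * hn - (2 * X + Y) * hm
  have hm1 : -2 ≤ m := by nlinarith
  have hm2 : m ≤ 2 := by nlinarith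
  have hn1 : -9 ≤ n := by nlinarith
  have hn2 : n ≤ 9 := by nlinarith
  have key : (n = 2 ∨ n = -2) ∧ (m = 2 ∨ m = -2) := by
    clear * - e2 hm1 hm2 hn1 hn2
    interval_cases m <;> interval_cases n <;> simp_all
  obtain ⟨rfl | rfl, rfl | rfl⟩ := key
  · exact .inr ⟨by rw [show a = X + 12 * Y by linarith], by rw [show b = -X by linarith]; ring⟩
  · exact .inl ⟨by rw [show a = X - 11 * Y by linarith], by rw [show b = X + Y by linarith]⟩
  · exact .inl ⟨by rw [show a = -(X - 11 * Y) by linarith]; ring,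
      by rw [show b = -(X + Y) by linarith]; ring⟩
  · exact .inr ⟨by rw [show a = -(X + 12 * Y) by linarith]; ring,
      by rw [show b = X by linarith]⟩

theorem sq_eq_of_principal {p X Y a b : ℤ} (hp : Prime p) (h : p = X ^ 2 + X * Y + 6 * Y ^ 2)
    (hab : a ^ 2 + 23 * b ^ 2 = 24 * p) :
    (a ^ 2 = (X - 11 * Y) ^ 2 ∧ b ^ 2 = (X + Y) ^ 2) ∨
    (a ^ 2 = (X + 12 * Y) ^ 2 ∧ b ^ 2 = X ^ 2) := by
  have hd : p ∣ (a * Y - b * (2 * X + Y)) * (a * Y - -b * (2 * X + Y)) :=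
    ⟨24 * Y ^ 2 - 4 * b ^ 2, by linear_combination 4 * b ^ 2 * h + Y ^ 2 * hab⟩
  rcases hp.dvd_or_dvd hd with hd | hd
  · exact sq_eq_of_dvd_of_principal hp h hab hd
  · have := sq_eq_of_dvd_of_principal hp h (by linarith [neg_sq b]) hd
    rwa [neg_sq] at this

theorem sq_eq_of_dvd_of_nonprincipal {p X Y a b : ℤ} (hp : Prime p) (hp2 : p % 2 = 1)
    (h : p = 2 * X ^ 2 + X * Y + 3 * Y ^ 2)
    (hab : a ^ 2 + 23 * b ^ 2 = 24 * p) (hd : p ∣ a * Y - b * (4 * X + Y)) :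
    a ^ 2 = (5 * X + 7 * Y) ^ 2 ∧ b ^ 2 = (Y - X) ^ 2 := by
  obtain ⟨m, hm⟩ := hd
  have hp0 := hp.ne_zero
  have e1 : (a * (4 * X + Y) + 23 * b * Y) ^ 2 = p * (p * (192 - 23 * m ^ 2)) := by
    linear_combination (-(a ^ 2 + 23 * b ^ 2) * 8) * h + 8 * p * hab -
      23 * (a * Y - b * (4 * X + Y) + p * m) * hm
  obtain ⟨n, hn⟩ := hp.dvd_of_dvd_pow (Dvd.intro _ e1.symm)
  have e2 : n ^ 2 + 23 * m ^ 2 = 192 := by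
    rw [hn] at e1
    apply mul_left_cancel₀ (pow_ne_zero 2 hp0)
    linear_combination e1
  have e3 : 8 * a = n * (4 * X + Y) + 23 * m * Y := by
    apply mul_left_cancel₀ hp0
    linear_combination 8 * a * h + (4 * X + Y) * hn + 23 * Y * hm
  have e4 : 8 * b = n * Y - m * (4 * X + Y) := by
    apply mul_left_cancel₀ hp0
    linear_combination 8 * b * h + Y * hn - (4 * X + Y) * hm
  have hm1 : -2 ≤ m := by nlinarith
  have hm2 : m ≤ 2 := by nlinarith
  have hn1 : -13 ≤ n := by nlinarith
  have hn2 : n ≤ 13 := by nlinarith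
  have key : (n = 10 ∨ n = -10) ∧ (m = 2 ∨ m = -2) ∨ (n = 13 ∨ n = -13) ∧ (m = 1 ∨ m = -1) := by
    clear * - e2 hm1 hm2 hn1 hn2
    interval_cases m <;> interval_cases n <;> simp_all
  have hpar : X % 2 = 0 ∧ Y % 2 = 1 := by
    rw [h] at hp2
    clear * - hp2
    rcases Int.emod_two_eq_zero_or_one X with h1 | h1 <;>
    rcases Int.emod_two_eq_zero_or_one Y with h2 | h2 <;>
    simp [pow_two, Int.add_emod, Int.mul_emod, h1, h2] at hp2 ⊢
  obtain ⟨hX, hY⟩ := hpar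
  obtain ⟨rfl | rfl, rfl | rfl⟩ | ⟨rfl | rfl, rfl | rfl⟩ := key
  · exact ⟨by rw [show a = 5 * X + 7 * Y by linarith], by rw [show b = Y - X by linarith]⟩
  · omega
  · omega
  · exact ⟨by rw [show a = -(5 * X + 7 * Y) by linarith]; ring,
      by rw [show b = -(Y - X) by linarith]; ring⟩
  all_goals omega

theorem sq_eq_of_nonprincipal {p X Y a b : ℤ} (hp : Prime p) (hp2 : p % 2 = 1)
    (h : p = 2 * X ^ 2 + X * Y + 3 * Y ^ 2) (hab : a ^ 2 + 23 * b ^ 2 = 24 * p) :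
    a ^ 2 = (5 * X + 7 * Y) ^ 2 ∧ b ^ 2 = (Y - X) ^ 2 := by
  have hd : p ∣ (a * Y - b * (4 * X + Y)) * (a * Y - -b * (4 * X + Y)) :=
    ⟨24 * Y ^ 2 - 8 * b ^ 2, by linear_combination 8 * b ^ 2 * h + Y ^ 2 * hab⟩
  rcases hp.dvd_or_dvd hd with hd | hd
  · exact sq_eq_of_dvd_of_nonprincipal hp hp2 h hab hd
  · have := sq_eq_of_dvd_of_nonprincipal hp hp2 h (by linarith [neg_sq b]) hd
    rwa [neg_sq] at this

end RamanujanTau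

namespace RamanujanTau

section

local notation "P" => PowerSeries.pentagonalSeries (ZMod 23)

theorem exists_eq_reduced_of_isSquare {p : ℕ} (hp : p.Prime) (hp2 : p ≠ 2) (hp23 : p ≠ 23)
    (h : IsSquare (p : ZMod 23)) : ∃ X Y : ℤ,
      (p : ℤ) = X ^ 2 + X * Y + 6 * Y ^ 2 ∨ (p : ℤ) = 2 * X ^ 2 + X * Y + 3 * Y ^ 2 := by
  have : Fact p.Prime := ⟨hp⟩
  have : Fact (Nat.Prime 23) := ⟨by norm_num⟩
  have hsq : IsSquare (-23 : ZMod p) := by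
    rcases Nat.odd_mod_four_iff.1 (Nat.odd_iff.1 (hp.odd_of_ne_two hp2)) with h4 | h4
    · have h1 : IsSquare (-1 : ZMod p) := ZMod.exists_sq_eq_neg_one_iff.2 (by omega)
      have h2 := (ZMod.exists_sq_eq_prime_iff_of_mod_four_eq_one (q := 23) h4 (by norm_num)).2 h
      simpa using h1.mul h2
    · have h1 : ¬ IsSquare (-1 : ZMod p) := fun h1 => ZMod.exists_sq_eq_neg_one_iff.1 h1 h4
      have h2 : ¬ IsSquare ((23 : ℕ) : ZMod p) := fun h2 =>
        (ZMod.exists_sq_eq_prime_iff_of_mod_four_eq_three h4 (by norm_num) hp23).1 h2 h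
      have h0 : (-23 : ZMod p) ≠ 0 := by
        rw [neg_ne_zero]
        have := (ZMod.natCast_eq_zero_iff 23 p).not.2
          ((Nat.prime_dvd_prime_iff_eq hp (by norm_num)).not.2 hp23)
        exact_mod_cast this
      rw [← quadraticChar_one_iff_isSquare h0, show (-23 : ZMod p) = -1 * (23 : ℕ) by simp, map_mul,
        quadraticChar_neg_one_iff_not_isSquare.2 h1, quadraticChar_neg_one_iff_not_isSquare.2 h2]
      norm_num
  obtain ⟨s, hs⟩ := hsq
  obtain ⟨b, hb, hodd⟩ : ∃ b : ℤ, (b : ZMod p) = s ∧ b % 2 = 1 := by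
    rcases Int.emod_two_eq_zero_or_one (s.val : ℤ) with h0 | h0
    · refine ⟨s.val + p, by simp, ?_⟩
      have := Nat.odd_iff.1 (hp.odd_of_ne_two hp2)
      omega
    · exact ⟨s.val, by simp, h0⟩
  have hd : (p : ℤ) ∣ b ^ 2 + 23 := by
    rw [← ZMod.intCast_zmod_eq_zero_iff_dvd]
    push_cast
    rw [hb, pow_two, ← hs]
    ring
  have hd4 : (4 : ℤ) ∣ b ^ 2 + 23 := by
    obtain ⟨c, rfl⟩ : ∃ c, b = 2 * c + 1 := ⟨b / 2, by omega⟩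
    exact ⟨c ^ 2 + c + 6, by ring⟩
  have hcop : IsCoprime (4 : ℤ) p := by
    have : Nat.Coprime 4 p := by
      rw [show 4 = 2 ^ 2 from rfl]
      exact (Nat.coprime_primes Nat.prime_two hp).2 hp2.symm |>.pow_left 2
    exact_mod_cast Nat.isCoprime_iff_coprime.2 this
  obtain ⟨c, hc⟩ := hcop.mul_dvd hd4 hd
  obtain ⟨x, y, -, -, ⟨h, -⟩ | ⟨h, -⟩⟩ :=
    pullbackOfReduced (a := p) (b := b) (c := c) (by exact_mod_cast hp.pos) (by linarith)
  · exact ⟨x, y, .inl h⟩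
  · exact ⟨x, y, .inr h⟩

theorem exists_sq_eq_of_emod {a : ℤ} (h2 : a % 2 = 1) (h3 : a % 3 ≠ 0) :
    ∃ i : ℕ, a ^ 2 = 24 * i + 1 := by
  have h : (24 : ℤ) ∣ a ^ 2 - 1 := by
    obtain ⟨k, rfl | rfl⟩ : ∃ k, a = 6 * k + 1 ∨ a = 6 * k - 1 := ⟨(a + 1) / 6, by omega⟩
    · obtain ⟨c, hc⟩ := Int.even_mul_succ_self k
      rcases Int.even_or_odd' k with ⟨c, rfl | rfl⟩
      · exact ⟨6 * c ^ 2 + c, by ring⟩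
      · exact ⟨6 * c ^ 2 + 7 * c + 2, by ring⟩
    · rcases Int.even_or_odd' k with ⟨c, rfl | rfl⟩
      · exact ⟨6 * c ^ 2 - c, by ring⟩
      · exact ⟨6 * c ^ 2 + 5 * c + 1, by ring⟩
  obtain ⟨c, hc⟩ := h
  lift c to ℕ using by nlinarith [sq_nonneg a]
  exact ⟨c, by linarith⟩

theorem coeff_mul_coeff_eq_one {i j : ℕ} {a b : ℤ} (ha : a ^ 2 = 24 * i + 1)
    (hb : b ^ 2 = 24 * j + 1) (h : a % 12 = b % 12) :
    PowerSeries.coeff i P * PowerSeries.coeff j P = 1 := by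
  rw [coeff_pentagonalSeries_of_sq ha, coeff_pentagonalSeries_of_sq hb, h]
  split_ifs <;> simp

theorem coeff_mul_coeff_eq_neg_one {i j : ℕ} {a b : ℤ} (ha : a ^ 2 = 24 * i + 1)
    (hb : b ^ 2 = 24 * j + 1) (h2 : b % 2 = 1) (h3 : b % 3 ≠ 0) (h : a % 12 = 7 * b % 12) :
    PowerSeries.coeff i P * PowerSeries.coeff j P = -1 := by
  rw [coeff_pentagonalSeries_of_sq ha, coeff_pentagonalSeries_of_sq hb]
  have hb12 : b % 12 = 1 ∨ b % 12 = 5 ∨ b % 12 = 7 ∨ b % 12 = 11 := by omega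
  rw [h, Int.mul_emod]
  rcases hb12 with h | h | h | h <;> simp [h]

theorem exists_sq_of_term_ne_zero {p : ℕ} (hp : 0 < p) {x : ℕ × ℕ}
    (hx : x ∈ Finset.HasAntidiagonal.antidiagonal (p - 1))
    (h : (PowerSeries.coeff x.1 P *
      if 23 ∣ x.2 then PowerSeries.coeff (x.2 / 23) P else 0) ≠ 0) :
    ∃ (j : ℕ) (a b : ℤ), x.2 = 23 * j ∧ a ^ 2 = 24 * x.1 + 1 ∧ b ^ 2 = 24 * j + 1 ∧
      a ^ 2 + 23 * b ^ 2 = 24 * p := by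
  obtain ⟨i, k⟩ := x
  have hx := Finset.HasAntidiagonal.mem_antidiagonal.1 hx
  simp only at h hx ⊢
  split_ifs at h with hd
  · obtain ⟨j, rfl⟩ := hd
    rw [Nat.mul_div_cancel_left _ (by norm_num)] at h
    obtain ⟨a, ha⟩ := exists_sq_of_coeff_pentagonalSeries_ne_zero (left_ne_zero_of_mul h)
    obtain ⟨b, hb⟩ := exists_sq_of_coeff_pentagonalSeries_ne_zero (right_ne_zero_of_mul h)
    exact ⟨j, a, b, rfl, ha, hb, by rw [ha, hb]; omega⟩
  · simp at h

theorem ramanujanTau_mod_of_principal {p : ℕ} (hp : p.Prime) (hp2 : p ≠ 2) (hp3 : p ≠ 3)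
    (hp23 : p ≠ 23) {X Y : ℤ} (h : (p : ℤ) = X ^ 2 + X * Y + 6 * Y ^ 2) :
    (ramanujanTau p : ZMod 23) = 2 := by
  have hpZ := Nat.prime_iff_prime_int.1 hp
  have hmod2 : (p : ℤ) % 2 = 1 := by
    have := Nat.odd_iff.1 (hp.odd_of_ne_two hp2); omega
  have hmod3 : (p : ℤ) % 3 ≠ 0 := by
    have := (Nat.prime_dvd_prime_iff_eq Nat.prime_three hp).not.2 hp3.symm; omega
  have hpar : X % 2 = 1 ∧ Y % 2 = 0 := by
    rw [h] at hmod2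
    clear * - hmod2
    rcases Int.emod_two_eq_zero_or_one X with h1 | h1 <;>
    rcases Int.emod_two_eq_zero_or_one Y with h2 | h2 <;>
    simp [pow_two, Int.add_emod, Int.mul_emod, h1, h2] at hmod2 ⊢
  have hthree : X % 3 ≠ 0 ∧ (X + Y) % 3 ≠ 0 := by
    constructor <;> intro h0
    · obtain ⟨c, hc⟩ := Int.dvd_of_emod_eq_zero h0
      rw [h, hc] at hmod3
      exact hmod3 (Int.emod_eq_zero_of_dvd ⟨3 * c ^ 2 + c * Y + 2 * Y ^ 2, by ring⟩)
    · obtain ⟨c, hc⟩ := Int.dvd_of_emod_eq_zero h0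
      rw [h, show X = 3 * c - Y by linarith] at hmod3
      exact hmod3 (Int.emod_eq_zero_of_dvd ⟨3 * c ^ 2 - c * Y + 2 * Y ^ 2, by ring⟩)
  obtain ⟨i₁, hi₁⟩ := exists_sq_eq_of_emod (a := X - 11 * Y) (by omega) (by omega)
  obtain ⟨j₁, hj₁⟩ := exists_sq_eq_of_emod (a := X + Y) (by omega) (by omega)
  obtain ⟨i₂, hi₂⟩ := exists_sq_eq_of_emod (a := X + 12 * Y) (by omega) (by omega)
  obtain ⟨j₂, hj₂⟩ := exists_sq_eq_of_emod (a := X) (by omega) (by omega)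
  have hs₁ : i₁ + 23 * j₁ = p - 1 := by
    have : (24 * (i₁ + 23 * j₁ + 1) : ℤ) = 24 * p := by
      linear_combination 24 * -h - hi₁ - 23 * hj₁
    omega
  have hs₂ : i₂ + 23 * j₂ = p - 1 := by
    have : (24 * (i₂ + 23 * j₂ + 1) : ℤ) = 24 * p := by
      linear_combination 24 * -h - hi₂ - 23 * hj₂
    omega
  have hne : (i₁, 23 * j₁) ≠ (i₂, 23 * j₂) := by
    intro heq
    have hj : j₁ = j₂ := by simp at heq; exact heq.2
    have : Y * (2 * X + Y) = 0 := by
      rw [hj] at hj₁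
      linear_combination hj₁ - hj₂
    rcases mul_eq_zero.1 this with h0 | h0
    · rw [h0] at h
      exact hpZ.irreducible.not_isSquare ⟨X, by linarith⟩
    · have h23 : (p : ℤ) = 23 * X ^ 2 := by
        rw [h, show Y = -2 * X by linarith]; ring
      have : (23 : ℕ) ∣ p := by
        have : (23 : ℤ) ∣ p := ⟨_, h23⟩
        exact_mod_cast this
      exact hp23 ((Nat.prime_dvd_prime_iff_eq (by norm_num) hp).1 this).symm
  have hsum := ramanujanTau_succ_mod (p - 1)
  rw [Nat.sub_add_cancel hp.pos] at hsum
  rw [hsum, Finset.sum_eq_add (i₁, 23 * j₁) (i₂, 23 * j₂) hne]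
  · simp only [dvd_mul_right, if_true, Nat.mul_div_cancel_left _ (show 0 < 23 by norm_num)]
    rw [coeff_mul_coeff_eq_one hi₁ hj₁ (by omega), coeff_mul_coeff_eq_one hi₂ hj₂ (by omega)]
    norm_num
  · intro x hx hx'
    by_contra hne
    obtain ⟨j, a, b, hxj, ha, hb, hab⟩ := exists_sq_of_term_ne_zero hp.pos hx hne
    obtain ⟨h1, h2⟩ | ⟨h1, h2⟩ := sq_eq_of_principal hpZ h hab
    · exact hx'.1 (Prod.ext (by simp only; omega) (by simp only; omega))
    · exact hx'.2 (Prod.ext (by simp only; omega) (by simp only; omega))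
  · intro h
    exact absurd (Finset.HasAntidiagonal.mem_antidiagonal.2 hs₁) h
  · intro h
    exact absurd (Finset.HasAntidiagonal.mem_antidiagonal.2 hs₂) h

theorem ramanujanTau_mod_of_nonprincipal {p : ℕ} (hp : p.Prime) (hp2 : p ≠ 2) (hp3 : p ≠ 3)
    {X Y : ℤ} (h : (p : ℤ) = 2 * X ^ 2 + X * Y + 3 * Y ^ 2) :
    (ramanujanTau p : ZMod 23) = -1 := by
  have hpZ := Nat.prime_iff_prime_int.1 hp
  have hmod2 : (p : ℤ) % 2 = 1 := by
    have := Nat.odd_iff.1 (hp.odd_of_ne_two hp2); omega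
  have hmod3 : (p : ℤ) % 3 ≠ 0 := by
    have := (Nat.prime_dvd_prime_iff_eq Nat.prime_three hp).not.2 hp3.symm; omega
  have hpar : X % 2 = 0 ∧ Y % 2 = 1 := by
    rw [h] at hmod2
    clear * - hmod2
    rcases Int.emod_two_eq_zero_or_one X with h1 | h1 <;>
    rcases Int.emod_two_eq_zero_or_one Y with h2 | h2 <;>
    simp [pow_two, Int.add_emod, Int.mul_emod, h1, h2] at hmod2 ⊢
  have hthree : (Y - X) % 3 ≠ 0 := by
    intro h0
    obtain ⟨c, hc⟩ := Int.dvd_of_emod_eq_zero h0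
    rw [h, show Y = 3 * c + X by linarith] at hmod3
    exact hmod3 (Int.emod_eq_zero_of_dvd ⟨9 * c ^ 2 + 7 * c * X + 2 * X ^ 2, by ring⟩)
  obtain ⟨i, hi⟩ := exists_sq_eq_of_emod (a := 5 * X + 7 * Y) (by omega) (by omega)
  obtain ⟨j, hj⟩ := exists_sq_eq_of_emod (a := Y - X) (by omega) (by omega)
  have hs : i + 23 * j = p - 1 := by
    have : (24 * (i + 23 * j + 1) : ℤ) = 24 * p := by
      linear_combination 24 * -h - hi - 23 * hj
    omega
  have hsum := ramanujanTau_succ_mod (p - 1)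
  rw [Nat.sub_add_cancel hp.pos] at hsum
  rw [hsum, Finset.sum_eq_single (i, 23 * j)]
  · simp only [dvd_mul_right, if_true, Nat.mul_div_cancel_left _ (show 0 < 23 by norm_num)]
    exact coeff_mul_coeff_eq_neg_one hi hj (by omega) hthree (by omega)
  · intro x hx hx'
    by_contra hne
    obtain ⟨k, a, b, hxk, ha, hb, hab⟩ := exists_sq_of_term_ne_zero hp.pos hx hne
    obtain ⟨h1, h2⟩ := sq_eq_of_nonprincipal hpZ hmod2 h hab
    exact hx' (Prod.ext (by simp only; omega) (by simp only; omega))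
  · intro h
    exact absurd (Finset.HasAntidiagonal.mem_antidiagonal.2 hs) h

theorem ramanujanTau_twentyThree_mod : (ramanujanTau 23 : ZMod 23) = 1 := by
  rw [ramanujanTau_succ_mod 22, Finset.sum_eq_single (22, 0)]
  · simpa using coeff_mul_coeff_eq_one (i := 22) (j := 0) (a := 23) (b := -1) (by norm_num)
      (by norm_num) (by norm_num)
  · rintro ⟨i, k⟩ hx hx'
    have := Finset.HasAntidiagonal.mem_antidiagonal.1 hx
    simp only at this ⊢
    rw [if_neg, mul_zero]
    rintro ⟨c, rfl⟩
    exact hx' (by ext <;> simp only <;> omega)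
  · intro h
    exact absurd (Finset.HasAntidiagonal.mem_antidiagonal.2 (show 22 + 0 = 22 from rfl)) h

/-- The congruence for `τ(p)` modulo `23`. -/
theorem ramanujanTau_prime_mod_twentyThree {p : ℕ} (hp : p.Prime) (hp23 : p ≠ 23) :
    ((p : ZMod 23) ^ 11 = -1 ∧ (ramanujanTau p : ZMod 23) = 0) ∨
    ((p : ZMod 23) ^ 11 = 1 ∧
      ((ramanujanTau p : ZMod 23) = 2 ∨ (ramanujanTau p : ZMod 23) = -1)) := by
  have h0 : (p : ZMod 23) ≠ 0 := by
    rw [ne_eq, ZMod.natCast_eq_zero_iff, Nat.prime_dvd_prime_iff_eq (by norm_num) hp]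
    exact hp23.symm
  have hQ : ∀ x : ZMod 23, x ≠ 0 → x ^ 11 = -1 ∨ x ^ 11 = 1 ∧ x = x ^ 6 * x ^ 6 := by decide
  rcases hQ p h0 with hQ | ⟨hQ, hsq⟩
  · refine .inl ⟨hQ, ?_⟩
    have hsum := ramanujanTau_succ_mod (p - 1)
    rw [Nat.sub_add_cancel hp.pos] at hsum
    rw [hsum]
    refine Finset.sum_eq_zero fun x hx => ?_
    by_contra hne
    obtain ⟨k, a, b, -, -, -, hab⟩ := exists_sq_of_term_ne_zero hp.pos hx hne
    have := congrArg (Int.cast : ℤ → ZMod 23) hab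
    push_cast at this
    rw [show (23 : ZMod 23) = 0 from rfl, show (24 : ZMod 23) = 1 from rfl, zero_mul, add_zero,
      one_mul] at this
    rw [← this] at hQ
    clear * - hQ
    generalize (a : ZMod 23) = a at hQ
    revert a
    decide
  · refine .inr ⟨hQ, ?_⟩
    by_cases hp2 : p = 2
    · rw [hp2, ramanujanTau_small.1]
      exact .inr (by decide)
    by_cases hp3 : p = 3
    · rw [hp3, ramanujanTau_small.2.1]
      exact .inr (by decide)
    obtain ⟨X, Y, h | h⟩ := exists_eq_reduced_of_isSquare hp hp2 hp23 ⟨_, hsq⟩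
    · exact .inl (ramanujanTau_mod_of_principal hp hp2 hp3 hp23 h)
    · exact .inr (ramanujanTau_mod_of_nonprincipal hp hp2 hp3 h)

end

end RamanujanTau

namespace RamanujanTau

/-- The Lucas sequence with parameters `t` and `Q`. -/
def lucasU {R : Type*} [CommRing R] (t Q : R) : ℕ → R
  | 0 => 0
  | 1 => 1
  | n + 2 => t * lucasU t Q (n + 1) - Q * lucasU t Q n

section

variable {R : Type*} [CommRing R] (t Q : R)

@[simp] theorem lucasU_zero : lucasU t Q 0 = 0 := rfl

@[simp] theorem lucasU_one : lucasU t Q 1 = 1 := rfl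

theorem lucasU_add_two (n : ℕ) :
    lucasU t Q (n + 2) = t * lucasU t Q (n + 1) - Q * lucasU t Q n := rfl

theorem lucasU_two : lucasU t Q 2 = t := by simp [lucasU_add_two]

theorem lucasU_three : lucasU t Q 3 = t ^ 2 - Q := by
  rw [lucasU_add_two, lucasU_two, lucasU_one]
  ring

theorem lucasU_five : lucasU t Q 5 = (t ^ 2) ^ 2 - 3 * t ^ 2 * Q + Q ^ 2 := by
  rw [lucasU_add_two, lucasU_add_two, lucasU_three, lucasU_two]
  ring

theorem lucasU_seven : lucasU t Q 7 =
    (t ^ 2) ^ 3 - 5 * (t ^ 2) ^ 2 * Q + 6 * t ^ 2 * Q ^ 2 - Q ^ 3 := by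
  rw [lucasU_add_two, lucasU_add_two, lucasU_five, lucasU_add_two, lucasU_three, lucasU_two]
  ring

theorem lucasU_add (m n : ℕ) : lucasU t Q (m + (n + 1)) =
    lucasU t Q (m + 1) * lucasU t Q (n + 1) - Q * lucasU t Q m * lucasU t Q n := by
  induction m using Nat.twoStepInduction with
  | zero => simp
  | one =>
    rw [add_comm 1, add_assoc, lucasU_add_two, lucasU_two, lucasU_one, mul_one]
  | more m ih₁ ih₂ =>
    rw [show m + 2 + (n + 1) = m + (n + 1) + 2 by ring, lucasU_add_two,
      show m + (n + 1) + 1 = m + 1 + (n + 1) by ring, ih₁, ih₂, lucasU_add_two t Q (m + 1),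
      lucasU_add_two t Q m]
    ring

theorem lucasU_dvd (d k : ℕ) : lucasU t Q d ∣ lucasU t Q (d * k) := by
  induction k with
  | zero => simp
  | succ k ih =>
    rcases d with _ | d
    · simp
    · rw [Nat.mul_succ, lucasU_add t Q _ d]
      exact dvd_sub (Dvd.intro_left _ rfl) ((ih.mul_left Q).mul_right _)

theorem map_lucasU {S : Type*} [CommRing S] (f : R →+* S) (n : ℕ) :
    f (lucasU t Q n) = lucasU (f t) (f Q) n := by
  induction n using Nat.twoStepInduction with
  | zero => simp
  | one => simp
  | more n ih₁ ih₂ => simp [lucasU_add_two, ih₁, ih₂]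

variable {t Q}

theorem pow_dvd_lucasU {d : R} (ht : d ∣ t) (hQ : d ^ 2 ∣ Q) (n : ℕ) :
    d ^ n ∣ lucasU t Q (n + 1) := by
  induction n using Nat.twoStepInduction with
  | zero => simp
  | one => simpa [lucasU_two] using ht
  | more n ih₁ ih₂ =>
    rw [lucasU_add_two]
    refine dvd_sub ?_ ?_
    · rw [pow_succ']
      exact mul_dvd_mul ht ih₂
    · rw [add_comm n, pow_add]
      exact mul_dvd_mul hQ ih₁

theorem lucasU_mod_eq_zero [IsDomain R] {k n : ℕ} (h0 : lucasU t Q k = 0)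
    (h1 : lucasU t Q (k + 1) ≠ 0) (hn : lucasU t Q n = 0) : lucasU t Q (n % k) = 0 := by
  have h : ∀ m r, lucasU t Q (r + k * m) = lucasU t Q (k + 1) ^ m * lucasU t Q r := by
    intro m r
    induction m with
    | zero => simp
    | succ m ih =>
      rcases hr : r + k * m with _ | s
      · rw [Nat.mul_succ, ← add_assoc, hr, zero_add, h0, pow_succ', mul_assoc, ← ih, hr]
        simp
      · rw [Nat.mul_succ, ← add_assoc, add_comm, hr, lucasU_add, h0, ← hr, ih]
        ring
  rw [← Nat.mod_add_div n k, h] at hn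
  exact (mul_eq_zero.1 hn).resolve_left (pow_ne_zero _ h1)

end

theorem ramanujanTau_prime_pow_eq_lucasU {p : ℕ} (hp : p.Prime) (k : ℕ) :
    ramanujanTau (p ^ k) = lucasU (ramanujanTau p) ((p : ℤ) ^ 11) (k + 1) := by
  induction k using Nat.twoStepInduction with
  | zero => simp [ramanujanTau_one]
  | one => simp [lucasU_two]
  | more k ih₁ ih₂ => rw [ramanujanTau_prime_pow_add_two hp, ih₁, ih₂, ← lucasU_add_two]

theorem three_dvd_of_lucasU_eq_zero {t Q : ZMod 3} (hQ : Q ≠ 0) {n : ℕ} (hn : n % 2 = 1)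
    (h : lucasU t Q n = 0) : 3 ∣ n ∧ lucasU t Q 3 = 0 := by
  have key : ∀ t Q : ZMod 3, Q ≠ 0 →
      (lucasU t Q 3 = 0 ∧ lucasU t Q 4 ≠ 0 ∧ lucasU t Q 2 ≠ 0) ∨
      (lucasU t Q 4 = 0 ∧ lucasU t Q 5 ≠ 0 ∧ lucasU t Q 3 ≠ 0) := by decide
  have : Fact (Nat.Prime 3) := ⟨Nat.prime_three⟩
  rcases key t Q hQ with ⟨h0, h1, h2⟩ | ⟨h0, h1, h2⟩
  · have := lucasU_mod_eq_zero h0 h1 h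
    have h3 : n % 3 = 0 ∨ n % 3 = 1 ∨ n % 3 = 2 := by omega
    rcases h3 with h3 | h3 | h3
    · exact ⟨Nat.dvd_of_mod_eq_zero h3, h0⟩
    · simp [h3] at this
    · exact absurd (by rwa [h3] at this) h2
  · have := lucasU_mod_eq_zero h0 h1 h
    have h3 : n % 4 = 1 ∨ n % 4 = 3 := by omega
    rcases h3 with h3 | h3
    · simp [h3] at this
    · exact absurd (by rwa [h3] at this) h2

theorem five_dvd_of_lucasU_eq_zero {x : ZMod 5} (hx : x ≠ 0) {n : ℕ} (hn : n % 2 = 1)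
    (h : lucasU (x + x ^ 2) (x ^ 11) n = 0) : 5 ∣ n ∧ lucasU (x + x ^ 2) (x ^ 11) 5 = 0 := by
  have key : ∀ x : ZMod 5, x ≠ 0 →
      (lucasU (x + x ^ 2) (x ^ 11) 5 = 0 ∧ lucasU (x + x ^ 2) (x ^ 11) 6 ≠ 0 ∧
        ∀ i < 5, i ≠ 0 → lucasU (x + x ^ 2) (x ^ 11) i ≠ 0) ∨
      (lucasU (x + x ^ 2) (x ^ 11) 4 = 0 ∧ lucasU (x + x ^ 2) (x ^ 11) 5 ≠ 0 ∧
        lucasU (x + x ^ 2) (x ^ 11) 3 ≠ 0) := by decide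
  have : Fact (Nat.Prime 5) := ⟨Nat.prime_five⟩
  rcases key x hx with ⟨h0, h1, h2⟩ | ⟨h0, h1, h2⟩
  · have := lucasU_mod_eq_zero h0 h1 h
    refine ⟨Nat.dvd_of_mod_eq_zero ?_, h0⟩
    by_contra hne
    exact h2 _ (Nat.mod_lt _ (by norm_num)) hne this
  · have := lucasU_mod_eq_zero h0 h1 h
    have h3 : n % 4 = 1 ∨ n % 4 = 3 := by omega
    rcases h3 with h3 | h3
    · simp [h3] at this
    · exact absurd (by rwa [h3] at this) h2

theorem seven_dvd_of_lucasU_eq_zero {x : ZMod 7} (hx : x ≠ 0) {n : ℕ} (hn : n % 2 = 1)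
    (h : lucasU (x + x ^ 4) (x ^ 11) n = 0) : 7 ∣ n ∧ lucasU (x + x ^ 4) (x ^ 11) 7 = 0 := by
  have key : ∀ x : ZMod 7, x ≠ 0 →
      (lucasU (x + x ^ 4) (x ^ 11) 7 = 0 ∧ lucasU (x + x ^ 4) (x ^ 11) 8 ≠ 0 ∧
        ∀ i < 7, i ≠ 0 → lucasU (x + x ^ 4) (x ^ 11) i ≠ 0) ∨
      (lucasU (x + x ^ 4) (x ^ 11) 2 = 0 ∧ lucasU (x + x ^ 4) (x ^ 11) 3 ≠ 0) := by decide
  have : Fact (Nat.Prime 7) := ⟨Nat.prime_seven⟩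
  rcases key x hx with ⟨h0, h1, h2⟩ | ⟨h0, h1⟩
  · have := lucasU_mod_eq_zero h0 h1 h
    refine ⟨Nat.dvd_of_mod_eq_zero ?_, h0⟩
    by_contra hne
    exact h2 _ (Nat.mod_lt _ (by norm_num)) hne this
  · have := lucasU_mod_eq_zero h0 h1 h
    simp [hn] at this

end RamanujanTau

namespace RamanujanTau

theorem odd_of_dvd {a b : ℤ} (h : a ∣ b) (hb : b % 2 = 1) : a % 2 = 1 := by
  obtain ⟨c, rfl⟩ := h
  exact Int.odd_iff.1 (Int.odd_mul.1 (Int.odd_iff.2 hb)).1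

theorem even_index_of_odd_ramanujanTau {p k : ℕ} (hp : p.Prime) (h : ramanujanTau (p ^ k) % 2 = 1) :
    (k + 1) % 2 = 1 := by
  by_contra hk
  obtain ⟨m, hm⟩ : 2 ∣ k + 1 := by omega
  rw [ramanujanTau_prime_pow_eq_lucasU hp, hm] at h
  have := odd_of_dvd (lucasU_dvd _ _ 2 m) h
  rw [lucasU_two] at this
  have := even_ramanujanTau_prime hp
  rw [Int.even_iff] at this
  omega

/-- If `ℓ ∈ {3, 5, 7}`, no odd `α` with `|α| < 100` is divisible by `τ(ℓ ^ k)` with `k > 0`. -/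
theorem not_ramanujanTau_pow_dvd {p k : ℕ} (hp : p = 3 ∨ p = 5 ∨ p = 7) (hk : k ≠ 0) {α : ℤ}
    (hα : α % 2 = 1) (hlt : |α| < 100) : ¬ ramanujanTau (p ^ k) ∣ α := by
  intro h
  have hprime : p.Prime := by rcases hp with rfl | rfl | rfl <;> norm_num
  have hk2 := even_index_of_odd_ramanujanTau hprime (odd_of_dvd h hα)
  have hle : |ramanujanTau (p ^ k)| < 100 :=
    (Int.le_of_dvd (abs_pos.2 (by omega)) (by rwa [abs_dvd_abs])).trans_lt hlt
  have h0 : ramanujanTau (p ^ k) ≠ 0 := by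
    intro h0
    rw [h0, zero_dvd_iff] at h
    omega
  rw [ramanujanTau_prime_pow_eq_lucasU hprime] at hle h0
  by_cases h2 : k = 2
  · subst h2
    rw [lucasU_three] at hle
    rcases hp with rfl | rfl | rfl
    · rw [ramanujanTau_small.2.1] at hle
      norm_num at hle
    · rw [ramanujanTau_small.2.2.1] at hle
      norm_num at hle
    · rw [ramanujanTau_small.2.2.2] at hle
      norm_num at hle
  · obtain ⟨d, hd, hdt, hdQ⟩ : ∃ d : ℤ, 4 < d ∧ d ∣ ramanujanTau p ∧ d ^ 2 ∣ (p : ℤ) ^ 11 := by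
      rcases hp with rfl | rfl | rfl
      · exact ⟨9, by norm_num, by rw [ramanujanTau_small.2.1]; norm_num, by norm_num⟩
      · exact ⟨5, by norm_num, by rw [ramanujanTau_small.2.2.1]; norm_num, by norm_num⟩
      · exact ⟨7, by norm_num, by rw [ramanujanTau_small.2.2.2]; norm_num, by norm_num⟩
    have h4 : d ^ 4 ∣ lucasU (ramanujanTau p) ((p : ℤ) ^ 11) (k + 1) :=
      (pow_dvd_pow d (by omega)).trans (pow_dvd_lucasU hdt hdQ k)
    have := Int.le_of_dvd (abs_pos.2 h0) ((dvd_abs _ _).2 h4)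
    have : (4 : ℤ) ^ 4 ≤ d ^ 4 := pow_le_pow_left₀ (by norm_num) hd.le 4
    omega

theorem natCast_zmod_ne_zero {l p : ℕ} (hl : l.Prime) (hp : p.Prime) (h : p ≠ l) :
    (p : ZMod l) ≠ 0 := by
  rw [ne_eq, ZMod.natCast_eq_zero_iff, Nat.prime_dvd_prime_iff_eq hl hp]
  exact h.symm

theorem dvd_of_lucasU_dvd {p k d : ℕ} (hp : p.Prime) (hd : d ∣ k + 1) :
    lucasU (ramanujanTau p) ((p : ℤ) ^ 11) d ∣ ramanujanTau (p ^ k) := by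
  obtain ⟨m, hm⟩ := hd
  rw [ramanujanTau_prime_pow_eq_lucasU hp, hm]
  exact lucasU_dvd _ _ d m

theorem intCast_lucasU {l : ℕ} (t Q : ℤ) (n : ℕ) :
    ((lucasU t Q n : ℤ) : ZMod l) = lucasU (t : ZMod l) (Q : ZMod l) n :=
  map_lucasU t Q (Int.castRingHom (ZMod l)) n

/-- The reductions of `τ(p)` and `p ^ 11` modulo `23`. -/
theorem ramanujanTau_mod_cases {p : ℕ} (hp : p.Prime) :
    let t : ZMod 23 := (ramanujanTau p : ℤ)
    let Q : ZMod 23 := ((p : ℤ) ^ 11 : ℤ)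
    (t = 0 ∧ Q = -1) ∨ (t = 1 ∧ Q = 0) ∨ (t = -1 ∧ Q = 1) ∨ (t = 2 ∧ Q = 1) := by
  intro t Q
  have hQ : Q = (p : ZMod 23) ^ 11 := by simp [Q]
  rw [hQ]
  by_cases hp23 : p = 23
  · subst hp23
    exact .inr (.inl ⟨ramanujanTau_twentyThree_mod, by decide⟩)
  · rcases ramanujanTau_prime_mod_twentyThree hp hp23 with h | ⟨h1, h2 | h2⟩
    · exact .inl ⟨h.2, h.1⟩
    · exact .inr (.inr (.inr ⟨h2, h1⟩))
    · exact .inr (.inr (.inl ⟨h2, h1⟩))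

theorem dvd_sub_of_mod {t Q : ℤ} (h : (t : ZMod 23) = 2 ∧ (Q : ZMod 23) = 1) :
    23 ∣ t - 2 ∧ 23 ∣ Q - 1 := by
  rw [← Nat.cast_ofNat (n := 23), ← ZMod.intCast_zmod_eq_zero_iff_dvd,
    ← ZMod.intCast_zmod_eq_zero_iff_dvd]
  push_cast
  rw [h.1, h.2, sub_self, sub_self]
  exact ⟨rfl, rfl⟩

theorem pow_eleven_ne_one {p : ℕ} (hp : p.Prime) : (p : ℤ) ^ 11 ≠ 1 := by
  exact_mod_cast (Nat.one_lt_pow (by norm_num) hp.one_lt).ne'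

theorem not_two_dvd_of_odd_lucasU {p : ℕ} (hp : p.Prime) {n : ℕ}
    (h : lucasU (ramanujanTau p) ((p : ℤ) ^ 11) (n + 2) % 2 = 1) : ¬ (2 : ℤ) ∣ p := by
  intro h2
  have h2 : 2 ∣ (p : ℤ) ^ 11 := h2.trans (dvd_pow_self _ (by norm_num))
  have := dvd_sub ((even_ramanujanTau_prime hp).two_dvd.mul_right
    (lucasU (ramanujanTau p) ((p : ℤ) ^ 11) (n + 1)))
    (h2.mul_right (lucasU (ramanujanTau p) ((p : ℤ) ^ 11) n))
  rw [← lucasU_add_two] at this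
  omega

theorem emod_eq_of_cast_eq {β : ℤ} (c : ℤ) (h : (β : ZMod 23) = c) : β % 23 = c % 23 :=
  (ZMod.intCast_eq_intCast_iff' _ _ 23).1 h

theorem lucasU_three_ne {p : ℕ} (hp : p.Prime) {β : ℤ} (hodd : β % 2 = 1) (hlt : |β| < 90)
    (h23 : ¬ 23 ∣ β) (h3 : 3 ∣ β) : lucasU (ramanujanTau p) ((p : ℤ) ^ 11) 3 ≠ β := by
  intro h
  rw [abs_lt] at hlt
  have hmod := ramanujanTau_mod_cases hp
  have hc := congrArg (Int.cast : ℤ → ZMod 23) h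
  rw [intCast_lucasU, lucasU_three] at hc
  have hβ : β = -45 ∨ β = 3 ∧ ((ramanujanTau p : ℤ) : ZMod 23) = 2 ∧
      (((p : ℤ) ^ 11 : ℤ) : ZMod 23) = 1 := by
    rcases hmod with ⟨h1, h2⟩ | ⟨h1, h2⟩ | ⟨h1, h2⟩ | ⟨h1, h2⟩ <;> rw [h1, h2] at hc
    · have := emod_eq_of_cast_eq 1 (hc.symm.trans (by decide))
      omega
    · have := emod_eq_of_cast_eq 1 (hc.symm.trans (by decide))
      omega
    · have := emod_eq_of_cast_eq 0 (hc.symm.trans (by decide))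
      omega
    · have := emod_eq_of_cast_eq 3 (hc.symm.trans (by decide))
      exact .inr ⟨by omega, h1, h2⟩
  rcases hβ with rfl | ⟨rfl, hβ⟩
  · by_cases hp5 : p = 5
    · subst hp5
      rw [lucasU_three, ramanujanTau_small.2.2.1] at h
      norm_num at h
    · have h5 := congrArg (Int.cast : ℤ → ZMod 5) h
      rw [intCast_lucasU, lucasU_three, ramanujanTau_prime_congr_five hp] at h5
      push_cast at h5
      have key : ∀ x : ZMod 5, x ≠ 0 → (x + x ^ 2) ^ 2 - x ^ 11 ≠ -45 := by decide
      exact key p (natCast_zmod_ne_zero (by norm_num) hp hp5) h5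
  · obtain ⟨ht, -⟩ := dvd_sub_of_mod hβ
    have hp2 := not_two_dvd_of_odd_lucasU hp (n := 1) (by rw [h]; rfl)
    rw [lucasU_three] at h
    have ht7 : 7 ∣ ramanujanTau p - 2 := by
      by_cases hp7 : p = 7
      · subst hp7
        rw [ramanujanTau_small.2.2.2] at h
        norm_num at h
      · have h7 := congrArg (Int.cast : ℤ → ZMod 7) h
        push_cast at h7
        rw [ramanujanTau_prime_congr_seven hp] at h7
        have key : ∀ x : ZMod 7, (x + x ^ 4) ^ 2 - x ^ 11 = 3 → x ≠ 0 → x + x ^ 4 - 2 = 0 := by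
          decide
        have := key p h7 (natCast_zmod_ne_zero (by norm_num) hp hp7)
        rw [← ramanujanTau_prime_congr_seven hp] at this
        exact (ZMod.intCast_zmod_eq_zero_iff_dvd _ 7).1 (by exact_mod_cast this)
    have := sq_eq_pow_eleven_add_three (t := ramanujanTau p) (q := p) (by linarith) hp2 ht7 ht
    rw [this] at h
    exact pow_eleven_ne_one hp (by linarith)

theorem lucasU_five_ne {p : ℕ} (hp : p.Prime) {β : ℤ} (hodd : β % 2 = 1) (hlt : |β| < 90)
    (h5 : 5 ∣ β) : lucasU (ramanujanTau p) ((p : ℤ) ^ 11) 5 ≠ β := by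
  intro h
  rw [abs_lt] at hlt
  have hmod := ramanujanTau_mod_cases hp
  have hc := congrArg (Int.cast : ℤ → ZMod 23) h
  rw [intCast_lucasU, lucasU_five] at hc
  have hβ : 9 ∣ β ∨ β = 5 ∧ ((ramanujanTau p : ℤ) : ZMod 23) = 2 ∧
      (((p : ℤ) ^ 11 : ℤ) : ZMod 23) = 1 := by
    rcases hmod with ⟨h1, h2⟩ | ⟨h1, h2⟩ | ⟨h1, h2⟩ | ⟨h1, h2⟩ <;> rw [h1, h2] at hc
    · have := emod_eq_of_cast_eq 1 (hc.symm.trans (by decide))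
      omega
    · have := emod_eq_of_cast_eq 1 (hc.symm.trans (by decide))
      omega
    · have := emod_eq_of_cast_eq (-1) (hc.symm.trans (by decide))
      omega
    · have := emod_eq_of_cast_eq 5 (hc.symm.trans (by decide))
      exact .inr ⟨by omega, h1, h2⟩
  rcases hβ with h9 | ⟨rfl, hβ⟩
  · by_cases hp3 : p = 3
    · subst hp3
      rw [lucasU_five, ramanujanTau_small.2.1] at h
      norm_num at h
      omega
    · have h3 := congrArg (Int.cast : ℤ → ZMod 3) h
      rw [intCast_lucasU, lucasU_five,
        (ZMod.intCast_zmod_eq_zero_iff_dvd β 3).2 (dvd_trans (by norm_num) h9)] at h3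
      push_cast at h3
      have key : ∀ t x : ZMod 3, x ≠ 0 → (t ^ 2) ^ 2 - 3 * t ^ 2 * x ^ 11 + (x ^ 11) ^ 2 ≠ 0 := by
        decide
      exact key _ p (natCast_zmod_ne_zero (by norm_num) hp hp3) h3
  · rw [lucasU_five] at h
    exact pow_eleven_ne_one hp
      (eq_one_of_quintic h (pow_pos (by exact_mod_cast hp.pos) _) (dvd_sub_of_mod hβ).2)

theorem lucasU_seven_ne {p : ℕ} (hp : p.Prime) {β : ℤ} (hodd : β % 2 = 1) (hlt : |β| < 100)
    (h7 : 7 ∣ β) : lucasU (ramanujanTau p) ((p : ℤ) ^ 11) 7 ≠ β := by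
  intro h
  rw [abs_lt] at hlt
  have hmod := ramanujanTau_mod_cases hp
  have hc := congrArg (Int.cast : ℤ → ZMod 23) h
  rw [intCast_lucasU, lucasU_seven] at hc
  have hβ : β = -91 ∨ β = 7 ∧ ((ramanujanTau p : ℤ) : ZMod 23) = 2 ∧
      (((p : ℤ) ^ 11 : ℤ) : ZMod 23) = 1 := by
    rcases hmod with ⟨h1, h2⟩ | ⟨h1, h2⟩ | ⟨h1, h2⟩ | ⟨h1, h2⟩ <;> rw [h1, h2] at hc
    · have := emod_eq_of_cast_eq 1 (hc.symm.trans (by decide))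
      omega
    · have := emod_eq_of_cast_eq 1 (hc.symm.trans (by decide))
      omega
    · have := emod_eq_of_cast_eq 1 (hc.symm.trans (by decide))
      omega
    · have := emod_eq_of_cast_eq 7 (hc.symm.trans (by decide))
      exact .inr ⟨by omega, h1, h2⟩
  rcases hβ with rfl | ⟨rfl, hβ⟩
  · have h5 := congrArg (Int.cast : ℤ → ZMod 5) h
    rw [intCast_lucasU, lucasU_seven, ramanujanTau_prime_congr_five hp] at h5
    push_cast at h5
    have key : ∀ x : ZMod 5, ((x + x ^ 2) ^ 2) ^ 3 - 5 * ((x + x ^ 2) ^ 2) ^ 2 * x ^ 11 +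
        6 * (x + x ^ 2) ^ 2 * (x ^ 11) ^ 2 - (x ^ 11) ^ 3 ≠ -91 := by decide
    exact key p h5
  · rw [lucasU_seven] at h
    obtain ⟨ht, hQ⟩ := dvd_sub_of_mod hβ
    exact pow_eleven_ne_one hp (eq_one_of_heptic h (even_ramanujanTau_prime hp).two_dvd ht hQ)

/-- The common shape of the reductions for `ℓ = 3, 5, 7`. -/
theorem exists_lucasU_dvd {l n : ℕ} (hl : l = 3 ∨ l = 5 ∨ l = 7) (hn : n ≠ 0)
    (hodd : ramanujanTau n % 2 = 1) (hlt : |ramanujanTau n| < 100)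
    (h : (l : ℤ) ∣ ramanujanTau n) : ∃ p : ℕ, p.Prime ∧
      lucasU (ramanujanTau p) ((p : ℤ) ^ 11) l ∣ ramanujanTau n ∧
      (l : ℤ) ∣ lucasU (ramanujanTau p) ((p : ℤ) ^ 11) l := by
  have hprime : l.Prime := by rcases hl with rfl | rfl | rfl <;> norm_num
  obtain ⟨p, k, hp, hlk, hkn⟩ :=
    exists_prime_pow_of_dvd_ramanujanTau (Nat.prime_iff_prime_int.1 hprime) hn h
  have hk : k ≠ 0 := by
    rintro rfl
    rw [pow_zero, ramanujanTau_one] at hlk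
    exact hprime.one_lt.ne' (by exact_mod_cast Int.eq_one_of_dvd_one (by positivity) hlk)
  have hpl : p ≠ l := by
    rintro rfl
    exact not_ramanujanTau_pow_dvd hl hk hodd hlt hkn
  have hk2 := even_index_of_odd_ramanujanTau hp (odd_of_dvd hkn hodd)
  have hp0 := natCast_zmod_ne_zero hprime hp hpl
  suffices l ∣ k + 1 ∧ ((lucasU (ramanujanTau p) ((p : ℤ) ^ 11) l : ℤ) : ZMod l) = 0 from
    ⟨p, hp, (dvd_of_lucasU_dvd hp this.1).trans hkn,
      (ZMod.intCast_zmod_eq_zero_iff_dvd _ _).1 this.2⟩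
  rw [← ZMod.intCast_zmod_eq_zero_iff_dvd, ramanujanTau_prime_pow_eq_lucasU hp,
    intCast_lucasU] at hlk
  rw [intCast_lucasU]
  push_cast at hlk ⊢
  rcases hl with rfl | rfl | rfl
  · have := Fact.mk hprime
    exact three_dvd_of_lucasU_eq_zero (pow_ne_zero _ hp0) hk2 hlk
  · rw [ramanujanTau_prime_congr_five hp] at hlk ⊢
    exact five_dvd_of_lucasU_eq_zero hp0 hk2 hlk
  · rw [ramanujanTau_prime_congr_seven hp] at hlk ⊢
    exact seven_dvd_of_lucasU_eq_zero hp0 hk2 hlk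

theorem abs_le_of_dvd {a b : ℤ} (h : a ∣ b) (hb : b % 2 = 1) : |a| ≤ |b| :=
  Int.le_of_dvd (abs_pos.2 (by omega)) (by rwa [abs_dvd_abs])

theorem not_three_dvd_ramanujanTau {n : ℕ} (hn : n ≠ 0) (hodd : ramanujanTau n % 2 = 1)
    (hlt : |ramanujanTau n| < 90) (h23 : ¬ 23 ∣ ramanujanTau n) : ¬ 3 ∣ ramanujanTau n := by
  intro h
  obtain ⟨p, hp, h1, h2⟩ := exists_lucasU_dvd (.inl rfl) hn hodd (by omega) h
  exact lucasU_three_ne hp (odd_of_dvd h1 hodd) ((abs_le_of_dvd h1 hodd).trans_lt hlt)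
    (fun h => h23 (h.trans h1)) h2 rfl

theorem not_five_dvd_ramanujanTau {n : ℕ} (hn : n ≠ 0) (hodd : ramanujanTau n % 2 = 1)
    (hlt : |ramanujanTau n| < 90) : ¬ 5 ∣ ramanujanTau n := by
  intro h
  obtain ⟨p, hp, h1, h2⟩ := exists_lucasU_dvd (.inr (.inl rfl)) hn hodd (by omega) h
  exact lucasU_five_ne hp (odd_of_dvd h1 hodd) ((abs_le_of_dvd h1 hodd).trans_lt hlt) h2 rfl

theorem not_seven_dvd_ramanujanTau {n : ℕ} (hn : n ≠ 0) (hodd : ramanujanTau n % 2 = 1)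
    (hlt : |ramanujanTau n| < 100) : ¬ 7 ∣ ramanujanTau n := by
  intro h
  obtain ⟨p, hp, h1, h2⟩ := exists_lucasU_dvd (.inr (.inr rfl)) hn hodd hlt h
  exact lucasU_seven_ne hp (odd_of_dvd h1 hodd) ((abs_le_of_dvd h1 hodd).trans_lt hlt) h2 rfl

end RamanujanTau

theorem tau_avoids_odd_values (n : ℕ) (hn : 1 < n) :
    ramanujanTau n ∉
      ({-9, 15, -15, 21, -21, -25, -27, -33, 35, -35, 45, -45, 49, -49, -55,
        63, -63, 77, -77, -81, 91, -91} : Set ℤ) := by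
  intro h
  have h3 := RamanujanTau.not_three_dvd_ramanujanTau (n := n) (by omega)
  have h5 := RamanujanTau.not_five_dvd_ramanujanTau (n := n) (by omega)
  have h7 := RamanujanTau.not_seven_dvd_ramanujanTau (n := n) (by omega)
  simp only [abs_lt] at h3 h5 h7
  simp only [Set.mem_insert_iff, Set.mem_singleton_iff] at h
  generalize ramanujanTau n = a at h h3 h5 h7
  omega
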